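/- Let K_0 be a convex body in R^n with nonempty interior, let s_0 ≥ 2 and 0 < ε < 1. If K_{s_0} is any convex body whose surface tensors up to rank s_0 coincide with those of K_0, then δ^t(K_0, K_{s_0}) ≤ c(n, ε, Φ_{n-1}^2(K_0)) s_0^{−(1−ε)/(4n)}, where c depends only on n, ε and the rank-2 surface tensor of K_0. Consequently, any sequence (K_{s_0}) with Φ_{n-1}^s(K_{s_0}) = Φ_{n-1}^s(K_0) for 0 ≤ s ≤ s_0 converges in shape (translative Hausdorff distance) to K_0 as s_0 → ∞. -/

import Mathlib

open MeasureTheory Metric Real Filter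
open scoped InnerProductSpace ENNReal NNReal Topology

noncomputable section

abbrev En (n : ℕ) := EuclideanSpace ℝ (Fin n)

abbrev Sph (n : ℕ) : Set (En n) := Metric.sphere 0 1

/-- `μ` is the surface area measure `S_{n-1}(K, ·)` of the convex body `K`. -/
def IsSurfaceAreaMeasure {n : ℕ} (K : Set (En n)) (μ : Measure (Sph n)) : Prop :=
  ((interior K).Nonempty ∧ ∀ ω : Set (Sph n), MeasurableSet ω →
      μ ω = μH[((n : ℝ) - 1)]
        {x ∈ frontier K | ∃ u ∈ ω, ∀ y ∈ K, ⟪y - x, (u : En n)⟫_ℝ ≤ 0})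
  ∨ (interior K = ∅ ∧ ∃ u u' : Sph n, (u' : En n) = -(u : En n) ∧
      (∃ c : ℝ, ∀ x ∈ K, ⟪x, (u : En n)⟫_ℝ = c) ∧
      μ = (μH[((n : ℝ) - 1)] K) • (Measure.dirac u + Measure.dirac u'))

/-- The moment of a Borel measure on the sphere corresponding to the
multi-index `i : Fin n → ℕ`. -/
def sphMoment {n : ℕ} (μ : Measure (Sph n)) (i : Fin n → ℕ) : ℝ :=
  ∫ u, ∏ j, ((u : En n) j) ^ (i j) ∂μ

/-- The coefficient matrix of the rank-2 surface tensor `Φ_{n-1}²`. -/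
def rank2TensorMatrix {n : ℕ} (μ : Measure (Sph n)) : Matrix (Fin n) (Fin n) ℝ :=
  Matrix.of fun i j => (1 / (8 * π)) * ∫ u, (u : En n) i * (u : En n) j ∂μ

/-- The translative Hausdorff distance `δᵗ(K, L) = inf_x δ(K, L + x)`. -/
def transHausdorffDist {n : ℕ} (K L : Set (En n)) : ℝ :=
  ⨅ x : En n, Metric.hausdorffDist K ((fun y => y + x) '' L)

/-- Quantile function of a positive continuous density on an open interval. -/
theorem exists_quantile {f : ℝ → ℝ} {a₀ a₁ : ℝ} (hlt : a₀ < a₁)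
    (hc : ContinuousOn f (Set.Ioo a₀ a₁)) (hpos : ∀ x ∈ Set.Ioo a₀ a₁, 0 < f x)
    (hintg : IntervalIntegrable f volume a₀ a₁) :
    0 < (∫ t in a₀..a₁, f t) ∧
    ∃ a : ℝ → ℝ, (∀ τ ∈ Set.Ioo (0 : ℝ) 1, a τ ∈ Set.Ioo a₀ a₁ ∧
        (∫ t in a₀..a τ, f t) = τ * ∫ t in a₀..a₁, f t) ∧
      StrictMonoOn a (Set.Ioo 0 1) ∧
      (∀ τ ∈ Set.Ioo (0 : ℝ) 1, HasDerivAt a ((∫ t in a₀..a₁, f t) / f (a τ)) τ) ∧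
      a '' Set.Ioo 0 1 = Set.Ioo a₀ a₁ := by
  have hsub : ∀ {x y : ℝ}, x ∈ Set.Icc a₀ a₁ → y ∈ Set.Icc a₀ a₁ →
      IntervalIntegrable f volume x y := by
    intro x y hx hy
    refine hintg.mono_set ?_
    rw [Set.uIcc_of_le hlt.le]
    exact Set.uIcc_subset_Icc hx hy
  have hmono : StrictMonoOn (fun x => ∫ t in a₀..x, f t) (Set.Icc a₀ a₁) := by
    intro x hx y hy hxy
    have h1 := intervalIntegral.integral_add_adjacent_intervals
      (hsub (Set.left_mem_Icc.2 hlt.le) hx) (hsub hx hy)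
    have h2 : 0 < ∫ t in x..y, f t := by
      refine intervalIntegral.intervalIntegral_pos_of_pos_on (hsub hx hy) ?_ hxy
      intro t ht
      exact hpos t ⟨hx.1.trans_lt ht.1, ht.2.trans_le hy.2⟩
    simp only
    linarith
  have hV : 0 < ∫ t in a₀..a₁, f t := by
    have := hmono (Set.left_mem_Icc.2 hlt.le) (Set.right_mem_Icc.2 hlt.le) hlt
    simpa using this
  refine ⟨hV, ?_⟩
  set V := ∫ t in a₀..a₁, f t with hVdef
  have hFc : ContinuousOn (fun x => ∫ t in a₀..x, f t) (Set.Icc a₀ a₁) := by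
    have := intervalIntegral.continuousOn_primitive_interval' hintg (Set.left_mem_uIcc)
    rwa [Set.uIcc_of_le hlt.le] at this
  have hFd : ∀ x ∈ Set.Ioo a₀ a₁, HasDerivAt (fun x => ∫ t in a₀..x, f t) (f x) x := by
    intro x hx
    refine intervalIntegral.integral_hasDerivAt_right
      (hsub (Set.left_mem_Icc.2 hlt.le) ⟨hx.1.le, hx.2.le⟩)
      (hc.stronglyMeasurableAtFilter isOpen_Ioo x hx) (hc.continuousAt (isOpen_Ioo.mem_nhds hx))
  have hex : ∀ τ ∈ Set.Ioo (0 : ℝ) 1, ∃ x ∈ Set.Ioo a₀ a₁, (∫ t in a₀..x, f t) = τ * V := by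
    intro τ hτ
    have h1 := intermediate_value_Ioo hlt.le hFc
    have h2 : τ * V ∈ Set.Ioo (∫ t in a₀..a₀, f t) (∫ t in a₀..a₁, f t) := by
      simp only [intervalIntegral.integral_same]
      exact ⟨by have := hτ.1; positivity, by rw [← hVdef]; nlinarith [hτ.2]⟩
    obtain ⟨x, hx, hx2⟩ := h1 h2
    exact ⟨x, hx, hx2⟩
  choose! a ha using hex
  have ham : StrictMonoOn a (Set.Ioo 0 1) := by
    intro s hs t ht hst
    have h1 := ha s hs
    have h2 := ha t ht
    by_contra hcon
    push Not at hcon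
    have h3 := hmono.monotoneOn ⟨h2.1.1.le, h2.1.2.le⟩ ⟨h1.1.1.le, h1.1.2.le⟩ hcon
    simp only [h1.2, h2.2] at h3
    nlinarith
  have him : a '' Set.Ioo 0 1 = Set.Ioo a₀ a₁ := by
    apply Set.Subset.antisymm
    · rintro _ ⟨τ, hτ, rfl⟩
      exact (ha τ hτ).1
    · intro y hy
      have hyI : y ∈ Set.Icc a₀ a₁ := ⟨hy.1.le, hy.2.le⟩
      have h1 := hmono (Set.left_mem_Icc.2 hlt.le) hyI hy.1
      have h2 := hmono hyI (Set.right_mem_Icc.2 hlt.le) hy.2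
      simp only [intervalIntegral.integral_same] at h1
      simp only [← hVdef] at h2
      have hτ : (∫ t in a₀..y, f t) / V ∈ Set.Ioo (0 : ℝ) 1 :=
        ⟨div_pos h1 hV, (div_lt_one hV).2 h2⟩
      refine ⟨_, hτ, ?_⟩
      have h3 := ha _ hτ
      rw [div_mul_cancel₀ _ hV.ne'] at h3
      exact hmono.injOn ⟨h3.1.1.le, h3.1.2.le⟩ hyI h3.2
  refine ⟨a, ha, ham, ?_, him⟩
  intro τ hτ
  have hcont : ContinuousAt a τ := by
    refine ham.continuousAt_of_image_mem_nhds (isOpen_Ioo.mem_nhds hτ) ?_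
    rw [him]
    exact isOpen_Ioo.mem_nhds (ha τ hτ).1
  have hd : HasDerivAt (fun x => (∫ t in a₀..x, f t) / V) (f (a τ) / V) (a τ) :=
    (hFd _ (ha τ hτ).1).div_const V
  have hne : f (a τ) / V ≠ 0 := (div_pos (hpos _ (ha τ hτ).1) hV).ne'
  have := HasDerivAt.of_local_left_inverse hcont hd hne ?_
  · rwa [inv_div] at this
  · filter_upwards [isOpen_Ioo.mem_nhds hτ] with s hs
    rw [(ha s hs).2, mul_div_cancel_right₀ _ hV.ne']

/-- Change of variables: the transport lower bound for the integral of `h` along a weighted mean of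
two monotone parametrisations. -/
theorem lintegral_comp_mul_le {h : ℝ → ℝ≥0∞} {c c' : ℝ → ℝ} (hcm : StrictMonoOn c (Set.Ioo 0 1))
    (hcd : ∀ τ ∈ Set.Ioo (0 : ℝ) 1, HasDerivAt c (c' τ) τ) :
    ∫⁻ τ in Set.Ioo (0 : ℝ) 1, ENNReal.ofReal (|c' τ|) * h (c τ) ≤ ∫⁻ z, h z := by
  rw [← lintegral_image_eq_lintegral_abs_deriv_mul measurableSet_Ioo
    (fun τ hτ => (hcd τ hτ).hasDerivWithinAt) hcm.injOn]
  exact setLIntegral_le_lintegral _ _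

/-- One-dimensional Prékopa–Leindler inequality for positive continuous densities on intervals. -/
theorem prekopa_leindler_interval {f g : ℝ → ℝ} {h : ℝ → ℝ≥0∞} {a₀ a₁ b₀ b₁ t : ℝ}
    (ht0 : 0 < t) (ht1 : t < 1) (hab : a₀ < a₁) (hbb : b₀ < b₁)
    (hfc : ContinuousOn f (Set.Ioo a₀ a₁)) (hfpos : ∀ x ∈ Set.Ioo a₀ a₁, 0 < f x)
    (hfint : IntervalIntegrable f volume a₀ a₁)
    (hgc : ContinuousOn g (Set.Ioo b₀ b₁)) (hgpos : ∀ x ∈ Set.Ioo b₀ b₁, 0 < g x)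
    (hgint : IntervalIntegrable g volume b₀ b₁)
    (hh : ∀ x ∈ Set.Ioo a₀ a₁, ∀ y ∈ Set.Ioo b₀ b₁,
      ENNReal.ofReal (f x ^ (1 - t) * g y ^ t) ≤ h ((1 - t) * x + t * y)) :
    ENNReal.ofReal ((∫ x in a₀..a₁, f x) ^ (1 - t) * (∫ x in b₀..b₁, g x) ^ t) ≤ ∫⁻ z, h z := by
  obtain ⟨hV, a, ha, ham, had, -⟩ := exists_quantile hab hfc hfpos hfint
  obtain ⟨hW, b, hb, hbm, hbd, -⟩ := exists_quantile hbb hgc hgpos hgint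
  set V := ∫ x in a₀..a₁, f x
  set W := ∫ x in b₀..b₁, g x
  have hcm : StrictMonoOn (fun τ => (1 - t) * a τ + t * b τ) (Set.Ioo 0 1) := by
    intro x hx y hy hxy
    have h1 := ham hx hy hxy
    have h2 := hbm hx hy hxy
    simp only
    nlinarith
  refine le_trans ?_ (lintegral_comp_mul_le (h := h) hcm
    (c' := fun τ => (1 - t) * (V / f (a τ)) + t * (W / g (b τ)))
    (fun τ hτ => ((had τ hτ).const_mul _).add ((hbd τ hτ).const_mul _)))
  have key : ∀ τ ∈ Set.Ioo (0 : ℝ) 1, ENNReal.ofReal (V ^ (1 - t) * W ^ t) ≤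
      ENNReal.ofReal (|(1 - t) * (V / f (a τ)) + t * (W / g (b τ))|) *
        h ((1 - t) * a τ + t * b τ) := by
    intro τ hτ
    have hfp := hfpos _ (ha τ hτ).1
    have hgp := hgpos _ (hb τ hτ).1
    refine le_trans ?_ (mul_le_mul_right (hh _ (ha τ hτ).1 _ (hb τ hτ).1) _)
    rw [← ENNReal.ofReal_mul (abs_nonneg _)]
    apply ENNReal.ofReal_le_ofReal
    have hp1 : 0 < V / f (a τ) := div_pos hV hfp
    have hp2 : 0 < W / g (b τ) := div_pos hW hgp
    have h1 := Real.geom_mean_le_arith_mean2_weighted (by linarith : 0 ≤ 1 - t) ht0.le hp1.le hp2.le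
      (by ring)
    have h2 : V ^ (1 - t) * W ^ t = ((V / f (a τ)) ^ (1 - t) * (W / g (b τ)) ^ t) *
        (f (a τ) ^ (1 - t) * g (b τ) ^ t) := by
      rw [Real.div_rpow hV.le hfp.le, Real.div_rpow hW.le hgp.le]
      have := (Real.rpow_pos_of_pos hfp (1 - t)).ne'
      have := (Real.rpow_pos_of_pos hgp t).ne'
      field_simp
    rw [h2]
    refine mul_le_mul_of_nonneg_right (h1.trans (le_abs_self _)) ?_
    positivity
  calc ENNReal.ofReal (V ^ (1 - t) * W ^ t)
      = ∫⁻ τ in Set.Ioo (0 : ℝ) 1, ENNReal.ofReal (V ^ (1 - t) * W ^ t) := by simp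
    _ ≤ _ := setLIntegral_mono' measurableSet_Ioo key

/-- A compact convex set with nonempty interior. -/
structure IsFullBody {E : Type*} [AddCommGroup E] [Module ℝ E] [TopologicalSpace E] (S : Set E) :
    Prop where
  convex : Convex ℝ S
  isCompact : IsCompact S
  interior_nonempty : (interior S).Nonempty

/-- The Minkowski combination `(1 - t) A + t B`. -/
def minkowskiMix {E : Type*} [AddCommGroup E] [Module ℝ E] (t : ℝ) (A B : Set E) : Set E :=
  Set.image2 (fun x y => (1 - t) • x + t • y) A B

/-- The horizontal section of a subset of `ℝ^{m+1}` at height `z`. -/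
def slice {m : ℕ} (S : Set (Fin (m + 1) → ℝ)) (z : ℝ) : Set (Fin m → ℝ) :=
  {y | (Fin.cons z y : Fin (m + 1) → ℝ) ∈ S}

section
variable {E : Type*} [NormedAddCommGroup E] [NormedSpace ℝ E]

theorem Convex.minkowskiMix {A B : Set E} (hA : Convex ℝ A) (hB : Convex ℝ B) (t : ℝ) :
    Convex ℝ (minkowskiMix t A B) := by
  rintro _ ⟨x, hx, y, hy, rfl⟩ _ ⟨x', hx', y', hy', rfl⟩ a b ha hb hab
  refine ⟨_, hA hx hx' ha hb hab, _, hB hy hy' ha hb hab, ?_⟩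
  simp only
  module

theorem IsCompact.minkowskiMix {A B : Set E} (hA : IsCompact A) (hB : IsCompact B) (t : ℝ) :
    IsCompact (minkowskiMix t A B) := by
  have : _root_.minkowskiMix t A B = (fun p : E × E => (1 - t) • p.1 + t • p.2) '' (A ×ˢ B) := by
    exact (Set.image_prod (fun x y => (1 - t) • x + t • y)).symm
  rw [this]
  exact (hA.prod hB).image (by fun_prop)

theorem interior_minkowskiMix_nonempty {A B : Set E} (hA : (interior A).Nonempty)
    (hB : B.Nonempty) {t : ℝ} (ht : t < 1) : (interior (minkowskiMix t A B)).Nonempty := by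
  obtain ⟨a, ha⟩ := hA
  obtain ⟨b, hb⟩ := hB
  have hne : (1 - t) ≠ 0 := by linarith
  let e : E ≃ₜ E := (Homeomorph.smulOfNeZero (1 - t) hne).trans (Homeomorph.addRight (t • b))
  refine ⟨e a, ?_⟩
  have h1 : IsOpen (e '' interior A) := e.isOpenMap _ isOpen_interior
  refine interior_maximal ?_ h1 ⟨a, ha, rfl⟩
  rintro _ ⟨x, hx, rfl⟩
  exact ⟨x, interior_subset hx, b, hb, rfl⟩

theorem IsFullBody.nonempty {A : Set E} (hA : IsFullBody A) : A.Nonempty :=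
  hA.interior_nonempty.mono interior_subset

theorem IsFullBody.minkowskiMix {A B : Set E} (hA : IsFullBody A) (hB : IsFullBody B) {t : ℝ}
    (ht : t < 1) : IsFullBody (minkowskiMix t A B) :=
  ⟨hA.1.minkowskiMix hB.1 t, hA.2.minkowskiMix hB.2 t,
    interior_minkowskiMix_nonempty hA.3 hB.nonempty ht⟩

theorem IsFullBody.volume_pos [MeasurableSpace E] {μ : Measure E} [μ.IsOpenPosMeasure]
    [IsFiniteMeasureOnCompacts μ] {A : Set E} (hA : IsFullBody A) : 0 < μ.real A := by
  refine ENNReal.toReal_pos ?_ hA.isCompact.measure_lt_top.ne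
  exact (Measure.measure_pos_of_nonempty_interior μ hA.3).ne'

end

section
variable {m : ℕ}

theorem continuous_fin_cons (z : ℝ) :
    Continuous (fun y : Fin m → ℝ => (Fin.cons z y : Fin (m + 1) → ℝ)) := by
  refine continuous_pi fun i => ?_
  refine Fin.cases ?_ (fun j => ?_) i
  · simpa using continuous_const
  · simpa using continuous_apply j

theorem cons_combo (a b z z' : ℝ) (y y' : Fin m → ℝ) :
    (Fin.cons (a * z + b * z') (a • y + b • y') : Fin (m + 1) → ℝ)
      = a • (Fin.cons z y : Fin (m + 1) → ℝ) + b • (Fin.cons z' y' : Fin (m + 1) → ℝ) := by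
  ext i
  refine Fin.cases ?_ (fun j => ?_) i <;> simp

theorem convex_slice {S : Set (Fin (m + 1) → ℝ)} (hS : Convex ℝ S) (z : ℝ) :
    Convex ℝ (slice S z) := by
  intro x hx y hy a b ha hb hab
  have := hS hx hy ha hb hab
  rw [← cons_combo, ← add_mul, hab, one_mul] at this
  exact this

theorem isCompact_slice {S : Set (Fin (m + 1) → ℝ)} (hS : IsCompact S) (z : ℝ) :
    IsCompact (slice S z) := by
  have h1 : IsCompact ((fun x : Fin (m + 1) → ℝ => (Fin.tail x : Fin m → ℝ)) '' S) :=
    hS.image (by unfold Fin.tail; fun_prop)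
  refine h1.of_isClosed_subset (hS.isClosed.preimage (continuous_fin_cons z)) ?_
  intro y hy
  exact ⟨_, hy, Fin.tail_cons _ _⟩

theorem prodMk_preimage_eq_slice (S : Set (Fin (m + 1) → ℝ)) (z : ℝ) :
    Prod.mk z ⁻¹' ((MeasurableEquiv.piFinSuccAbove (fun _ : Fin (m + 1) => ℝ) 0).symm ⁻¹' S)
      = slice S z := by
  ext y
  simp [slice, MeasurableEquiv.piFinSuccAbove_symm_apply, Fin.insertNthEquiv]

theorem volume_eq_lintegral_slice {S : Set (Fin (m + 1) → ℝ)} (hS : MeasurableSet S) :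
    volume S = ∫⁻ z, volume (slice S z) := by
  have e := (volume_preserving_piFinSuccAbove (fun _ : Fin (m + 1) => ℝ) 0).symm
  rw [← e.measure_preimage hS.nullMeasurableSet]
  rw [Measure.volume_eq_prod, Measure.prod_apply (e.measurable hS)]
  exact lintegral_congr fun z => by rw [prodMk_preimage_eq_slice]

theorem measurable_volume_slice {S : Set (Fin (m + 1) → ℝ)} (hS : MeasurableSet S) :
    Measurable (fun z => volume (slice S z)) := by
  have e := (volume_preserving_piFinSuccAbove (fun _ : Fin (m + 1) => ℝ) 0).symm
  have := measurable_measure_prodMk_left (ν := (volume : Measure (Fin m → ℝ))) (e.measurable hS)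
  simpa only [prodMk_preimage_eq_slice] using this

theorem minkowskiMix_slice_subset {A B : Set (Fin (m + 1) → ℝ)} (t x y : ℝ) :
    minkowskiMix t (slice A x) (slice B y) ⊆ slice (minkowskiMix t A B) ((1 - t) * x + t * y) := by
  rintro _ ⟨p, hp, q, hq, rfl⟩
  exact ⟨_, hp, _, hq, (cons_combo _ _ _ _ _ _).symm⟩

theorem IsFullBody.exists_slice_bounds {A : Set (Fin (m + 1) → ℝ)} (hA : IsFullBody A) :
    ∃ a₀ a₁ : ℝ, a₀ < a₁ ∧ (∀ x ∈ A, x 0 ∈ Set.Icc a₀ a₁) ∧ (∃ p ∈ A, p 0 = a₀) ∧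
      (∃ p ∈ A, p 0 = a₁) ∧ ∀ z ∈ Set.Ioo a₀ a₁, IsFullBody (slice A z) := by
  have hc0 : Continuous (fun x : Fin (m + 1) → ℝ => x 0) := continuous_apply 0
  obtain ⟨p, hp, hpmin⟩ := hA.isCompact.exists_isMinOn hA.nonempty hc0.continuousOn
  obtain ⟨q, hq, hqmax⟩ := hA.isCompact.exists_isMaxOn hA.nonempty hc0.continuousOn
  have hmin : ∀ x ∈ A, p 0 ≤ x 0 := fun x hx => hpmin hx
  have hmax : ∀ x ∈ A, x 0 ≤ q 0 := fun x hx => hqmax hx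
  obtain ⟨w, hw⟩ := hA.interior_nonempty
  have hstrict : p 0 < w 0 ∧ w 0 < q 0 := by
    obtain ⟨ε, hε, hball⟩ := Metric.isOpen_iff.1 isOpen_interior w hw
    have hin : ∀ s : ℝ, |s| < ε → w + Pi.single 0 s ∈ A := by
      intro s hs
      apply interior_subset
      apply hball
      rw [mem_ball_iff_norm, add_sub_cancel_left, Pi.norm_single]
      exact hs
    have h1 := hmin _ (hin (-(ε / 2)) (by rw [abs_neg, abs_of_pos] <;> linarith))
    have h2 := hmax _ (hin (ε / 2) (by rw [abs_of_pos] <;> linarith))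
    simp at h1 h2
    constructor <;> linarith
  refine ⟨p 0, q 0, hstrict.1.trans hstrict.2, fun x hx => ⟨hmin x hx, hmax x hx⟩, ⟨p, hp, rfl⟩,
    ⟨q, hq, rfl⟩, ?_⟩
  intro z hz
  have hinz : ∃ v ∈ interior A, v 0 = z := by
    rcases le_total z (w 0) with hzw | hzw
    · refine ⟨((z - p 0) / (w 0 - p 0)) • w + (1 - (z - p 0) / (w 0 - p 0)) • p, ?_, ?_⟩
      · have hd : 0 < w 0 - p 0 := by linarith
        refine hA.convex.combo_interior_self_mem_interior hw hp
          (div_pos (by linarith [hz.1]) hd) ?_ (by ring)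
        rw [sub_nonneg, div_le_one hd]; linarith
      · have hd : w 0 - p 0 ≠ 0 := by linarith
        simp; field_simp; ring
    · refine ⟨((q 0 - z) / (q 0 - w 0)) • w + (1 - (q 0 - z) / (q 0 - w 0)) • q, ?_, ?_⟩
      · have hd : 0 < q 0 - w 0 := by linarith
        refine hA.convex.combo_interior_self_mem_interior hw hq
          (div_pos (by linarith [hz.2]) hd) ?_ (by ring)
        rw [sub_nonneg, div_le_one hd]; linarith
      · have hd : q 0 - w 0 ≠ 0 := by linarith
        simp; field_simp; ring
  obtain ⟨v, hv, hvz⟩ := hinz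
  refine ⟨convex_slice hA.1 z, isCompact_slice hA.2 z, ⟨Fin.tail v, ?_⟩⟩
  have h1 : IsOpen {y : Fin m → ℝ | (Fin.cons z y : Fin (m + 1) → ℝ) ∈ interior A} :=
    isOpen_interior.preimage (continuous_fin_cons z)
  refine interior_maximal (s := slice A z) ?_ h1 ?_
  · exact fun y hy => interior_subset (s := A) hy
  · change (Fin.cons z (Fin.tail v) : Fin (m + 1) → ℝ) ∈ interior A
    rw [← hvz, Fin.cons_self_tail]; exact hv

end

section
variable {m : ℕ}

theorem slice_eq_empty {A : Set (Fin (m + 1) → ℝ)} {a₀ a₁ : ℝ}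
    (hb : ∀ x ∈ A, x 0 ∈ Set.Icc a₀ a₁) {z : ℝ} (hz : z ∉ Set.Icc a₀ a₁) : slice A z = ∅ := by
  ext y
  simp only [Set.mem_empty_iff_false, iff_false]
  intro hy
  exact hz (by simpa using hb _ hy)

theorem setLIntegral_slice {A : Set (Fin (m + 1) → ℝ)} (hA : IsCompact A) {a₀ a₁ : ℝ}
    (hb : ∀ x ∈ A, x 0 ∈ Set.Icc a₀ a₁) :
    ∫⁻ z in Set.Ioc a₀ a₁, volume (slice A z) = volume A := by
  rw [volume_eq_lintegral_slice hA.measurableSet, setLIntegral_congr Ioc_ae_eq_Icc,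
    ← lintegral_indicator measurableSet_Icc]
  refine lintegral_congr fun z => ?_
  by_cases hz : z ∈ Set.Icc a₀ a₁
  · simp [hz]
  · simp [hz, slice_eq_empty hb hz]

theorem intervalIntegrable_slice {A : Set (Fin (m + 1) → ℝ)} (hA : IsCompact A) {a₀ a₁ : ℝ}
    (hlt : a₀ ≤ a₁) (hb : ∀ x ∈ A, x 0 ∈ Set.Icc a₀ a₁) :
    IntervalIntegrable (fun z => volume.real (slice A z)) volume a₀ a₁ := by
  rw [intervalIntegrable_iff_integrableOn_Ioc_of_le hlt]
  refine integrable_toReal_of_lintegral_ne_top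
    (measurable_volume_slice hA.measurableSet).aemeasurable ?_
  rw [setLIntegral_slice hA hb]
  exact hA.measure_lt_top.ne

theorem integral_slice {A : Set (Fin (m + 1) → ℝ)} (hA : IsCompact A) {a₀ a₁ : ℝ}
    (hlt : a₀ ≤ a₁) (hb : ∀ x ∈ A, x 0 ∈ Set.Icc a₀ a₁) :
    ∫ z in a₀..a₁, volume.real (slice A z) = volume.real A := by
  rw [intervalIntegral.integral_of_le hlt]
  have := integral_toReal (μ := volume.restrict (Set.Ioc a₀ a₁))
    (measurable_volume_slice hA.measurableSet).aemeasurable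
    (Eventually.of_forall fun z => (isCompact_slice hA z).measure_lt_top)
  rw [setLIntegral_slice hA hb] at this
  exact this

/-- The multiplicative Brunn–Minkowski inequality in `ℝ^m`, as a predicate on the dimension. -/
def BrunnMinkowski (m : ℕ) : Prop :=
  ∀ (A B : Set (Fin m → ℝ)) (t : ℝ), IsFullBody A → IsFullBody B → 0 < t → t < 1 →
    volume.real A ^ (1 - t) * volume.real B ^ t ≤ volume.real (minkowskiMix t A B)

theorem IsFullBody.minkowskiMix_self_subset {E : Type*} [AddCommGroup E] [Module ℝ E]
    {A : Set E} (hA : Convex ℝ A) {t : ℝ} (ht0 : 0 ≤ t) (ht1 : t ≤ 1) :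
    _root_.minkowskiMix t A A ⊆ A := by
  rintro _ ⟨x, hx, y, hy, rfl⟩
  exact hA hx hy (by linarith) ht0 (by ring)

theorem slice_mul_le (hBM : BrunnMinkowski m) {A B : Set (Fin (m + 1) → ℝ)}
    (hA : IsCompact A) (hB : IsCompact B) {x y t : ℝ} (hx : IsFullBody (slice A x))
    (hy : IsFullBody (slice B y)) (ht0 : 0 < t) (ht1 : t < 1) :
    volume.real (slice A x) ^ (1 - t) * volume.real (slice B y) ^ t
      ≤ volume.real (slice (minkowskiMix t A B) ((1 - t) * x + t * y)) := by
  refine (hBM _ _ t hx hy ht0 ht1).trans ?_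
  exact measureReal_mono (minkowskiMix_slice_subset t x y)
    (isCompact_slice (hA.minkowskiMix hB t) _).measure_lt_top.ne

theorem slice_self_mul_le (hBM : BrunnMinkowski m) {A : Set (Fin (m + 1) → ℝ)}
    (hA : IsFullBody A) {x y t : ℝ} (hx : IsFullBody (slice A x))
    (hy : IsFullBody (slice A y)) (ht0 : 0 < t) (ht1 : t < 1) :
    volume.real (slice A x) ^ (1 - t) * volume.real (slice A y) ^ t
      ≤ volume.real (slice A ((1 - t) * x + t * y)) := by
  refine (slice_mul_le hBM hA.2 hA.2 hx hy ht0 ht1).trans ?_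
  refine measureReal_mono ?_ (isCompact_slice hA.2 _).measure_lt_top.ne
  intro p hp
  exact IsFullBody.minkowskiMix_self_subset hA.1 ht0.le ht1.le hp

theorem concaveOn_log_slice (hBM : BrunnMinkowski m) {A : Set (Fin (m + 1) → ℝ)}
    (hA : IsFullBody A) {a₀ a₁ : ℝ} (hs : ∀ z ∈ Set.Ioo a₀ a₁, IsFullBody (slice A z)) :
    ConcaveOn ℝ (Set.Ioo a₀ a₁) (fun z => Real.log (volume.real (slice A z))) := by
  refine ⟨convex_Ioo _ _, ?_⟩
  intro x hx y hy a b ha hb hab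
  have hpx : 0 < volume.real (slice A x) := (hs x hx).volume_pos
  have hpy : 0 < volume.real (slice A y) := (hs y hy).volume_pos
  rcases ha.eq_or_lt with rfl | ha
  · have : b = 1 := by linarith
    simp [this]
  rcases hb.eq_or_lt with rfl | hb
  · have : a = 1 := by linarith
    simp [this]
  have h1 := slice_self_mul_le hBM hA (hs x hx) (hs y hy) hb (by linarith)
  have h1b : 1 - b = a := by linarith
  rw [h1b] at h1
  have h2 := Real.log_le_log (by positivity) h1
  rw [Real.log_mul (by positivity) (by positivity), Real.log_rpow hpx, Real.log_rpow hpy] at h2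
  simpa using h2

theorem continuousOn_slice (hBM : BrunnMinkowski m) {A : Set (Fin (m + 1) → ℝ)}
    (hA : IsFullBody A) {a₀ a₁ : ℝ} (hs : ∀ z ∈ Set.Ioo a₀ a₁, IsFullBody (slice A z)) :
    ContinuousOn (fun z => volume.real (slice A z)) (Set.Ioo a₀ a₁) := by
  have h1 := (concaveOn_log_slice hBM hA hs).continuousOn isOpen_Ioo
  refine h1.rexp.congr fun z hz => ?_
  exact (Real.exp_log (hs z hz).volume_pos).symm

theorem min_slice_le (hBM : BrunnMinkowski m) {A : Set (Fin (m + 1) → ℝ)}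
    (hA : IsFullBody A) {a₀ a₁ : ℝ} (hs : ∀ z ∈ Set.Ioo a₀ a₁, IsFullBody (slice A z))
    {x y z : ℝ} (hx : x ∈ Set.Ioo a₀ a₁) (hz : z ∈ Set.Ioo a₀ a₁) (hxy : x < y) (hyz : y < z) :
    min (volume.real (slice A x)) (volume.real (slice A z)) ≤ volume.real (slice A y) := by
  have hy : y ∈ Set.Ioo a₀ a₁ := ⟨hx.1.trans hxy, hyz.trans hz.2⟩
  have h := (concaveOn_log_slice hBM hA hs).min_le_of_mem_Icc hx hz ⟨hxy.le, hyz.le⟩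
  have hpx : 0 < volume.real (slice A x) := (hs x hx).volume_pos
  have hpy : 0 < volume.real (slice A y) := (hs y hy).volume_pos
  have hpz : 0 < volume.real (slice A z) := (hs z hz).volume_pos
  rcases min_le_iff.1 h with h | h
  · exact (min_le_left _ _).trans ((Real.log_le_log_iff hpx hpy).1 h)
  · exact (min_le_right _ _).trans ((Real.log_le_log_iff hpz hpy).1 h)

theorem brunnMinkowski (m : ℕ) : BrunnMinkowski m := by
  induction m with
  | zero =>
    intro A B t hA hB ht0 ht1
    have h1 : ∀ S : Set (Fin 0 → ℝ), S.Nonempty → volume.real S = 1 := by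
      intro S hS
      rw [Subsingleton.eq_univ_of_nonempty hS, measureReal_def, volume_pi,
        ← Set.pi_univ Set.univ, Measure.pi_pi]
      simp
    rw [h1 A hA.nonempty, h1 B hB.nonempty, h1 _ (hA.minkowskiMix hB ht1).nonempty]
    simp
  | succ m hBM =>
    intro A B t hA hB ht0 ht1
    obtain ⟨a₀, a₁, hab, hba, -, -, hsa⟩ := hA.exists_slice_bounds
    obtain ⟨b₀, b₁, hbb, hbb', -, -, hsb⟩ := hB.exists_slice_bounds
    have hM := hA.minkowskiMix hB ht1
    have h := prekopa_leindler_interval (h := fun z => volume (slice (minkowskiMix t A B) z))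
      ht0 ht1 hab hbb (continuousOn_slice hBM hA hsa)
      (fun x hx => (hsa x hx).volume_pos) (intervalIntegrable_slice hA.2 hab.le hba)
      (continuousOn_slice hBM hB hsb) (fun x hx => (hsb x hx).volume_pos)
      (intervalIntegrable_slice hB.2 hbb.le hbb') ?_
    · rw [integral_slice hA.2 hab.le hba, integral_slice hB.2 hbb.le hbb',
        ← volume_eq_lintegral_slice hM.2.measurableSet] at h
      exact (ENNReal.ofReal_le_iff_le_toReal hM.2.measure_lt_top.ne).1 h
    · intro x hx y hy
      refine (ENNReal.ofReal_le_iff_le_toReal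
        (isCompact_slice hM.2 _).measure_lt_top.ne).2 ?_
      exact slice_mul_le hBM hA.2 hB.2 (hsa x hx) (hsb y hy) ht0 ht1

end

theorem integral_le_width_mul {f : ℝ → ℝ} {a₀ a₁ x : ℝ} (hx : x ∈ Set.Ioo a₀ a₁)
    (hpos : ∀ x ∈ Set.Ioo a₀ a₁, 0 < f x)
    (hintg : IntervalIntegrable f volume a₀ a₁)
    (hmin : ∀ x ∈ Set.Ioo a₀ a₁, ∀ z ∈ Set.Ioo a₀ a₁, ∀ y, x < y → y < z → min (f x) (f z) ≤ f y)
    {c : ℝ} (h0 : c ≤ ∫ t in a₀..x, f t) (h1 : c ≤ ∫ t in x..a₁, f t) :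
    c ≤ (a₁ - a₀) * f x := by
  have hlt : a₀ < a₁ := hx.1.trans hx.2
  have hfx := hpos x hx
  have hi0 : IntervalIntegrable f volume a₀ x := by
    refine hintg.mono_set ?_
    rw [Set.uIcc_of_le hx.1.le, Set.uIcc_of_le hlt.le]
    exact Set.Icc_subset_Icc le_rfl hx.2.le
  have hi1 : IntervalIntegrable f volume x a₁ := by
    refine hintg.mono_set ?_
    rw [Set.uIcc_of_le hx.2.le, Set.uIcc_of_le hlt.le]
    exact Set.Icc_subset_Icc hx.1.le le_rfl
  by_cases hcase : ∀ y ∈ Set.Ioo a₀ x, f y ≤ f x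
  · have h2 : ∫ t in a₀..x, f t ≤ ∫ t in a₀..x, f x :=
      intervalIntegral.integral_mono_on_of_le_Ioo hx.1.le hi0 intervalIntegrable_const hcase
    rw [intervalIntegral.integral_const, smul_eq_mul] at h2
    nlinarith [hx.1, hx.2]
  · push Not at hcase
    obtain ⟨y, hy, hyx⟩ := hcase
    have h3 : ∀ z ∈ Set.Ioo x a₁, f z ≤ f x := by
      intro z hz
      by_contra hcon
      push Not at hcon
      have := hmin y ⟨hy.1, hy.2.trans hx.2⟩ z ⟨hx.1.trans hz.1, hz.2⟩ x hy.2 hz.1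
      rcases min_le_iff.1 this with h | h <;> linarith
    have h2 : ∫ t in x..a₁, f t ≤ ∫ t in x..a₁, f x :=
      intervalIntegral.integral_mono_on_of_le_Ioo hx.2.le hi1 intervalIntegrable_const h3
    rw [intervalIntegral.integral_const, smul_eq_mul] at h2
    nlinarith [hx.1, hx.2]

theorem abs_sub_le_of_geom_mean {X Y M θ : ℝ} (hX : 0 < X) (hY : 0 < Y) (hXM : X ≤ M) (hYM : Y ≤ M)
    (hθ : 0 < θ) :
    |X - Y| ≤ ((X + Y) / (2 * √(X * Y)) - 1) / θ + θ * M * (X + Y) := by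
  obtain ⟨p, hp, rfl⟩ : ∃ p : ℝ, 0 < p ∧ X = p ^ 2 := ⟨√X, Real.sqrt_pos.2 hX, (Real.sq_sqrt hX.le).symm⟩
  obtain ⟨q, hq, rfl⟩ : ∃ q : ℝ, 0 < q ∧ Y = q ^ 2 := ⟨√Y, Real.sqrt_pos.2 hY, (Real.sq_sqrt hY.le).symm⟩
  have hs : √(p ^ 2 * q ^ 2) = p * q := by
    rw [← mul_pow, Real.sqrt_sq (by positivity)]
  rw [hs]
  have h1 : (p ^ 2 + q ^ 2) / (2 * (p * q)) - 1 = (p - q) ^ 2 / (2 * (p * q)) := by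
    field_simp; ring
  rw [h1]
  have h2 : |p ^ 2 - q ^ 2| = |p - q| * (p + q) := by
    rw [show p ^ 2 - q ^ 2 = (p - q) * (p + q) by ring, abs_mul, abs_of_pos (by linarith : 0 < p + q)]
  have h3 : (p + q) ^ 2 * (p * q) ≤ 2 * M * (p ^ 2 + q ^ 2) := by
    have e1 : (p + q) ^ 2 ≤ 2 * (p ^ 2 + q ^ 2) := by nlinarith [sq_nonneg (p - q)]
    have e2 : p * q ≤ M := by nlinarith [sq_nonneg (p - q)]
    nlinarith [mul_le_mul e1 e2 (by positivity) (by positivity)]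
  have h4 : |p - q| * (p + q) ≤ (p - q) ^ 2 / (2 * (p * q)) / θ + θ * ((p + q) ^ 2 * (p * q)) / 2 := by
    rw [← sq_abs (p - q)]
    generalize |p - q| = r
    have : r ^ 2 / (2 * (p * q)) / θ + θ * ((p + q) ^ 2 * (p * q)) / 2 - r * (p + q)
      = (r - θ * (p * q) * (p + q)) ^ 2 / (2 * (p * q) * θ) := by
      field_simp; ring
    have h5 : 0 ≤ (r - θ * (p * q) * (p + q)) ^ 2 / (2 * (p * q) * θ) := by positivity
    linarith
  rw [h2]
  nlinarith [mul_le_mul_of_nonneg_left h3 hθ.le]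

/-- The mean of the quantile function is the mean of the density. -/
theorem integral_quantile {f a : ℝ → ℝ} {a₀ a₁ V : ℝ} (hV : 0 < V)
    (hpos : ∀ x ∈ Set.Ioo a₀ a₁, 0 < f x)
    (ha : ∀ τ ∈ Set.Ioo (0 : ℝ) 1, a τ ∈ Set.Ioo a₀ a₁) (ham : StrictMonoOn a (Set.Ioo 0 1))
    (had : ∀ τ ∈ Set.Ioo (0 : ℝ) 1, HasDerivAt a (V / f (a τ)) τ)
    (him : a '' Set.Ioo 0 1 = Set.Ioo a₀ a₁) (hlt : a₀ ≤ a₁) :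
    ∫ τ in Set.Ioo (0 : ℝ) 1, a τ = (∫ z in a₀..a₁, z * f z) / V := by
  rw [intervalIntegral.integral_of_le hlt, integral_Ioc_eq_integral_Ioo, ← him,
    integral_image_eq_integral_abs_deriv_smul measurableSet_Ioo
      (fun τ hτ => (had τ hτ).hasDerivWithinAt) ham.injOn]
  rw [eq_div_iff hV.ne', mul_comm, ← integral_const_mul]
  refine setIntegral_congr_fun measurableSet_Ioo fun τ hτ => ?_
  have hp := hpos _ (ha τ hτ)
  simp only [smul_eq_mul]
  rw [abs_of_pos (div_pos hV hp)]
  field_simp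

theorem integrableOn_quantile {a : ℝ → ℝ} {a₀ a₁ : ℝ}
    (ha : ∀ τ ∈ Set.Ioo (0 : ℝ) 1, a τ ∈ Set.Ioo a₀ a₁)
    (hac : ContinuousOn a (Set.Ioo 0 1)) : IntegrableOn a (Set.Ioo 0 1) := by
  have hm : AEStronglyMeasurable a (volume.restrict (Set.Ioo 0 1)) :=
    hac.aestronglyMeasurable measurableSet_Ioo
  refine Integrable.of_bound hm (max |a₀| |a₁|) ?_
  refine (ae_restrict_iff' measurableSet_Ioo).2 (Eventually.of_forall fun τ hτ => ?_)
  rw [Real.norm_eq_abs]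
  exact abs_le_max_abs_abs (ha τ hτ).1.le (ha τ hτ).2.le

/-- Section profile of a convex body of volume `V` and width at most `W` in dimension `n`. -/
structure IsProfile (n : ℕ) (W V : ℝ) (f : ℝ → ℝ) (a₀ a₁ : ℝ) : Prop where
  lt : a₀ < a₁
  cont : ContinuousOn f (Set.Ioo a₀ a₁)
  pos : ∀ x ∈ Set.Ioo a₀ a₁, 0 < f x
  int : IntervalIntegrable f volume a₀ a₁
  min_le : ∀ x ∈ Set.Ioo a₀ a₁, ∀ z ∈ Set.Ioo a₀ a₁, ∀ y, x < y → y < z → min (f x) (f z) ≤ f y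
  width : a₁ - a₀ ≤ W
  integral_eq : ∫ x in a₀..a₁, f x = V
  upper : ∀ x ∈ Set.Ioo a₀ a₁, ((a₁ - x) / W) ^ n * V ≤ ∫ t in x..a₁, f t
  lower : ∀ x ∈ Set.Ioo a₀ a₁, ((x - a₀) / W) ^ n * V ≤ ∫ t in a₀..x, f t

/-- Quantile function of a profile. -/
structure IsQuantile (V : ℝ) (f : ℝ → ℝ) (a₀ a₁ : ℝ) (a : ℝ → ℝ) : Prop where
  mem : ∀ τ ∈ Set.Ioo (0 : ℝ) 1, a τ ∈ Set.Ioo a₀ a₁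
  integral_eq : ∀ τ ∈ Set.Ioo (0 : ℝ) 1, ∫ t in a₀..a τ, f t = τ * V
  mono : StrictMonoOn a (Set.Ioo 0 1)
  deriv : ∀ τ ∈ Set.Ioo (0 : ℝ) 1, HasDerivAt a (V / f (a τ)) τ
  image : a '' Set.Ioo 0 1 = Set.Ioo a₀ a₁

theorem IsProfile.exists_isQuantile {n : ℕ} {W V a₀ a₁ : ℝ} {f : ℝ → ℝ}
    (h : IsProfile n W V f a₀ a₁) : 0 < V ∧ ∃ a, IsQuantile V f a₀ a₁ a := by
  obtain ⟨hV, a, h1, h2, h3, h4⟩ := exists_quantile h.lt h.cont h.pos h.int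
  rw [h.integral_eq] at hV h1
  rw [h.integral_eq] at h3
  exact ⟨hV, a, fun τ hτ => (h1 τ hτ).1, fun τ hτ => (h1 τ hτ).2, h2, h3, h4⟩

section
variable {n : ℕ} {W V a₀ a₁ : ℝ} {f a : ℝ → ℝ}

theorem IsQuantile.continuousOn (q : IsQuantile V f a₀ a₁ a) : ContinuousOn a (Set.Ioo 0 1) :=
  fun τ hτ => (q.deriv τ hτ).continuousAt.continuousWithinAt

theorem IsProfile.integral_right (h : IsProfile n W V f a₀ a₁) (q : IsQuantile V f a₀ a₁ a)
    {τ : ℝ} (hτ : τ ∈ Set.Ioo (0 : ℝ) 1) : ∫ t in a τ..a₁, f t = (1 - τ) * V := by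
  have hx := q.mem τ hτ
  have hi0 : IntervalIntegrable f volume a₀ (a τ) := by
    refine h.int.mono_set ?_
    rw [Set.uIcc_of_le hx.1.le, Set.uIcc_of_le h.lt.le]
    exact Set.Icc_subset_Icc le_rfl hx.2.le
  have hi1 : IntervalIntegrable f volume (a τ) a₁ := by
    refine h.int.mono_set ?_
    rw [Set.uIcc_of_le hx.2.le, Set.uIcc_of_le h.lt.le]
    exact Set.Icc_subset_Icc hx.1.le le_rfl
  have := intervalIntegral.integral_add_adjacent_intervals hi0 hi1
  rw [q.integral_eq τ hτ, h.integral_eq] at this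
  linarith

theorem IsProfile.deriv_le (h : IsProfile n W V f a₀ a₁) (q : IsQuantile V f a₀ a₁ a) (hV : 0 < V)
    {δ τ : ℝ} (hδ : 0 < δ) (hτ : τ ∈ Set.Icc δ (1 - δ)) : V / f (a τ) ≤ W / δ := by
  have hτ' : τ ∈ Set.Ioo (0 : ℝ) 1 := ⟨hδ.trans_le hτ.1, by linarith [hτ.2]⟩
  have hx := q.mem τ hτ'
  have h1 := integral_le_width_mul (c := δ * V) hx h.pos h.int h.min_le
    (by rw [q.integral_eq τ hτ']; nlinarith [hτ.1])
    (by rw [h.integral_right q hτ']; nlinarith [hτ.2])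
  have hf := h.pos _ hx
  rw [div_le_div_iff₀ hf hδ]
  nlinarith [h.width]

theorem IsProfile.upper_le (h : IsProfile n W V f a₀ a₁) (q : IsQuantile V f a₀ a₁ a) (hV : 0 < V)
    (hn : n ≠ 0) {e τ : ℝ} (he : 0 < e) (hτ : τ ∈ Set.Ioo (0 : ℝ) 1) (hτe : 1 - τ ≤ e ^ n) :
    a τ ≤ a₁ ∧ a₁ - a τ ≤ W * e := by
  have hx := q.mem τ hτ
  refine ⟨hx.2.le, ?_⟩
  have h1 := h.upper _ hx
  rw [h.integral_right q hτ] at h1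
  have h2 : ((a₁ - a τ) / W) ^ n ≤ e ^ n := (le_of_mul_le_mul_right h1 hV).trans hτe
  have hW : 0 < W := by linarith [h.width, h.lt]
  have h3 := le_of_pow_le_pow_left₀ hn he.le h2
  rwa [div_le_iff₀ hW, mul_comm] at h3

theorem IsProfile.lower_le (h : IsProfile n W V f a₀ a₁) (q : IsQuantile V f a₀ a₁ a) (hV : 0 < V)
    (hn : n ≠ 0) {e τ : ℝ} (he : 0 < e) (hτ : τ ∈ Set.Ioo (0 : ℝ) 1) (hτe : τ ≤ e ^ n) :
    a₀ ≤ a τ ∧ a τ - a₀ ≤ W * e := by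
  have hx := q.mem τ hτ
  refine ⟨hx.1.le, ?_⟩
  have h1 := h.lower _ hx
  rw [q.integral_eq _ hτ] at h1
  have h2 : ((a τ - a₀) / W) ^ n ≤ e ^ n := (le_of_mul_le_mul_right h1 hV).trans hτe
  have hW : 0 < W := by linarith [h.width, h.lt]
  have h3 := le_of_pow_le_pow_left₀ hn he.le h2
  rwa [div_le_iff₀ hW, mul_comm] at h3

theorem IsProfile.continuousOn_deriv (h : IsProfile n W V f a₀ a₁) (q : IsQuantile V f a₀ a₁ a) :
    ContinuousOn (fun τ => V / f (a τ)) (Set.Ioo 0 1) :=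
  ContinuousOn.div continuousOn_const (h.cont.comp q.continuousOn q.mem)
    fun τ hτ => (h.pos _ (q.mem τ hτ)).ne'

end

section
variable {n : ℕ} {W V a₀ a₁ b₀ b₁ : ℝ} {f g a b : ℝ → ℝ}

theorem IsProfile.integral_deficit_le (hf : IsProfile n W V f a₀ a₁) (hg : IsProfile n W V g b₀ b₁)
    (qa : IsQuantile V f a₀ a₁ a) (qb : IsQuantile V g b₀ b₁ b) (hV : 0 < V)
    {h : ℝ → ℝ≥0∞} {η : ℝ} (hη : 0 ≤ η)
    (hh : ∀ x ∈ Set.Ioo a₀ a₁, ∀ y ∈ Set.Ioo b₀ b₁,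
      ENNReal.ofReal (√(f x * g y)) ≤ h ((x + y) / 2))
    (hintg : ∫⁻ z, h z ≤ ENNReal.ofReal (V * (1 + η))) {σ τ : ℝ} (hσ : 0 < σ) (hστ : σ ≤ τ)
    (hτ : τ < 1) :
    ∫ t in σ..τ, ((V / f (a t) + V / g (b t)) / (2 * √(V / f (a t) * (V / g (b t)))) - 1) ≤ η := by
  set P : ℝ → ℝ := fun t =>
    (V / f (a t) + V / g (b t)) / (2 * √(V / f (a t) * (V / g (b t)))) - 1 with hP
  have hX : ∀ t ∈ Set.Ioo (0 : ℝ) 1, 0 < V / f (a t) := fun t ht => div_pos hV (hf.pos _ (qa.mem t ht))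
  have hY : ∀ t ∈ Set.Ioo (0 : ℝ) 1, 0 < V / g (b t) := fun t ht => div_pos hV (hg.pos _ (qb.mem t ht))
  have hPc : ContinuousOn P (Set.Ioo 0 1) := by
    refine ContinuousOn.sub (ContinuousOn.div ((hf.continuousOn_deriv qa).add (hg.continuousOn_deriv qb))
      (continuousOn_const.mul (((hf.continuousOn_deriv qa).mul (hg.continuousOn_deriv qb)).sqrt)) ?_)
      continuousOn_const
    intro t ht
    have := Real.sqrt_pos.2 (mul_pos (hX t ht) (hY t ht))
    positivity
  have hP0 : ∀ t ∈ Set.Ioo (0 : ℝ) 1, 0 ≤ P t := by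
    intro t ht
    have hx := hX t ht
    have hy := hY t ht
    have h1 := Real.sqrt_pos.2 (mul_pos hx hy)
    rw [hP]
    simp only [sub_nonneg]
    rw [le_div_iff₀ (by positivity), one_mul]
    have h2 := Real.sq_sqrt (mul_pos hx hy).le
    nlinarith [sq_nonneg (V / f (a t) - V / g (b t))]
  have hcm : StrictMonoOn (fun τ => (a τ + b τ) / 2) (Set.Ioo 0 1) := by
    intro x hx y hy hxy
    have h1 := qa.mono hx hy hxy
    have h2 := qb.mono hx hy hxy
    simp only
    linarith
  have h1 := (lintegral_comp_mul_le (h := h) hcm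
    (c' := fun τ => (V / f (a τ) + V / g (b τ)) / 2)
    (fun τ hτ => ((qa.deriv τ hτ).add (qb.deriv τ hτ)).div_const 2)).trans hintg
  have h2 : ∫⁻ t in Set.Ioo (0 : ℝ) 1, ENNReal.ofReal (V * (1 + P t)) ≤ ENNReal.ofReal (V * (1 + η)) := by
    refine le_trans (setLIntegral_mono' measurableSet_Ioo fun t ht => ?_) h1
    refine le_trans ?_ (mul_le_mul_right (hh _ (qa.mem t ht) _ (qb.mem t ht)) _)
    have hx := hX t ht
    have hy := hY t ht
    have h5 := hf.pos _ (qa.mem t ht)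
    have h6 := hg.pos _ (qb.mem t ht)
    rw [← ENNReal.ofReal_mul (abs_nonneg _)]
    apply ENNReal.ofReal_le_ofReal
    rw [abs_of_pos (by linarith), hP]
    simp only [add_sub_cancel]
    have h7 : √(V / f (a t) * (V / g (b t))) = V / √(f (a t) * g (b t)) := by
      rw [div_mul_div_comm, Real.sqrt_div (by positivity), Real.sqrt_mul_self hV.le]
    rw [h7]
    have := Real.sqrt_pos.2 (mul_pos h5 h6)
    apply le_of_eq
    field_simp
  have hm : AEStronglyMeasurable (fun t => V * (1 + P t)) (volume.restrict (Set.Ioo 0 1)) :=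
    (continuousOn_const.mul (continuousOn_const.add hPc)).aestronglyMeasurable measurableSet_Ioo
  have h0 : 0 ≤ᵐ[volume.restrict (Set.Ioo 0 1)] fun t => V * (1 + P t) :=
    (ae_restrict_iff' measurableSet_Ioo).2 (Eventually.of_forall fun t ht => by
      have := hP0 t ht
      simp only [Pi.zero_apply]
      positivity)
  have hi : IntegrableOn (fun t => V * (1 + P t)) (Set.Ioo 0 1) := by
    refine ⟨hm, ?_⟩
    rw [hasFiniteIntegral_iff_ofReal h0]
    exact h2.trans_lt ENNReal.ofReal_lt_top
  have h3 : ∫ t in Set.Ioo (0 : ℝ) 1, V * (1 + P t) ≤ V * (1 + η) := by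
    rw [integral_eq_lintegral_of_nonneg_ae h0 hm]
    exact ENNReal.toReal_le_of_le_ofReal (by positivity) h2
  have hiP : IntegrableOn P (Set.Ioo 0 1) := by
    have h4 : IntegrableOn (fun t => V⁻¹ * (V * (1 + P t)) - 1) (Set.Ioo 0 1) :=
      (hi.const_mul _).sub (integrable_const _)
    refine h4.congr_fun (fun t _ => ?_) measurableSet_Ioo
    simp only
    field_simp
    ring
  have h5 : ∫ t in Set.Ioo (0 : ℝ) 1, P t ≤ η := by
    rw [integral_const_mul, integral_add (integrable_const _) hiP] at h3
    simp at h3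
    nlinarith
  rw [intervalIntegral.integral_of_le hστ]
  refine le_trans (setIntegral_mono_set hiP ?_ ?_) h5
  · exact (ae_restrict_iff' measurableSet_Ioo).2 (Eventually.of_forall hP0)
  · exact Eventually.of_forall fun t ht => ⟨hσ.trans ht.1, ht.2.trans_lt hτ⟩

theorem IsProfile.abs_sub_le (hf : IsProfile n W V f a₀ a₁) (hg : IsProfile n W V g b₀ b₁)
    (qa : IsQuantile V f a₀ a₁ a) (qb : IsQuantile V g b₀ b₁ b) (hV : 0 < V)
    {h : ℝ → ℝ≥0∞} {η δ θ : ℝ} (hη : 0 ≤ η) (hδ : 0 < δ) (hθ : 0 < θ)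
    (hh : ∀ x ∈ Set.Ioo a₀ a₁, ∀ y ∈ Set.Ioo b₀ b₁,
      ENNReal.ofReal (√(f x * g y)) ≤ h ((x + y) / 2))
    (hintg : ∫⁻ z, h z ≤ ENNReal.ofReal (V * (1 + η))) {σ τ : ℝ} (hσ : δ ≤ σ) (hστ : σ ≤ τ)
    (hτ : τ ≤ 1 - δ) :
    |(a τ - b τ) - (a σ - b σ)| ≤ η / θ + θ * (W / δ) * (2 * W) := by
  have hsub : ∀ t ∈ Set.uIcc σ τ, t ∈ Set.Ioo (0 : ℝ) 1 := by
    intro t ht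
    rw [Set.uIcc_of_le hστ] at ht
    exact ⟨by linarith [ht.1], by linarith [ht.2]⟩
  have hXc : ContinuousOn (fun τ => V / f (a τ)) (Set.uIcc σ τ) := (hf.continuousOn_deriv qa).mono hsub
  have hYc : ContinuousOn (fun τ => V / g (b τ)) (Set.uIcc σ τ) := (hg.continuousOn_deriv qb).mono hsub
  have e1 : ∫ t in σ..τ, V / f (a t) = a τ - a σ :=
    intervalIntegral.integral_eq_sub_of_hasDerivAt (fun t ht => qa.deriv t (hsub t ht))
      hXc.intervalIntegrable
  have e2 : ∫ t in σ..τ, V / g (b t) = b τ - b σ :=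
    intervalIntegral.integral_eq_sub_of_hasDerivAt (fun t ht => qb.deriv t (hsub t ht))
      hYc.intervalIntegrable
  have e3 : (a τ - b τ) - (a σ - b σ) = ∫ t in σ..τ, (V / f (a t) - V / g (b t)) := by
    rw [intervalIntegral.integral_sub hXc.intervalIntegrable hYc.intervalIntegrable, e1, e2]; ring
  have hX : ∀ t ∈ Set.Ioo (0 : ℝ) 1, 0 < V / f (a t) := fun t ht => div_pos hV (hf.pos _ (qa.mem t ht))
  have hY : ∀ t ∈ Set.Ioo (0 : ℝ) 1, 0 < V / g (b t) := fun t ht => div_pos hV (hg.pos _ (qb.mem t ht))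
  have hPc : ContinuousOn (fun t => (V / f (a t) + V / g (b t)) /
      (2 * √(V / f (a t) * (V / g (b t)))) - 1) (Set.uIcc σ τ) := by
    refine ContinuousOn.sub (ContinuousOn.div (hXc.add hYc)
      (continuousOn_const.mul ((hXc.mul hYc).sqrt)) ?_) continuousOn_const
    intro t ht
    have := Real.sqrt_pos.2 (mul_pos (hX t (hsub t ht)) (hY t (hsub t ht)))
    positivity
  have h1 : ∫ t in σ..τ, (((V / f (a t) + V / g (b t)) /
      (2 * √(V / f (a t) * (V / g (b t)))) - 1) / θ + θ * (W / δ) * (V / f (a t) + V / g (b t)))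
      ≤ η / θ + θ * (W / δ) * (2 * W) := by
    rw [intervalIntegral.integral_add (hPc.intervalIntegrable.div_const _)
      ((hXc.intervalIntegrable.add hYc.intervalIntegrable).const_mul _),
      intervalIntegral.integral_div, intervalIntegral.integral_const_mul,
      intervalIntegral.integral_add hXc.intervalIntegrable hYc.intervalIntegrable, e1, e2]
    have h2 := hf.integral_deficit_le hg qa qb hV hη hh hintg (hδ.trans_le hσ) hστ
      (by linarith : τ < 1)
    have hW : 0 < W := by linarith [hf.width, hf.lt]
    have hσ' := hsub σ Set.left_mem_uIcc
    have hτ' := hsub τ Set.right_mem_uIcc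
    have h3 := hf.width
    have h4 := hg.width
    have h5 := qa.mem _ hσ'
    have h6 := qa.mem _ hτ'
    have h7 := qb.mem _ hσ'
    have h8 := qb.mem _ hτ'
    gcongr
    linarith [h5.1, h6.2, h7.1, h8.2]
  rw [e3]
  refine le_trans (intervalIntegral.abs_integral_le_integral_abs hστ) (le_trans ?_ h1)
  refine intervalIntegral.integral_mono_on hστ ?_ ?_ fun t ht => ?_
  · exact (hXc.sub hYc).abs.intervalIntegrable
  · exact ((hPc.div_const _).add (continuousOn_const.mul (hXc.add hYc))).intervalIntegrable
  · have ht' : t ∈ Set.Icc δ (1 - δ) := ⟨hσ.trans ht.1, ht.2.trans hτ⟩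
    have ht2 := hsub t (by rwa [Set.uIcc_of_le hστ])
    exact abs_sub_le_of_geom_mean (hX t ht2) (hY t ht2) (hf.deriv_le qa hV hδ ht')
      (hg.deriv_le qb hV hδ ht') hθ

/-- One-dimensional stability: right end points are close relative to the means. -/
theorem IsProfile.abs_end_sub_mean_le (hf : IsProfile n W V f a₀ a₁) (hg : IsProfile n W V g b₀ b₁)
    (hn : n ≠ 0) {h : ℝ → ℝ≥0∞} {e : ℝ} (he : 0 < e)
    (hh : ∀ x ∈ Set.Ioo a₀ a₁, ∀ y ∈ Set.Ioo b₀ b₁,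
      ENNReal.ofReal (√(f x * g y)) ≤ h ((x + y) / 2))
    (hintg : ∫⁻ z, h z ≤ ENNReal.ofReal (V * (1 + e ^ (n + 2)))) :
    |(a₁ - b₁) - ((∫ z in a₀..a₁, z * f z) / V - (∫ z in b₀..b₁, z * g z) / V)|
      ≤ (1 + 3 * W + 2 * W ^ 2) * e := by
  obtain ⟨hV, a, qa⟩ := hf.exists_isQuantile
  obtain ⟨-, b, qb⟩ := hg.exists_isQuantile
  have hW : 0 < W := by linarith [hf.width, hf.lt]
  have hWe : 0 < W * e := by positivity
  have hup : ∀ τ ∈ Set.Ioo (0 : ℝ) 1, 1 - τ ≤ e ^ n → |(a τ - b τ) - (a₁ - b₁)| ≤ W * e := by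
    intro τ hτ h1
    have h2 := hf.upper_le qa hV hn he hτ h1
    have h3 := hg.upper_le qb hV hn he hτ h1
    rw [abs_le]; constructor <;> linarith [h2.1, h2.2, h3.1, h3.2]
  have hlo : ∀ τ ∈ Set.Ioo (0 : ℝ) 1, τ ≤ e ^ n → |(a τ - b τ) - (a₀ - b₀)| ≤ W * e := by
    intro τ hτ h1
    have h2 := hf.lower_le qa hV hn he hτ h1
    have h3 := hg.lower_le qb hV hn he hτ h1
    rw [abs_le]; constructor <;> linarith [h2.1, h2.2, h3.1, h3.2]
  have hW2 : 0 < W ^ 2 * e := by positivity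
  have key : ∀ τ ∈ Set.Ioo (0 : ℝ) 1, |(a τ - b τ) - (a₁ - b₁)| ≤ (1 + 3 * W + 2 * W ^ 2) * e := by
    have hen : 0 < e ^ n := by positivity
    rcases le_or_gt (1 / 2) (e ^ n) with hc | hc
    · intro τ hτ
      have h1 := abs_le.1 (hup (1 / 2) ⟨by norm_num, by norm_num⟩ (by linarith))
      have h2 := abs_le.1 (hlo (1 / 2) ⟨by norm_num, by norm_num⟩ hc)
      rw [abs_le]
      rcases le_total τ (1 / 2) with h | h
      · have h3 := abs_le.1 (hlo τ hτ (h.trans hc))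
        constructor <;> linarith [h1.1, h1.2, h2.1, h2.2, h3.1, h3.2]
      · have h3 := abs_le.1 (hup τ hτ (by linarith))
        constructor <;> linarith [h3.1, h3.2]
    · have hmid : ∀ σ, e ^ n ≤ σ → σ ≤ 1 - e ^ n →
          |(a (1 - e ^ n) - b (1 - e ^ n)) - (a σ - b σ)| ≤ e + 2 * W ^ 2 * e := by
        intro σ h1 h2
        refine (hf.abs_sub_le hg qa qb hV (by positivity) hen (by positivity : 0 < e ^ (n + 1))
          hh hintg h1 h2 le_rfl).trans (le_of_eq ?_)
        rw [pow_add, pow_add]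
        field_simp
      have hm1 : (1 - e ^ n) ∈ Set.Ioo (0 : ℝ) 1 := ⟨by linarith, by linarith⟩
      have hm0 : e ^ n ∈ Set.Ioo (0 : ℝ) 1 := ⟨by linarith, by linarith⟩
      have h1 := abs_le.1 (hup _ hm1 (by linarith))
      intro τ hτ
      rw [abs_le]
      rcases le_total (1 - e ^ n) τ with h | h
      · have h3 := abs_le.1 (hup τ hτ (by linarith))
        constructor <;> linarith [h3.1, h3.2]
      rcases le_total (e ^ n) τ with h' | h'
      · have h3 := abs_le.1 (hmid τ h' h)
        constructor <;> linarith [h1.1, h1.2, h3.1, h3.2]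
      · have h3 := abs_le.1 (hmid _ le_rfl (by linarith))
        have h4 := abs_le.1 (hlo τ hτ h')
        have h5 := abs_le.1 (hlo _ hm0 le_rfl)
        constructor <;> linarith [h1.1, h1.2, h3.1, h3.2, h4.1, h4.2, h5.1, h5.2]
  have ia := integrableOn_quantile qa.mem qa.continuousOn
  have ib := integrableOn_quantile qb.mem qb.continuousOn
  rw [← integral_quantile hV hf.pos qa.mem qa.mono qa.deriv qa.image hf.lt.le,
    ← integral_quantile hV hg.pos qb.mem qb.mono qb.deriv qb.image hg.lt.le]
  have h1 : ∫ τ in Set.Ioo (0 : ℝ) 1, ((a τ - b τ) - (a₁ - b₁)) =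
      ((∫ τ in Set.Ioo (0 : ℝ) 1, a τ) - ∫ τ in Set.Ioo (0 : ℝ) 1, b τ) - (a₁ - b₁) := by
    have h2 : IntegrableOn (fun τ => a τ - b τ) (Set.Ioo 0 1) := ia.sub ib
    rw [integral_sub h2 (integrable_const _), integral_sub ia ib]
    simp
  rw [abs_sub_comm, ← h1]
  have := norm_setIntegral_le_of_norm_le_const (μ := volume) (s := Set.Ioo (0 : ℝ) 1)
    (f := fun τ => (a τ - b τ) - (a₁ - b₁)) (by simp) key
  simpa using this

end

section
variable {m : ℕ}

theorem slice_inter {A : Set (Fin (m + 1) → ℝ)} {s : Set ℝ} {z : ℝ} (hz : z ∈ s) :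
    slice (A ∩ {x | x 0 ∈ s}) z = slice A z := by
  ext y
  simp [slice, hz]

theorem homothety_pow_mul_le {E : Type*} [NormedAddCommGroup E] [NormedSpace ℝ E] [MeasurableSpace E]
    [BorelSpace E] [FiniteDimensional ℝ E] (μ : Measure E) [μ.IsAddHaarMeasure]
    {A B : Set E} {p : E} {ρ : ℝ} (hρ : 0 ≤ ρ) (hB : μ B ≠ ⊤)
    (h : ∀ x ∈ A, ρ • (x - p) + p ∈ B) :
    ρ ^ Module.finrank ℝ E * μ.real A ≤ μ.real B := by
  have h1 : AffineMap.homothety p ρ '' A ⊆ B := by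
    rintro _ ⟨x, hx, rfl⟩
    simpa [AffineMap.homothety_apply] using h x hx
  have h2 := measureReal_mono h1 hB
  rwa [measureReal_def, Measure.addHaar_image_homothety, ENNReal.toReal_mul,
    abs_of_nonneg (by positivity), ENNReal.toReal_ofReal (by positivity)] at h2

theorem IsFullBody.isProfile {A : Set (Fin (m + 1) → ℝ)} (hA : IsFullBody A) {a₀ a₁ W : ℝ}
    (hlt : a₀ < a₁) (hb : ∀ x ∈ A, x 0 ∈ Set.Icc a₀ a₁) (h0 : ∃ p ∈ A, p 0 = a₀)
    (h1 : ∃ p ∈ A, p 0 = a₁) (hs : ∀ z ∈ Set.Ioo a₀ a₁, IsFullBody (slice A z))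
    (hW : a₁ - a₀ ≤ W) :
    IsProfile (m + 1) W (volume.real A) (fun z => volume.real (slice A z)) a₀ a₁ := by
  have hW0 : 0 < W := by linarith
  refine ⟨hlt, continuousOn_slice (brunnMinkowski m) hA hs, fun z hz => (hs z hz).volume_pos,
    intervalIntegrable_slice hA.2 hlt.le hb, fun x hx z hz y hxy hyz =>
      min_slice_le (brunnMinkowski m) hA hs hx hz hxy hyz, hW, integral_slice hA.2 hlt.le hb, ?_, ?_⟩
  · intro x hx
    obtain ⟨p, hp, hp1⟩ := h1
    set B := A ∩ {y | y 0 ∈ Set.Icc x a₁} with hBdef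
    have hBc : IsCompact B := hA.2.inter_right (isClosed_Icc.preimage (continuous_apply 0))
    have e1 : ∫ t in x..a₁, volume.real (slice A t) = volume.real B := by
      rw [← integral_slice hBc hx.2.le fun y hy => hy.2]
      refine intervalIntegral.integral_congr fun t ht => ?_
      rw [Set.uIcc_of_le hx.2.le] at ht
      simp only [hBdef, slice_inter ht]
    rw [e1]
    have hρ0 : 0 ≤ (a₁ - x) / W := div_nonneg (by linarith [hx.2]) hW0.le
    have hρ1 : (a₁ - x) / W ≤ 1 := (div_le_one hW0).2 (by linarith [hx.1])
    have := homothety_pow_mul_le volume (p := p) (A := A) (B := B) (ρ := (a₁ - x) / W) hρ0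
      hBc.measure_lt_top.ne fun y hy => ?_
    · simpa using this
    · have hmem : ((a₁ - x) / W) • (y - p) + p ∈ A := by
        have := hA.1 hy hp hρ0 (sub_nonneg.2 hρ1) (by ring)
        convert this using 1
        module
      refine ⟨hmem, ?_, (hb _ hmem).2⟩
      have h3 := (hb y hy).1
      have h4 : (a₁ - x) / W * (a₁ - y 0) ≤ a₁ - x := by
        rw [div_mul_eq_mul_div, div_le_iff₀ hW0]
        exact mul_le_mul_of_nonneg_left (by linarith) (by linarith [hx.2])
      simp only [Pi.add_apply, Pi.smul_apply, Pi.sub_apply, smul_eq_mul, hp1]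
      linarith
  · intro x hx
    obtain ⟨p, hp, hp1⟩ := h0
    set B := A ∩ {y | y 0 ∈ Set.Icc a₀ x} with hBdef
    have hBc : IsCompact B := hA.2.inter_right (isClosed_Icc.preimage (continuous_apply 0))
    have e1 : ∫ t in a₀..x, volume.real (slice A t) = volume.real B := by
      rw [← integral_slice hBc hx.1.le fun y hy => hy.2]
      refine intervalIntegral.integral_congr fun t ht => ?_
      rw [Set.uIcc_of_le hx.1.le] at ht
      simp only [hBdef, slice_inter ht]
    rw [e1]
    have hρ0 : 0 ≤ (x - a₀) / W := div_nonneg (by linarith [hx.1]) hW0.le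
    have hρ1 : (x - a₀) / W ≤ 1 := (div_le_one hW0).2 (by linarith [hx.2])
    have := homothety_pow_mul_le volume (p := p) (A := A) (B := B) (ρ := (x - a₀) / W) hρ0
      hBc.measure_lt_top.ne fun y hy => ?_
    · simpa using this
    · have hmem : ((x - a₀) / W) • (y - p) + p ∈ A := by
        have := hA.1 hy hp hρ0 (sub_nonneg.2 hρ1) (by ring)
        convert this using 1
        module
      refine ⟨hmem, (hb _ hmem).1, ?_⟩
      have h3 := (hb y hy).2
      have h4 : (x - a₀) / W * (y 0 - a₀) ≤ x - a₀ := by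
        rw [div_mul_eq_mul_div, div_le_iff₀ hW0]
        exact mul_le_mul_of_nonneg_left (by linarith) (by linarith [hx.1])
      simp only [Pi.add_apply, Pi.smul_apply, Pi.sub_apply, smul_eq_mul, hp1]
      linarith

theorem integral_mul_slice {A : Set (Fin (m + 1) → ℝ)} (hA : IsCompact A) {a₀ a₁ : ℝ}
    (hlt : a₀ ≤ a₁) (hb : ∀ x ∈ A, x 0 ∈ Set.Icc a₀ a₁) :
    ∫ z in a₀..a₁, z * volume.real (slice A z) = ∫ x in A, x 0 := by
  have e := (volume_preserving_piFinSuccAbove (fun _ : Fin (m + 1) => ℝ) 0).symm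
  rw [← e.setIntegral_preimage_emb (MeasurableEquiv.measurableEmbedding _)]
  have hms := e.measurable hA.measurableSet
  rw [← integral_indicator hms, Measure.volume_eq_prod, integral_prod]
  · rw [intervalIntegral.integral_of_le hlt, ← integral_Icc_eq_integral_Ioc,
      setIntegral_eq_integral_of_forall_compl_eq_zero]
    · refine integral_congr_ae (Eventually.of_forall fun z => ?_)
      have h1 : ∀ y : Fin m → ℝ, ((MeasurableEquiv.piFinSuccAbove (fun _ : Fin (m + 1) => ℝ) 0).symm ⁻¹'
          A).indicator (fun x => (MeasurableEquiv.piFinSuccAbove (fun _ : Fin (m + 1) => ℝ) 0).symm x 0) (z, y)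
          = (slice A z).indicator (fun _ => z) y := by
        intro y
        rw [← prodMk_preimage_eq_slice]
        simp only [Set.indicator, Set.mem_preimage]
        simp [MeasurableEquiv.piFinSuccAbove_symm_apply, Fin.insertNthEquiv]
        rfl
      simp only [h1]
      rw [integral_indicator_const _ (isCompact_slice hA z).measurableSet, smul_eq_mul, mul_comm]
    · intro z hz
      rw [slice_eq_empty hb hz]
      simp
  · rw [← Measure.volume_eq_prod, integrable_indicator_iff hms]
    have h2 : IntegrableOn (fun x : Fin (m + 1) → ℝ => x 0) A :=
      (continuous_apply 0).continuousOn.integrableOn_compact hA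
    exact (e.integrableOn_comp_preimage (MeasurableEquiv.measurableEmbedding _)).2 h2

/-- Stability of the Brunn–Minkowski inequality in a coordinate direction. -/
theorem abs_sub_le_of_volume_mix {A B : Set (Fin (m + 1) → ℝ)} (hA : IsFullBody A)
    (hB : IsFullBody B) {W V e α β : ℝ} (he : 0 < e) (hVA : volume.real A = V)
    (hVB : volume.real B = V)
    (hWA : ∀ x ∈ A, ∀ y ∈ A, x 0 - y 0 ≤ W) (hWB : ∀ x ∈ B, ∀ y ∈ B, x 0 - y 0 ≤ W)
    (hM : volume.real (minkowskiMix (1 / 2) A B) ≤ V * (1 + e ^ (m + 3)))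
    (hα : IsGreatest ((fun x => x 0) '' A) α) (hβ : IsGreatest ((fun x => x 0) '' B) β) :
    |(α - β) - ((∫ x in A, x 0) / V - (∫ x in B, x 0) / V)| ≤ (1 + 3 * W + 2 * W ^ 2) * e := by
  obtain ⟨a₀, a₁, hlta, hba, ha0, ha1, hsa⟩ := hA.exists_slice_bounds
  obtain ⟨b₀, b₁, hltb, hbb, hb0, hb1, hsb⟩ := hB.exists_slice_bounds
  have hα1 : α = a₁ := by
    obtain ⟨p, hp, rfl⟩ := ha1
    obtain ⟨⟨q, hq, rfl⟩, h2⟩ := hα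
    exact le_antisymm (hba q hq).2 (h2 ⟨p, hp, rfl⟩)
  have hβ1 : β = b₁ := by
    obtain ⟨p, hp, rfl⟩ := hb1
    obtain ⟨⟨q, hq, rfl⟩, h2⟩ := hβ
    exact le_antisymm (hbb q hq).2 (h2 ⟨p, hp, rfl⟩)
  subst hα1 hβ1
  have pA := hA.isProfile (W := W) hlta hba ha0 ha1 hsa (by
    obtain ⟨p, hp, rfl⟩ := ha1
    obtain ⟨q, hq, rfl⟩ := ha0
    exact hWA p hp q hq)
  have pB := hB.isProfile (W := W) hltb hbb hb0 hb1 hsb (by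
    obtain ⟨p, hp, rfl⟩ := hb1
    obtain ⟨q, hq, rfl⟩ := hb0
    exact hWB p hp q hq)
  rw [hVA] at pA
  rw [hVB] at pB
  have hMc := hA.2.minkowskiMix hB.2 (1 / 2)
  have := pA.abs_end_sub_mean_le pB (by simp) (e := e)
    (h := fun z => volume (slice (minkowskiMix (1 / 2) A B) z)) he ?_ ?_
  · rwa [integral_mul_slice hA.2 hlta.le hba, integral_mul_slice hB.2 hltb.le hbb] at this
  · intro x hx y hy
    have h1 := slice_mul_le (brunnMinkowski m) hA.2 hB.2 (hsa x hx) (hsb y hy)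
      (t := 1 / 2) (by norm_num) (by norm_num)
    rw [ENNReal.ofReal_le_iff_le_toReal (isCompact_slice hMc _).measure_lt_top.ne]
    convert h1 using 1
    · rw [Real.sqrt_eq_rpow, Real.mul_rpow measureReal_nonneg measureReal_nonneg]
      norm_num
    · rw [measureReal_def]
      congr 3
      ring
  · rw [← volume_eq_lintegral_slice hMc.measurableSet,
      ENNReal.le_ofReal_iff_toReal_le hMc.measure_lt_top.ne]
    · exact hM
    · have := hA.volume_pos (μ := volume)
      rw [hVA] at this
      positivity

end

/-- The support function of a set. -/
def supp {n : ℕ} (K : Set (En n)) (u : En n) : ℝ := sSup ((fun x => ⟪x, u⟫_ℝ) '' K)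

section
variable {n : ℕ} {K L : Set (En n)}

theorem isGreatest_supp (hK : IsCompact K) (hne : K.Nonempty) (u : En n) :
    IsGreatest ((fun x => ⟪x, u⟫_ℝ) '' K) (supp K u) :=
  (hK.image (by fun_prop)).isGreatest_sSup (hne.image _)

theorem le_supp (hK : IsCompact K) {x : En n} (hx : x ∈ K) (u : En n) : ⟪x, u⟫_ℝ ≤ supp K u :=
  (isGreatest_supp hK ⟨x, hx⟩ u).2 ⟨x, hx, rfl⟩

theorem exists_eq_supp (hK : IsCompact K) (hne : K.Nonempty) (u : En n) :
    ∃ x ∈ K, ⟪x, u⟫_ℝ = supp K u := (isGreatest_supp hK hne u).1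

theorem supp_le (hne : K.Nonempty) {u : En n} {c : ℝ} (h : ∀ x ∈ K, ⟪x, u⟫_ℝ ≤ c) : supp K u ≤ c :=
  csSup_le (hne.image _) (by rintro _ ⟨x, hx, rfl⟩; exact h x hx)

theorem supp_eq (hK : IsCompact K) {x u : En n} (hx : x ∈ K) (h : ∀ y ∈ K, ⟪y - x, u⟫_ℝ ≤ 0) :
    supp K u = ⟪x, u⟫_ℝ := by
  refine le_antisymm (supp_le ⟨x, hx⟩ fun y hy => ?_) (le_supp hK hx u)
  have := h y hy
  rw [inner_sub_left] at this
  linarith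

theorem IsFullBody.image_equiv {E F : Type*} [NormedAddCommGroup E] [NormedSpace ℝ E]
    [NormedAddCommGroup F] [NormedSpace ℝ F] {A : Set E} (hA : IsFullBody A) (T : E ≃L[ℝ] F) :
    IsFullBody (T '' A) := by
  refine ⟨hA.1.linear_image T.toLinearEquiv.toLinearMap, hA.2.image T.continuous, ?_⟩
  have := T.toHomeomorph.image_interior A
  change T '' interior A = interior (T '' A) at this
  rw [← this]
  exact hA.3.image _

theorem image_minkowskiMix {E F : Type*} [AddCommGroup E] [Module ℝ E] [AddCommGroup F] [Module ℝ F]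
    (T : E →ₗ[ℝ] F) (t : ℝ) (A B : Set E) :
    T '' minkowskiMix t A B = minkowskiMix t (T '' A) (T '' B) := by
  refine Set.image_image2_distrib fun x y => ?_
  simp

/-- Coordinates on `En (m + 1)` with a prescribed first direction. -/
theorem exists_volume_preserving_coordinates {m : ℕ} {u : En (m + 1)} (hu : ‖u‖ = 1) :
    ∃ T : En (m + 1) ≃L[ℝ] (Fin (m + 1) → ℝ), MeasurePreserving T ∧
      (∀ x, T x 0 = ⟪x, u⟫_ℝ) ∧ ∀ x, ‖x‖ = ‖WithLp.toLp 2 (T x)‖ := by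
  obtain ⟨b, hb⟩ := Orthonormal.exists_orthonormalBasis_extension_of_card_eq (𝕜 := ℝ)
    (E := En (m + 1)) (ι := Fin (m + 1)) (by simp) (v := fun _ => u) (s := {0}) (by
      rw [orthonormal_iff_ite]
      rintro ⟨i, hi⟩ ⟨j, hj⟩
      simp only [Set.mem_singleton_iff] at hi hj
      subst hi hj
      simp [hu])
  have hb0 : b 0 = u := hb 0 rfl
  refine ⟨b.repr.toContinuousLinearEquiv.trans (PiLp.continuousLinearEquiv 2 ℝ _), ?_, ?_, ?_⟩
  · exact (PiLp.volume_preserving_ofLp (Fin (m + 1))).comp b.measurePreserving_repr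
  · intro x
    change b.repr x 0 = _
    rw [b.repr_apply_apply, hb0, real_inner_comm]
  · intro x
    exact (b.repr.norm_map x).symm

/-- The moment vector `∫_K x dx`. -/
def momentVector (K : Set (En n)) : En n := ∫ x in K, x

theorem setIntegral_inner (hK : IsCompact K) (u : En n) :
    ∫ x in K, ⟪x, u⟫_ℝ = ⟪momentVector K, u⟫_ℝ := by
  have hi : IntegrableOn (fun x : En n => x) K := continuous_id.continuousOn.integrableOn_compact hK
  have := integral_inner (𝕜 := ℝ) hi u
  rw [momentVector, real_inner_comm, ← this]
  exact integral_congr_ae (Eventually.of_forall fun x => real_inner_comm _ _)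

/-- Stability of the Brunn–Minkowski inequality: support functions of bodies of equal volume are
close up to a translation. -/
theorem abs_supp_sub_le (hn : n ≠ 0) (hK : IsFullBody K) (hL : IsFullBody L) {W V e : ℝ}
    (he : 0 < e) (hVK : volume.real K = V) (hVL : volume.real L = V)
    (hWK : ∀ x ∈ K, ∀ y ∈ K, ‖x - y‖ ≤ W) (hWL : ∀ x ∈ L, ∀ y ∈ L, ‖x - y‖ ≤ W)
    (hM : volume.real (minkowskiMix (1 / 2) K L) ≤ V * (1 + e ^ (n + 2))) {u : En n}
    (hu : ‖u‖ = 1) :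
    |supp K u - supp L u - ⟪V⁻¹ • (momentVector K - momentVector L), u⟫_ℝ|
      ≤ (1 + 3 * W + 2 * W ^ 2) * e := by
  obtain ⟨m, rfl⟩ := Nat.exists_eq_succ_of_ne_zero hn
  obtain ⟨T, hT, hT0, -⟩ := exists_volume_preserving_coordinates hu
  have hTe : MeasurableEmbedding T := T.toHomeomorph.measurableEmbedding
  have hvol : ∀ S : Set (En (m + 1)), volume.real (T '' S) = volume.real S := by
    intro S
    rw [measureReal_def, measureReal_def, ← hT.measure_preimage_emb hTe,
      Set.preimage_image_eq _ T.injective]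
  have hintg : ∀ S : Set (En (m + 1)), IsCompact S →
      ∫ x in T '' S, x 0 = ⟪momentVector S, u⟫_ℝ := by
    intro S hS
    rw [hT.setIntegral_image_emb hTe (fun x => x 0) S, ← setIntegral_inner hS]
    simp only [hT0]
  have hgr : ∀ S : Set (En (m + 1)), IsCompact S → S.Nonempty →
      IsGreatest ((fun x => x 0) '' (T '' S)) (supp S u) := by
    intro S hS hne
    rw [Set.image_image]
    simpa only [hT0] using isGreatest_supp hS hne u
  have hwid : ∀ S : Set (En (m + 1)), (∀ x ∈ S, ∀ y ∈ S, ‖x - y‖ ≤ W) →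
      ∀ x ∈ T '' S, ∀ y ∈ T '' S, x 0 - y 0 ≤ W := by
    rintro S hS _ ⟨x, hx, rfl⟩ _ ⟨y, hy, rfl⟩
    rw [hT0, hT0, ← inner_sub_left]
    refine (real_inner_le_norm _ _).trans ?_
    rw [hu, mul_one]
    exact hS x hx y hy
  have := abs_sub_le_of_volume_mix (hK.image_equiv T) (hL.image_equiv T) he ((hvol K).trans hVK)
    ((hvol L).trans hVL) (hwid K hWK) (hwid L hWL) ?_ (hgr K hK.2 hK.nonempty)
    (hgr L hL.2 hL.nonempty)
  · rw [hintg K hK.2, hintg L hL.2] at this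
    convert this using 2
    rw [inner_smul_left, inner_sub_left]
    simp only [conj_trivial]
    ring
  · have h2 := image_minkowskiMix (T.toLinearEquiv.toLinearMap) (1 / 2) K L
    change T '' _ = minkowskiMix (1 / 2) (T '' K) (T '' L) at h2
    rw [← h2, hvol]
    exact hM

end

/-- The points of the half space `⟪·, u⟫ > 0` projecting radially into `B ⊆ {⟪·, u⟫ = 1}`. -/
def sector {n : ℕ} (u : En n) (B : Set (En n)) : Set (En n) :=
  {y | 0 < ⟪y, u⟫_ℝ ∧ (⟪y, u⟫_ℝ)⁻¹ • y ∈ B}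

theorem measurableSet_sector {n : ℕ} (u : En n) {B : Set (En n)} (hB : MeasurableSet B) :
    MeasurableSet (sector u B) := by
  have h1 : Measurable fun y : En n => ⟪y, u⟫_ℝ := by fun_prop
  have h2 : Measurable fun y : En n => (⟪y, u⟫_ℝ)⁻¹ • y := h1.inv.smul measurable_id
  exact (measurableSet_lt measurable_const h1).inter (h2 hB)

theorem setLIntegral_pow (m : ℕ) {a : ℝ} (ha : 0 ≤ a) :
    ∫⁻ z in Set.Ioc 0 a, ENNReal.ofReal (z ^ m) = ENNReal.ofReal (a ^ (m + 1) / (m + 1)) := by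
  rw [← ofReal_integral_eq_lintegral_ofReal]
  · rw [← intervalIntegral.integral_of_le ha, integral_pow]
    simp
  · exact ((continuous_pow m).continuousOn.integrableOn_compact isCompact_Icc).mono_set
      Set.Ioc_subset_Icc_self
  · exact (ae_restrict_iff' measurableSet_Ioc).2 (Eventually.of_forall fun z hz => by
      have := hz.1
      simp only [Pi.zero_apply]
      positivity)

/-- Volume of a truncated cone over a subset of an affine hyperplane. -/
theorem exists_cone_volume (m : ℕ) : ∃ κ : ℝ≥0, 0 < κ ∧ ∀ u : En (m + 1), ‖u‖ = 1 →
    ∀ B : Set (En (m + 1)), MeasurableSet B → (∀ x ∈ B, ⟪x, u⟫_ℝ = 1) → ∀ a : ℝ, 0 ≤ a →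
      volume (sector u B ∩ {y | ⟪y, u⟫_ℝ ≤ a}) = ENNReal.ofReal (a ^ (m + 1)) * (κ * μH[m] B) := by
  have hH : (μH[m] : Measure (En m)).IsAddHaarMeasure := by
    simpa using MeasureTheory.isAddHaarMeasure_hausdorffMeasure (E := En m)
  set c := Measure.addHaarScalarFactor (volume : Measure (En m)) μH[m] with hc
  have hcpos : 0 < c := Measure.addHaarScalarFactor_pos_of_isAddHaarMeasure _ _
  have hcv : (volume : Measure (En m)) = c • μH[m] := MeasureTheory.Measure.isAddLeftInvariant_eq_smul _ _
  refine ⟨c / (m + 1), by positivity, ?_⟩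
  intro u hu B hB hB1 a ha
  obtain ⟨T, hT, hT0, hTn⟩ := exists_volume_preserving_coordinates hu
  have hTe : MeasurableEmbedding T := T.toHomeomorph.measurableEmbedding
  set C := sector u B ∩ {y | ⟪y, u⟫_ℝ ≤ a} with hC
  have hCm : MeasurableSet C := by
    refine (measurableSet_sector u hB).inter (measurableSet_le ?_ measurable_const)
    fun_prop
  have hT0' : ∀ z (y : Fin m → ℝ), ⟪T.symm (Fin.cons z y), u⟫_ℝ = z := by
    intro z y
    rw [← hT0]
    simp
  have h1 : volume C = volume (T.symm ⁻¹' C) := by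
    rw [← hT.measure_preimage_emb hTe, ← Set.preimage_comp]
    simp
  have hBm : MeasurableSet (T.symm ⁻¹' B) := T.symm.continuous.measurable hB
  have h2 : ∀ z, volume (slice (T.symm ⁻¹' C) z) =
      (Set.Ioc 0 a).indicator (fun z => ENNReal.ofReal (z ^ m) * volume (slice (T.symm ⁻¹' B) 1)) z := by
    intro z
    by_cases hz : z ∈ Set.Ioc 0 a
    · rw [Set.indicator_of_mem hz]
      have h3 : slice (T.symm ⁻¹' C) z = (fun y => z⁻¹ • y) ⁻¹' (slice (T.symm ⁻¹' B) 1) := by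
        ext y
        have h4 : z⁻¹ • T.symm (Fin.cons z y) = T.symm (Fin.cons 1 (z⁻¹ • y)) := by
          rw [← map_smul]
          congr 1
          ext i
          refine Fin.cases ?_ (fun j => ?_) i
          · simp [hz.1.ne']
          · simp
        simp only [slice, hC, sector, Set.mem_preimage, Set.mem_ofPred_eq, Set.mem_inter_iff, hT0', h4]
        simp [hz.1, hz.2]
      rw [h3, Measure.addHaar_preimage_smul _ (inv_ne_zero hz.1.ne')]
      have := hz.1
      simp [abs_of_pos this]
    · rw [Set.indicator_of_notMem hz]
      convert measure_empty (μ := (volume : Measure (Fin m → ℝ)))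
      ext y
      simp only [slice, hC, sector, Set.mem_preimage, Set.mem_ofPred_eq, Set.mem_inter_iff, hT0',
        Set.mem_empty_iff_false, iff_false]
      rintro ⟨⟨h3, -⟩, h4⟩
      exact hz ⟨h3, h4⟩
  rw [h1, volume_eq_lintegral_slice (T.symm.continuous.measurable hCm)]
  simp only [h2]
  have hpm : Measurable fun z : ℝ => ENNReal.ofReal (z ^ m) := by fun_prop
  rw [lintegral_indicator measurableSet_Ioc, lintegral_mul_const _ hpm, setLIntegral_pow m ha]
  let ι : En m → En (m + 1) := fun p => T.symm (Fin.cons 1 (WithLp.ofLp p))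
  have hι : Isometry ι := by
    refine Isometry.of_dist_eq fun p q => ?_
    rw [dist_eq_norm, dist_eq_norm, hTn, EuclideanSpace.norm_eq, EuclideanSpace.norm_eq]
    congr 1
    simp [ι, Fin.sum_univ_succ]
  have hιB : ι '' (ι ⁻¹' B) = B := by
    refine Set.image_preimage_eq_of_subset fun x hx => ?_
    refine ⟨WithLp.toLp 2 (Fin.tail (T x)), ?_⟩
    have : (Fin.cons 1 (Fin.tail (T x)) : Fin (m + 1) → ℝ) = T x := by
      rw [← hB1 x hx, ← hT0]
      exact Fin.cons_self_tail _
    simp [ι, this]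
  have h5 : volume (slice (T.symm ⁻¹' B) 1) = c * μH[m] B := by
    rw [← hιB, hι.hausdorffMeasure_image (Or.inl (by positivity)), hιB]
    have h6 : ι ⁻¹' B = WithLp.ofLp ⁻¹' (slice (T.symm ⁻¹' B) 1) := rfl
    have h7 : c * μH[m] (ι ⁻¹' B) = (c • (μH[m] : Measure (En m))) (ι ⁻¹' B) := by
      rw [Measure.smul_apply, ENNReal.smul_def, smul_eq_mul]
    rw [h7, ← hcv, h6, (PiLp.volume_preserving_ofLp (Fin m)).measure_preimage]
    exact (hBm.preimage (continuous_fin_cons 1).measurable).nullMeasurableSet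
  rw [h5, ENNReal.ofReal_div_of_pos (by positivity), ENNReal.coe_div (by positivity)]
  rw [← mul_assoc, ← mul_assoc, ENNReal.div_eq_inv_mul, ENNReal.div_eq_inv_mul]
  congr 1
  have : ENNReal.ofReal ((m : ℝ) + 1) = (((m : ℝ≥0) + 1 : ℝ≥0) : ℝ≥0∞) := by
    rw [ENNReal.ofReal_eq_coe_nnreal (by positivity)]
    rfl
  rw [this]
  ring

section
variable {n : ℕ} {K : Set (En n)}

/-- The boundary points having an outer unit normal in `ω`. -/
def facet (K : Set (En n)) (ω : Set (Sph n)) : Set (En n) :=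
  {x ∈ frontier K | ∃ u ∈ ω, ∀ y ∈ K, ⟪y - x, (u : En n)⟫_ℝ ≤ 0}

/-- Radial projection to the hyperplane `⟪·, u⟫ = 1`. -/
def radial (u x : En n) : En n := (⟪x, u⟫_ℝ)⁻¹ • x

/-- `E` is nearly flat with normal `u` and height about `h`. -/
structure IsFlat (q h : ℝ) (u : En n) (E : Set (En n)) : Prop where
  lower : ∀ x ∈ E, h ≤ q * ⟪x, u⟫_ℝ
  upper : ∀ x ∈ E, ⟪x, u⟫_ℝ ≤ h
  radial_le : ∀ x ∈ E, ∀ y ∈ E, ‖radial u x - radial u y‖ ≤ q / h * ‖x - y‖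
  le_radial : ∀ x ∈ E, ∀ y ∈ E, ‖x - y‖ ≤ q * h * ‖radial u x - radial u y‖

theorem supp_le_add {R : ℝ} (hK : IsCompact K) (hne : K.Nonempty) (hR : ∀ x ∈ K, ‖x‖ ≤ R)
    (u v : En n) : supp K u ≤ supp K v + R * ‖u - v‖ := by
  refine supp_le hne fun x hx => ?_
  have h1 := le_supp hK hx v
  have h2 : ⟪x, u⟫_ℝ = ⟪x, v⟫_ℝ + ⟪x, u - v⟫_ℝ := by rw [inner_sub_right]; ring
  have h3 := real_inner_le_norm x (u - v)
  have h4 := mul_le_mul_of_nonneg_right (hR x hx) (norm_nonneg (u - v))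
  linarith

theorem exists_flat_radius {r R q : ℝ} (hK : IsCompact K) (hne : K.Nonempty)
    (hr : 0 < r) (hR : 0 < R)
    (hKr : ∀ u : Sph n, r ≤ supp K u) (hKR : ∀ x ∈ K, ‖x‖ ≤ R) (hq : 1 < q) :
    ∃ ε : ℝ, 0 < ε ∧ (∀ u : Sph n, IsFlat q (supp K u) u (facet K (closedBall u ε))) ∧
      ∀ u v : Sph n, dist v u ≤ ε → supp K v ≤ q * supp K u := by
  set η := min (1 / 2) ((q - 1) / (q + 1)) with hη
  have hη0 : 0 < η := lt_min (by norm_num) (div_pos (by linarith) (by linarith))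
  have hη1 : η ≤ 1 / 2 := min_le_left _ _
  have hη2 : 1 + η ≤ q * (1 - η) := by
    have : η ≤ (q - 1) / (q + 1) := min_le_right _ _
    rw [le_div_iff₀ (by linarith)] at this
    linarith
  have hRn : R * (η * r / (2 * R)) = η * r / 2 := by field_simp
  refine ⟨η * r / (2 * R), by positivity, ?_, ?_⟩
  · intro u
    set h := supp K u with hh
    have hrh : r ≤ h := hKr u
    have hh0 : 0 < h := hr.trans_le hrh
    set ε := η * r / (2 * R) with hε
    have hε0 : 0 < ε := by positivity
    have main : ∀ x ∈ facet K (closedBall u ε), x ∈ K ∧ ⟪x, (u : En n)⟫_ℝ ≤ h ∧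
        h * (1 - η) ≤ ⟪x, (u : En n)⟫_ℝ ∧
        ∀ y ∈ K, ⟪y - x, (u : En n)⟫_ℝ ≤ ε * ‖y - x‖ := by
      rintro x ⟨hx, v, hv, hvn⟩
      have hxK : x ∈ K := hK.isClosed.frontier_subset hx
      have hvu : ‖(v : En n) - u‖ ≤ ε := by rw [← dist_eq_norm]; exact hv
      refine ⟨hxK, le_supp hK hxK u, ?_, ?_⟩
      · have h1 := supp_eq hK hxK hvn
        have h2 := supp_le_add hK hne hKR u v
        have h3 : ⟪x, (v : En n)⟫_ℝ = ⟪x, (u : En n)⟫_ℝ + ⟪x, (v : En n) - u⟫_ℝ := by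
          rw [inner_sub_right]; ring
        have h4 := real_inner_le_norm x ((v : En n) - u)
        have h5 : ‖x‖ * ‖(v : En n) - u‖ ≤ R * ε :=
          mul_le_mul (hKR x hxK) hvu (norm_nonneg _) hR.le
        have h6 : R * ‖(u : En n) - v‖ ≤ R * ε := by
          rw [norm_sub_rev]
          exact mul_le_mul_of_nonneg_left hvu hR.le
        rw [hRn] at h5 h6
        nlinarith
      · intro y hy
        have h1 := hvn y hy
        have h3 : ⟪y - x, (u : En n)⟫_ℝ = ⟪y - x, (v : En n)⟫_ℝ + ⟪y - x, (u : En n) - v⟫_ℝ := by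
          rw [inner_sub_right]; ring
        have h4 := real_inner_le_norm (y - x) ((u : En n) - v)
        rw [norm_sub_rev (u : En n) v] at h4
        have h5 := mul_le_mul_of_nonneg_left hvu (norm_nonneg (y - x))
        linarith
    have hab : ∀ x ∈ facet K (closedBall u ε), ∀ y ∈ facet K (closedBall u ε),
        |⟪x, (u : En n)⟫_ℝ - ⟪y, (u : En n)⟫_ℝ| ≤ ε * ‖x - y‖ := by
      intro x hx y hy
      rw [← inner_sub_left, abs_le]
      constructor
      · have := (main x hx).2.2.2 y (main y hy).1
        rw [← neg_sub x y, inner_neg_left, norm_neg] at this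
        linarith
      · exact (main y hy).2.2.2 x (main x hx).1
    refine ⟨fun x hx => ?_, fun x hx => (main x hx).2.1, fun x hx y hy => ?_, fun x hx y hy => ?_⟩
    · have := (main x hx).2.2.1
      nlinarith
    all_goals
      have ha := (main x hx).2.2.1
      have hb := (main y hy).2.2.1
      have ha1 := (main x hx).2.1
      have hyR := hKR y (main y hy).1
      have habx := hab x hx y hy
      set a := ⟪x, (u : En n)⟫_ℝ with hadef
      set b := ⟪y, (u : En n)⟫_ℝ with hbdef
      have hpos : 0 < h * (1 - η) := mul_pos hh0 (by linarith)
      have ha0 : 0 < a := by linarith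
      have hb0 : 0 < b := by linarith
      have hnb : ‖(b⁻¹ * (a - b)) • y‖ ≤ η * ‖x - y‖ := by
        rw [norm_smul, norm_mul, Real.norm_eq_abs, Real.norm_eq_abs, abs_of_pos (inv_pos.2 hb0)]
        have h1 : |a - b| * ‖y‖ ≤ ε * ‖x - y‖ * R :=
          mul_le_mul habx hyR (norm_nonneg _) (by positivity)
        have h2 : ε * ‖x - y‖ * R = η * r / 2 * ‖x - y‖ := by rw [← hRn]; ring
        rw [mul_assoc, inv_mul_le_iff₀ hb0]
        have h3 : r / 2 ≤ b := by nlinarith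
        have h4 : η * r / 2 * ‖x - y‖ ≤ b * (η * ‖x - y‖) := by
          have := mul_le_mul_of_nonneg_right h3 (by positivity : 0 ≤ η * ‖x - y‖)
          linarith
        linarith
    · have e1 : radial u x - radial u y = a⁻¹ • ((x - y) - (b⁻¹ * (a - b)) • y) := by
        have e2 : a⁻¹ * (b⁻¹ * (a - b)) = b⁻¹ - a⁻¹ := by field_simp
        rw [radial, radial, ← hadef, ← hbdef, smul_sub, smul_sub, smul_smul, e2]
        module
      rw [e1, norm_smul, Real.norm_eq_abs, abs_of_pos (inv_pos.2 ha0)]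
      have h1 : ‖(x - y) - (b⁻¹ * (a - b)) • y‖ ≤ (1 + η) * ‖x - y‖ :=
        (norm_sub_le _ _).trans (by linarith)
      have h2 : a⁻¹ * (1 + η) ≤ q / h := by
        rw [inv_mul_eq_div, div_le_div_iff₀ ha0 hh0]
        nlinarith
      calc a⁻¹ * ‖(x - y) - (b⁻¹ * (a - b)) • y‖ ≤ a⁻¹ * ((1 + η) * ‖x - y‖) := by gcongr
        _ = a⁻¹ * (1 + η) * ‖x - y‖ := by ring
        _ ≤ q / h * ‖x - y‖ := by gcongr
    · have e1 : x - y = a • (radial u x - radial u y) + (b⁻¹ * (a - b)) • y := by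
        have e2 : b⁻¹ * (a - b) = a * b⁻¹ - 1 := by field_simp
        have e3 : a * a⁻¹ = 1 := mul_inv_cancel₀ ha0.ne'
        rw [radial, radial, ← hadef, ← hbdef, smul_sub, smul_smul, smul_smul, e2, e3]
        module
      have h1 : ‖x - y‖ ≤ a * ‖radial u x - radial u y‖ + η * ‖x - y‖ := by
        conv_lhs => rw [e1]
        refine (norm_add_le _ _).trans (add_le_add ?_ hnb)
        rw [norm_smul, Real.norm_eq_abs, abs_of_pos ha0]
      have h2 := mul_le_mul_of_nonneg_right ha1 (norm_nonneg (radial u x - radial u y))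
      have h3 : (1 - η) * ‖x - y‖ ≤ h * ‖radial u x - radial u y‖ := by linarith
      have h4 : 1 ≤ q * (1 - η) := by linarith
      calc ‖x - y‖ ≤ q * (1 - η) * ‖x - y‖ := le_mul_of_one_le_left (norm_nonneg _) h4
        _ = q * ((1 - η) * ‖x - y‖) := by ring
        _ ≤ q * (h * ‖radial u x - radial u y‖) := by gcongr
        _ = _ := by ring
  · intro u v huv
    have h2 := supp_le_add hK hne hKR v u
    have h6 : R * ‖(v : En n) - u‖ ≤ R * (η * r / (2 * R)) := by
      refine mul_le_mul_of_nonneg_left ?_ hR.le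
      rw [← dist_eq_norm]
      exact huv
    rw [hRn] at h6
    have := hKr u
    have h7 : 1 + η / 2 ≤ q := by nlinarith
    nlinarith

end

/-- The union of the segments joining the origin to points of `E`. -/
def coneHull {n : ℕ} (E : Set (En n)) : Set (En n) := Set.image2 (fun (s : ℝ) x => s • x) (Set.Icc 0 1) E

theorem isCompact_coneHull {n : ℕ} {E : Set (En n)} (hE : IsCompact E) : IsCompact (coneHull E) := by
  rw [coneHull, ← Set.image_prod]
  exact (isCompact_Icc.prod hE).image (by fun_prop)

theorem inner_radial {n : ℕ} {u x : En n} (h : ⟪x, u⟫_ℝ ≠ 0) : ⟪radial u x, u⟫_ℝ = 1 := by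
  rw [radial, inner_smul_left]
  simp [h]

/-- The cone constant relating volume to Hausdorff measure. -/
def coneConst (m : ℕ) : ℝ≥0 := (exists_cone_volume m).choose

theorem coneConst_pos (m : ℕ) : 0 < coneConst m := (exists_cone_volume m).choose_spec.1

theorem volume_sector {m : ℕ} {u : En (m + 1)} (hu : ‖u‖ = 1) {B : Set (En (m + 1))}
    (hB : MeasurableSet B) (hB1 : ∀ x ∈ B, ⟪x, u⟫_ℝ = 1) {a : ℝ} (ha : 0 ≤ a) :
    volume (sector u B ∩ {y | ⟪y, u⟫_ℝ ≤ a}) =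
      ENNReal.ofReal (a ^ (m + 1)) * (coneConst m * μH[m] B) :=
  (exists_cone_volume m).choose_spec.2 u hu B hB hB1 a ha

section
variable {m : ℕ} {q h : ℝ} {u : En (m + 1)} {E K : Set (En (m + 1))}

theorem IsFlat.exists_sector (hE : IsFlat q h u E) (hu : ‖u‖ = 1) (hq : 0 < q) (hh : 0 < h)
    (hK : ∀ x ∈ K, ⟪x, u⟫_ℝ ≤ h) :
    ∃ B, MeasurableSet B ∧ radial u '' E ⊆ B ∧
      volume (K ∩ sector u B) ≤ ENNReal.ofReal (q ^ m * h) * (coneConst m * μH[m] E) := by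
  refine ⟨toMeasurable μH[m] (radial u '' E) ∩ {x | ⟪x, u⟫_ℝ = 1}, ?_, ?_, ?_⟩
  · exact (measurableSet_toMeasurable _ _).inter
      (measurableSet_eq_fun (by fun_prop) measurable_const)
  · refine Set.subset_inter (subset_toMeasurable _ _) ?_
    rintro _ ⟨x, hx, rfl⟩
    refine inner_radial ?_
    have := hE.lower x hx
    intro h0
    rw [h0] at this
    linarith
  · have h1 : K ∩ sector u (toMeasurable μH[m] (radial u '' E) ∩ {x | ⟪x, u⟫_ℝ = 1}) ⊆
        sector u (toMeasurable μH[m] (radial u '' E) ∩ {x | ⟪x, u⟫_ℝ = 1}) ∩ {y | ⟪y, u⟫_ℝ ≤ h} :=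
      fun x hx => ⟨hx.2, hK x hx.1⟩
    refine (measure_mono h1).trans ?_
    rw [volume_sector hu ((measurableSet_toMeasurable _ _).inter
      (measurableSet_eq_fun (by fun_prop) measurable_const)) (fun x hx => hx.2) hh.le]
    have h2 : μH[m] (toMeasurable μH[m] (radial u '' E) ∩ {x | ⟪x, u⟫_ℝ = 1}) ≤
        ENNReal.ofReal ((q / h) ^ m) * μH[m] E := by
      refine (measure_mono Set.inter_subset_left).trans ?_
      rw [measure_toMeasurable]
      have hl : LipschitzOnWith (q / h).toNNReal (radial u) E := by
        refine LipschitzOnWith.of_dist_le_mul fun x hx y hy => ?_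
        rw [dist_eq_norm, dist_eq_norm, Real.coe_toNNReal _ (by positivity)]
        exact hE.radial_le x hx y hy
      have := hl.hausdorffMeasure_image_le (d := m) (by positivity)
      rwa [ENNReal.rpow_natCast, ← ENNReal.ofReal, ← ENNReal.ofReal_pow (by positivity)] at this
    calc _ ≤ ENNReal.ofReal (h ^ (m + 1)) * (coneConst m * (ENNReal.ofReal ((q / h) ^ m) * μH[m] E)) := by
          gcongr
      _ = ENNReal.ofReal (h ^ (m + 1)) * ENNReal.ofReal ((q / h) ^ m) * (coneConst m * μH[m] E) := by ring
      _ = _ := by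
          rw [← ENNReal.ofReal_mul (by positivity)]
          congr 2
          rw [div_pow]
          field_simp
          ring

theorem IsFlat.le_volume_coneHull (hE : IsFlat q h u E) (hEc : IsCompact E) (hu : ‖u‖ = 1) (hq : 0 < q)
    (hh : 0 < h) :
    ENNReal.ofReal h * (coneConst m * μH[m] E) ≤ ENNReal.ofReal (q ^ (2 * m + 1)) * volume (coneHull E) := by
  have hpos : ∀ x ∈ E, 0 < ⟪x, u⟫_ℝ := by
    intro x hx
    have := hE.lower x hx
    by_contra hcon
    push Not at hcon
    nlinarith
  set B := radial u '' E with hB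
  have hBc : IsCompact B := by
    refine hEc.image_of_continuousOn ?_
    refine ContinuousOn.smul (ContinuousOn.inv₀ (by fun_prop) fun x hx => (hpos x hx).ne') continuousOn_id
  have hB1 : ∀ x ∈ B, ⟪x, u⟫_ℝ = 1 := by
    rintro _ ⟨x, hx, rfl⟩
    exact inner_radial (hpos x hx).ne'
  have h1 : μH[m] E ≤ ENNReal.ofReal ((q * h) ^ m) * μH[m] B := by
    set G := Function.invFunOn (radial u) E with hG
    have hG1 : ∀ x ∈ E, G (radial u x) ∈ E ∧ radial u (G (radial u x)) = radial u x := by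
      intro x hx
      exact ⟨Function.invFunOn_mem ⟨x, hx, rfl⟩, Function.invFunOn_eq ⟨x, hx, rfl⟩⟩
    have hG2 : ∀ x ∈ E, G (radial u x) = x := by
      intro x hx
      have := hE.le_radial _ (hG1 x hx).1 x hx
      rw [(hG1 x hx).2, sub_self, norm_zero, mul_zero] at this
      exact sub_eq_zero.1 (norm_le_zero_iff.1 this)
    have hl : LipschitzOnWith (q * h).toNNReal G B := by
      refine LipschitzOnWith.of_dist_le_mul ?_
      rintro _ ⟨x, hx, rfl⟩ _ ⟨y, hy, rfl⟩
      rw [dist_eq_norm, dist_eq_norm, Real.coe_toNNReal _ (by positivity), hG2 x hx, hG2 y hy]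
      exact hE.le_radial x hx y hy
    have := hl.hausdorffMeasure_image_le (d := m) (by positivity)
    rw [ENNReal.rpow_natCast, ← ENNReal.ofReal, ← ENNReal.ofReal_pow (by positivity)] at this
    refine le_trans (measure_mono ?_) this
    intro x hx
    exact ⟨_, ⟨x, hx, rfl⟩, hG2 x hx⟩
  have h2 : sector u B ∩ {y | ⟪y, u⟫_ℝ ≤ h / q} ⊆ coneHull E := by
    rintro y ⟨⟨hy0, x, hx, hxy⟩, hyh⟩
    have hx0 := hpos x hx
    refine ⟨⟪y, u⟫_ℝ * (⟪x, u⟫_ℝ)⁻¹, ⟨by positivity, ?_⟩, x, hx, ?_⟩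
    · rw [← div_eq_mul_inv, div_le_one hx0]
      refine le_trans hyh ?_
      rw [div_le_iff₀ hq, mul_comm]
      exact hE.lower x hx
    · simp only
      rw [mul_smul]
      change ⟪y, u⟫_ℝ • radial u x = y
      rw [hxy, smul_inv_smul₀ hy0.ne']
  have h3 := measure_mono (μ := volume) h2
  rw [volume_sector hu hBc.measurableSet hB1 (by positivity)] at h3
  calc _ ≤ ENNReal.ofReal h * (coneConst m * (ENNReal.ofReal ((q * h) ^ m) * μH[m] B)) := by gcongr
    _ = ENNReal.ofReal (q ^ (2 * m + 1)) * (ENNReal.ofReal ((h / q) ^ (m + 1)) * (coneConst m * μH[m] B)) := by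
        have e1 : ENNReal.ofReal h * ENNReal.ofReal ((q * h) ^ m) =
            ENNReal.ofReal (q ^ (2 * m + 1)) * ENNReal.ofReal ((h / q) ^ (m + 1)) := by
          rw [← ENNReal.ofReal_mul hh.le, ← ENNReal.ofReal_mul (by positivity)]
          congr 1
          rw [div_pow, mul_pow, show q ^ (2 * m + 1) = q ^ (m + 1) * q ^ m by ring]
          field_simp
          ring
        calc _ = (ENNReal.ofReal h * ENNReal.ofReal ((q * h) ^ m)) * (coneConst m * μH[m] B) := by ring
          _ = _ := by rw [e1]; ring
    _ ≤ _ := by gcongr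

end

section
variable {n : ℕ} {K : Set (En n)}

theorem exists_pos_le_supp (hK : IsCompact K) (h0 : (0 : En n) ∈ interior K) :
    ∃ r : ℝ, 0 < r ∧ ∀ u : Sph n, r ≤ supp K u := by
  obtain ⟨ρ, hρ, hb⟩ := Metric.isOpen_iff.1 isOpen_interior 0 h0
  refine ⟨ρ / 2, by positivity, fun u => ?_⟩
  have hu : ‖(u : En n)‖ = 1 := by simp
  have hmem : (ρ / 2) • (u : En n) ∈ K := by
    refine interior_subset (hb ?_)
    rw [mem_ball_zero_iff, norm_smul, hu, Real.norm_of_nonneg (by positivity)]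
    linarith
  have := le_supp hK hmem u
  rwa [real_inner_smul_left, real_inner_self_eq_norm_sq, hu, one_pow, mul_one] at this

theorem facet_mono {ω ω' : Set (Sph n)} (h : ω ⊆ ω') : facet K ω ⊆ facet K ω' :=
  fun _ hx => ⟨hx.1, hx.2.imp fun _ hu => ⟨h hu.1, hu.2⟩⟩

theorem facet_union (ω ω' : Set (Sph n)) : facet K (ω ∪ ω') = facet K ω ∪ facet K ω' := by
  ext x
  constructor
  · rintro ⟨hx, u, hu | hu, h⟩
    · exact Or.inl ⟨hx, u, hu, h⟩
    · exact Or.inr ⟨hx, u, hu, h⟩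
  · rintro (h | h)
    · exact facet_mono Set.subset_union_left h
    · exact facet_mono Set.subset_union_right h

theorem isCompact_facet (hK : IsCompact K) {ω : Set (Sph n)} (hω : IsClosed ω) :
    IsCompact (facet K ω) := by
  have hf : IsCompact (frontier K) := hK.of_isClosed_subset isClosed_frontier hK.isClosed.frontier_subset
  have h1 : IsClosed {p : En n × Sph n | ∀ y ∈ K, ⟪y - p.1, (p.2 : En n)⟫_ℝ ≤ 0} := by
    simp only [Set.ofPred_forall]
    exact isClosed_iInter fun y => isClosed_iInter fun _ => isClosed_le (by fun_prop) continuous_const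
  have h2 : facet K ω = Prod.fst ''
      ((frontier K ×ˢ ω) ∩ {p : En n × Sph n | ∀ y ∈ K, ⟪y - p.1, (p.2 : En n)⟫_ℝ ≤ 0}) := by
    ext x
    constructor
    · rintro ⟨hx, u, hu, h⟩
      exact ⟨(x, u), ⟨⟨hx, hu⟩, h⟩, rfl⟩
    · rintro ⟨⟨x, u⟩, ⟨⟨hx, hu⟩, h⟩, rfl⟩
      exact ⟨hx, u, hu, h⟩
  rw [h2]
  exact ((hf.prod hω.isCompact).inter_right h1).image continuous_fst

theorem exists_normal (hK : IsFullBody K) {x : En n} (hx : x ∉ interior K) :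
    ∃ u : Sph n, ∀ y ∈ K, ⟪y - x, (u : En n)⟫_ℝ ≤ 0 := by
  obtain ⟨f, hf⟩ := geometric_hahn_banach_open_point hK.convex.interior isOpen_interior hx
  obtain ⟨w, hw⟩ : ∃ w : En n, ∀ y, f y = ⟪y, w⟫_ℝ :=
    ⟨(InnerProductSpace.toDual ℝ _).symm f, fun y => by
      rw [real_inner_comm, InnerProductSpace.toDual_symm_apply]⟩
  have hw0 : w ≠ 0 := by
    rintro rfl
    obtain ⟨a, ha⟩ := hK.interior_nonempty
    have := hf a ha
    rw [hw, hw, inner_zero_right, inner_zero_right] at this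
    exact lt_irrefl _ this
  have hle : ∀ y ∈ K, ⟪y, w⟫_ℝ ≤ ⟪x, w⟫_ℝ := by
    have hcl : IsClosed {y : En n | ⟪y, w⟫_ℝ ≤ ⟪x, w⟫_ℝ} := isClosed_le (by fun_prop) continuous_const
    have hsub : closure (interior K) ⊆ {y : En n | ⟪y, w⟫_ℝ ≤ ⟪x, w⟫_ℝ} := by
      refine hcl.closure_subset_iff.2 fun y hy => ?_
      have := hf y hy
      rw [hw, hw] at this
      exact this.le
    intro y hy
    refine hsub ?_
    rw [hK.convex.closure_interior_eq_closure_of_nonempty_interior hK.interior_nonempty]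
    exact subset_closure hy
  have hwn : 0 < ‖w‖ := norm_pos_iff.2 hw0
  refine ⟨⟨‖w‖⁻¹ • w, by simp [norm_smul, hwn.ne']⟩, fun y hy => ?_⟩
  simp only
  rw [inner_smul_right, inner_sub_left]
  have := hle y hy
  exact mul_nonpos_of_nonneg_of_nonpos (by positivity) (by linarith)

/-- A finite measurable partition of the sphere into small cells. -/
theorem exists_sphere_partition (n : ℕ) {ε : ℝ} (hε : 0 < ε) :
    ∃ (N : ℕ) (c : Fin N → Sph n) (ω : Fin N → Set (Sph n)), (∀ i, MeasurableSet (ω i)) ∧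
      Pairwise (Function.onFun Disjoint ω) ∧ (⋃ i, ω i) = Set.univ ∧ ∀ i, ω i ⊆ closedBall (c i) ε := by
  obtain ⟨t, -, ht, hcov⟩ := (isCompact_univ (X := Sph n)).finite_cover_balls hε
  obtain ⟨N, c, hc⟩ : ∃ (N : ℕ) (c : Fin N → Sph n), Set.range c = t := by
    obtain ⟨N, c, -, hc⟩ := ht.fin_param
    exact ⟨N, c, hc⟩
  refine ⟨N, c, fun i => disjointed (fun i => closedBall (c i) ε) i, fun i => ?_, disjoint_disjointed _, ?_,
    fun i => disjointed_le _ i⟩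
  · exact disjointedRec (fun _ _ h => h.diff isClosed_closedBall.measurableSet) isClosed_closedBall.measurableSet
  · rw [iUnion_disjointed]
    refine Set.eq_univ_of_univ_subset (hcov.trans ?_)
    rw [← hc, Set.biUnion_range]
    exact Set.iUnion_mono fun i => ball_subset_closedBall

end

theorem IsFlat.mono {n : ℕ} {q h : ℝ} {u : En n} {E E' : Set (En n)} (hE : IsFlat q h u E) (h' : E' ⊆ E) :
    IsFlat q h u E' :=
  ⟨fun x hx => hE.lower x (h' hx), fun x hx => hE.upper x (h' hx),
    fun x hx y hy => hE.radial_le x (h' hx) y (h' hy), fun x hx y hy => hE.le_radial x (h' hx) y (h' hy)⟩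

/-- `S` is the surface area measure of the full-dimensional body `K`. -/
def IsFacetMeasure {m : ℕ} (K : Set (En (m + 1))) (S : Measure (Sph (m + 1))) : Prop :=
  ∀ ω : Set (Sph (m + 1)), MeasurableSet ω → S ω = μH[m] (facet K ω)

section
variable {m : ℕ} {K : Set (En (m + 1))} {S : Measure (Sph (m + 1))}

theorem coneHull_subset {E : Set (En (m + 1))} (hK : Convex ℝ K) (h0 : (0 : En (m + 1)) ∈ K) (hE : E ⊆ K) :
    coneHull E ⊆ K := by
  rintro _ ⟨s, ⟨hs0, hs1⟩, x, hx, rfl⟩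
  exact hK.smul_mem_of_zero_mem h0 (hE hx) ⟨hs0, hs1⟩

theorem IsFacetMeasure.isFiniteMeasure (hS : IsFacetMeasure K S) (hK : IsFullBody K)
    (h0 : (0 : En (m + 1)) ∈ interior K) : IsFiniteMeasure S := by
  obtain ⟨r, hr, hKr⟩ := exists_pos_le_supp hK.isCompact h0
  obtain ⟨R, hR, hKR⟩ := hK.isCompact.isBounded.exists_pos_norm_le
  obtain ⟨ε, hε, hflat, -⟩ := exists_flat_radius hK.isCompact hK.nonempty hr hR hKr hKR one_lt_two
  have : IsLocallyFiniteMeasure S := by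
    refine ⟨fun u => ⟨closedBall u ε, closedBall_mem_nhds _ hε, ?_⟩⟩
    rw [hS _ isClosed_closedBall.measurableSet]
    have hu : ‖(u : En (m + 1))‖ = 1 := by simp
    have h1 := (hflat u).le_volume_coneHull (isCompact_facet hK.isCompact isClosed_closedBall) hu two_pos
      (hr.trans_le (hKr u))
    have h2 : ENNReal.ofReal (2 ^ (2 * m + 1)) * volume (coneHull (facet K (closedBall u ε))) < ∞ :=
      ENNReal.mul_lt_top ENNReal.ofReal_lt_top
        (isCompact_coneHull (isCompact_facet hK.isCompact isClosed_closedBall)).measure_lt_top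
    have h3 := h1.trans_lt h2
    by_contra hcon
    rw [not_lt, top_le_iff] at hcon
    rw [hcon, ENNReal.mul_top (by simpa using (coneConst_pos m).ne'), ENNReal.mul_top] at h3
    · exact lt_irrefl _ h3
    · simpa using hr.trans_le (hKr u)
  infer_instance

theorem volume_coneHull_inter (hK : IsFullBody K) (h0 : (0 : En (m + 1)) ∈ interior K)
    (hS : IsFacetMeasure K S) {C C' : Set (Sph (m + 1))} (hC : IsCompact C) (hC' : IsCompact C')
    (hd : Disjoint C C') {q : ℝ} (hq : 0 < q) {u : Sph (m + 1)} (hf : IsFlat q (supp K u) u (facet K C)) :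
    volume (coneHull (facet K C) ∩ coneHull (facet K C')) = 0 := by
  have := hS.isFiniteMeasure hK h0
  obtain ⟨r, hr, hKr⟩ := exists_pos_le_supp hK.isCompact h0
  have hu : ‖(u : En (m + 1))‖ = 1 := by simp
  have hh : 0 < supp K u := hr.trans_le (hKr u)
  have hnull : μH[m] (facet K C ∩ facet K C') = 0 := by
    have h1 := measure_union hd hC'.measurableSet (μ := S)
    have h2 := measure_union_add_inter (μ := (μH[m] : Measure (En (m + 1)))) (facet K C)
      (isCompact_facet hK.isCompact hC'.isClosed).measurableSet
    rw [hS _ hC.measurableSet, hS _ hC'.measurableSet, hS _ (hC.measurableSet.union hC'.measurableSet),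
      facet_union] at h1
    rw [h1] at h2
    have hfin : μH[m] (facet K C) + μH[m] (facet K C') ≠ ∞ := by
      rw [← hS _ hC.measurableSet, ← hS _ hC'.measurableSet]
      exact ENNReal.add_ne_top.2 ⟨measure_ne_top _ _, measure_ne_top _ _⟩
    exact (ENNReal.add_right_inj hfin).1 (by rw [h2, add_zero])
  obtain ⟨B, -, hB, hvol⟩ := (hf.mono (Set.inter_subset_left (t := facet K C'))).exists_sector hu hq hh
    (fun x hx => le_supp hK.isCompact hx u)
  rw [hnull, mul_zero, mul_zero, nonpos_iff_eq_zero] at hvol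
  refine measure_mono_null ?_ (measure_union_null (measure_singleton (0 : En (m + 1))) hvol)
  have key : ∀ x ∈ facet K Set.univ, ∀ s : ℝ, 0 < s → s • x ∈ K → s ≤ 1 := by
    rintro x ⟨hx, v, -, hv⟩ s hs hsx
    have hxK : x ∈ K := hK.isCompact.isClosed.frontier_subset hx
    have h1 := hv _ hsx
    have h2 := hKr v
    rw [supp_eq hK.isCompact hxK hv] at h2
    rw [inner_sub_left, real_inner_smul_left] at h1
    nlinarith
  rintro y ⟨⟨s, ⟨hs0, hs1⟩, x, hx, rfl⟩, ⟨s', ⟨hs0', hs1'⟩, x', hx', hxx⟩⟩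
  simp only at hxx ⊢
  have hxK : x ∈ K := hK.isCompact.isClosed.frontier_subset hx.1
  have hxK' : x' ∈ K := hK.isCompact.isClosed.frontier_subset hx'.1
  rcases hs0.eq_or_lt with rfl | hs0
  · left; simp
  have hx0 : 0 < ⟪x, (u : En (m + 1))⟫_ℝ := by
    have := hf.lower x hx
    by_contra hcon
    push Not at hcon
    nlinarith
  have hs0' : 0 < s' := by
    rcases hs0'.eq_or_lt with rfl | h
    · rw [zero_smul, eq_comm, smul_eq_zero] at hxx
      rcases hxx with h | h
      · exact absurd h hs0.ne'
      · rw [h, inner_zero_left] at hx0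
        exact absurd hx0 (lt_irrefl _)
    · exact h
  right
  have e1 : (s' / s) • x' = x := by
    rw [div_eq_inv_mul, mul_smul, hxx, inv_smul_smul₀ hs0.ne']
  have e2 : (s / s') • x = x' := by
    rw [div_eq_inv_mul, mul_smul, ← hxx, inv_smul_smul₀ hs0'.ne']
  have i1 := key x' (facet_mono (Set.subset_univ _) hx') (s' / s) (by positivity) (by rwa [e1])
  have i2 := key x (facet_mono (Set.subset_univ _) hx) (s / s') (by positivity) (by rwa [e2])
  rw [div_le_one hs0] at i1
  rw [div_le_one hs0'] at i2
  obtain rfl := le_antisymm i1 i2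
  have hx'' : x' = x := by rw [← e1, div_self hs0.ne', one_smul]
  subst hx''
  refine ⟨hK.convex.smul_mem_of_zero_mem (interior_subset h0) hxK ⟨hs0.le, hs1⟩, ?_, ?_⟩
  · rw [real_inner_smul_left]; positivity
  · refine hB ⟨x', ⟨hx, hx'⟩, ?_⟩
    rw [radial, real_inner_smul_left, smul_smul]
    congr 1
    field_simp

end

theorem continuous_supp {n : ℕ} {K : Set (En n)} (hK : IsCompact K) (hne : K.Nonempty) :
    Continuous (supp K) := by
  obtain ⟨R, hR, hKR⟩ := hK.isBounded.exists_pos_norm_le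
  refine (LipschitzWith.of_dist_le_mul (K := R.toNNReal) fun u v => ?_).continuous
  rw [Real.coe_toNNReal _ hR.le, Real.dist_eq, dist_eq_norm, abs_sub_le_iff]
  have h1 := supp_le_add hK hne hKR u v
  have h2 := supp_le_add hK hne hKR v u
  rw [norm_sub_rev] at h2
  constructor <;> linarith

theorem integrable_sphere {n : ℕ} {S : Measure (Sph n)} [IsFiniteMeasure S] {f : Sph n → ℝ}
    (hf : Continuous f) : Integrable f S :=
  hf.integrable_of_hasCompactSupport (HasCompactSupport.of_compactSpace f)

theorem integrable_supp {n : ℕ} {K : Set (En n)} (hK : IsCompact K) (hne : K.Nonempty)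
    (S : Measure (Sph n)) [IsFiniteMeasure S] : Integrable (fun u : Sph n => supp K u) S :=
  integrable_sphere ((continuous_supp hK hne).comp continuous_subtype_val)

section
variable {m : ℕ} {K L : Set (En (m + 1))} {S : Measure (Sph (m + 1))}

theorem IsFacetMeasure.mul_real_le (hS : IsFacetMeasure K S) {C : Set (Sph (m + 1))} (hK : IsFullBody K)
    (hC : IsCompact C) {q : ℝ} (hq : 0 < q) {u : Sph (m + 1)} (hh : 0 < supp K u)
    (hf : IsFlat q (supp K u) u (facet K C)) :
    supp K u * (coneConst m * S.real C) ≤ q ^ (2 * m + 1) * volume.real (coneHull (facet K C)) := by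
  have hE := isCompact_facet hK.isCompact hC.isClosed
  have hu : ‖(u : En (m + 1))‖ = 1 := by simp
  have h1 := hf.le_volume_coneHull hE hu hq hh
  rw [← hS _ hC.measurableSet] at h1
  have h2 := ENNReal.toReal_mono (ENNReal.mul_ne_top ENNReal.ofReal_ne_top
    (isCompact_coneHull hE).measure_lt_top.ne) h1
  rw [ENNReal.toReal_mul, ENNReal.toReal_mul, ENNReal.toReal_mul, ENNReal.toReal_ofReal hh.le,
    ENNReal.toReal_ofReal (by positivity)] at h2
  exact h2

theorem coneConst_mul_integral_supp_le_mul (hK : IsFullBody K) (h0 : (0 : En (m + 1)) ∈ interior K)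
    (hS : IsFacetMeasure K S) {q : ℝ} (hq : 1 < q) :
    coneConst m * ∫ u, supp K u ∂S ≤ q ^ (2 * m + 2) * volume.real K := by
  have := hS.isFiniteMeasure hK h0
  obtain ⟨r, hr, hKr⟩ := exists_pos_le_supp hK.isCompact h0
  obtain ⟨R, hR, hKR⟩ := hK.isCompact.isBounded.exists_pos_norm_le
  obtain ⟨ε, hε, hflat, hqs⟩ := exists_flat_radius hK.isCompact hK.nonempty hr hR hKr hKR hq
  obtain ⟨N, c, ω, hω, hd, hU, hsub⟩ := exists_sphere_partition (m + 1) hε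
  have hq0 : 0 < q := by linarith
  have hintg := integrable_supp hK.isCompact hK.nonempty S
  have hpos : ∀ i, 0 < supp K (c i) := fun i => hr.trans_le (hKr _)
  have hI : ∫ u, supp K u ∂S ≤ ∑ i, q * supp K (c i) * S.real (ω i) := by
    rw [← setIntegral_univ, ← hU, integral_iUnion_fintype hω hd fun i => hintg.integrableOn]
    refine Finset.sum_le_sum fun i _ => ?_
    calc _ ≤ ∫ u in ω i, q * supp K (c i) ∂S :=
          setIntegral_mono_on hintg.integrableOn (integrable_const _) (hω i)
            fun v hv => hqs _ _ (hsub i hv)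
      _ = _ := by simp [mul_comm]
  refine le_of_forall_pos_le_add fun e he => ?_
  set A := q * coneConst m * ∑ i, supp K (c i) with hA
  have hA0 : 0 ≤ A := by
    have : 0 ≤ ∑ i, supp K (c i) := Finset.sum_nonneg fun i _ => (hpos i).le
    positivity
  set δ := e / (A + 1) with hδ
  have hδ0 : 0 < δ := by positivity
  have hex : ∀ i, ∃ C ⊆ ω i, IsCompact C ∧ S.real (ω i) ≤ S.real C + δ := by
    intro i
    obtain ⟨C, h1, h2, h3⟩ := (hω i).exists_isCompact_lt_add (measure_ne_top S _)
      (ε := ENNReal.ofReal δ) (by simpa using hδ0)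
    refine ⟨C, h1, h2, ?_⟩
    have := ENNReal.toReal_mono (by finiteness) h3.le
    rwa [ENNReal.toReal_add (by finiteness) (by finiteness), ENNReal.toReal_ofReal hδ0.le] at this
  choose C hCω hC hCS using hex
  have hflatC : ∀ i, IsFlat q (supp K (c i)) (c i) (facet K (C i)) := fun i =>
    (hflat (c i)).mono (facet_mono ((hCω i).trans (hsub i)))
  have hcompact : ∀ i, IsCompact (coneHull (facet K (C i))) := fun i =>
    isCompact_coneHull (isCompact_facet hK.isCompact (hC i).isClosed)
  have hvol : ∑ i, volume.real (coneHull (facet K (C i))) ≤ volume.real K := by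
    have h1 : volume (⋃ i, coneHull (facet K (C i))) = ∑ i, volume (coneHull (facet K (C i))) := by
      rw [measure_iUnion₀, tsum_fintype]
      · intro i j hij
        exact volume_coneHull_inter hK h0 hS (hC i) (hC j)
          ((hd hij).mono (hCω i) (hCω j)) hq0 (hflatC i)
      · exact fun i => (hcompact i).measurableSet.nullMeasurableSet
    have h2 : (⋃ i, coneHull (facet K (C i))) ⊆ K := Set.iUnion_subset fun i =>
      coneHull_subset hK.convex (interior_subset h0) fun x hx => hK.isCompact.isClosed.frontier_subset hx.1
    have h3 := measureReal_mono (μ := volume) h2 hK.isCompact.measure_lt_top.ne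
    rw [measureReal_def, h1, ENNReal.toReal_sum fun i _ => (hcompact i).measure_lt_top.ne] at h3
    exact h3
  have hAδ : A * δ ≤ e := by
    rw [hδ, mul_div_assoc', div_le_iff₀ (by positivity)]
    nlinarith
  have hterm : ∀ i, coneConst m * (q * supp K (c i) * S.real (ω i)) ≤
      q ^ (2 * m + 2) * volume.real (coneHull (facet K (C i))) + q * coneConst m * supp K (c i) * δ := by
    intro i
    have h1 := hS.mul_real_le hK (hC i) hq0 (hpos i) (hflatC i)
    have h2 := mul_le_mul_of_nonneg_left (hCS i)
      (mul_nonneg (coneConst m).2 (mul_nonneg hq0.le (hpos i).le))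
    have h3 := mul_le_mul_of_nonneg_left h1 hq0.le
    rw [show q ^ (2 * m + 2) = q * q ^ (2 * m + 1) by ring]
    simp only [NNReal.val_eq_coe] at h2
    linarith
  calc _ ≤ coneConst m * ∑ i, q * supp K (c i) * S.real (ω i) := by gcongr
    _ = ∑ i, coneConst m * (q * supp K (c i) * S.real (ω i)) := Finset.mul_sum _ _ _
    _ ≤ ∑ i, (q ^ (2 * m + 2) * volume.real (coneHull (facet K (C i))) + q * coneConst m * supp K (c i) * δ) :=
        Finset.sum_le_sum fun i _ => hterm i
    _ = q ^ (2 * m + 2) * ∑ i, volume.real (coneHull (facet K (C i))) + A * δ := by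
        rw [Finset.sum_add_distrib, ← Finset.mul_sum, ← Finset.sum_mul, ← Finset.mul_sum]
    _ ≤ _ := by gcongr

/-- The cone-volume lower bound. -/
theorem coneConst_mul_integral_supp_le (hK : IsFullBody K) (h0 : (0 : En (m + 1)) ∈ interior K)
    (hS : IsFacetMeasure K S) : coneConst m * ∫ u, supp K u ∂S ≤ volume.real K := by
  have h1 : Tendsto (fun q : ℝ => q ^ (2 * m + 2) * volume.real K) (𝓝[>] 1) (𝓝 (1 ^ (2 * m + 2) * volume.real K)) :=
    Tendsto.mono_left (Continuous.tendsto (by fun_prop) 1) nhdsWithin_le_nhds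
  rw [one_pow, one_mul] at h1
  exact ge_of_tendsto h1 (eventually_mem_nhdsWithin.mono fun q hq =>
    coneConst_mul_integral_supp_le_mul hK h0 hS hq)

theorem exists_exit (hK : IsFullBody K) (h0 : (0 : En (m + 1)) ∈ interior K) {y : En (m + 1)} (hy : y ∉ K) :
    ∃ x ∈ frontier K, ∃ l : ℝ, 1 ≤ l ∧ y = l • x := by
  have hcl : IsClosed K := hK.isCompact.isClosed
  set T := Set.Icc (0 : ℝ) 1 ∩ (fun s : ℝ => s • y) ⁻¹' K with hT
  have hTc : IsCompact T := isCompact_Icc.inter_right (hcl.preimage (by fun_prop))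
  have hTn : T.Nonempty := ⟨0, by simp, by simpa using interior_subset h0⟩
  obtain ⟨s, hs⟩ := hTc.exists_isGreatest hTn
  have hs1 : s < 1 := by
    refine lt_of_le_of_ne hs.1.1.2 ?_
    rintro rfl
    have := hs.1.2
    simp at this
    exact hy this
  have hfr : s • y ∉ interior K := by
    intro hintg
    have hc : Tendsto (fun s : ℝ => s • y) (𝓝[>] s) (𝓝 (s • y)) :=
      Tendsto.mono_left (Continuous.tendsto (by fun_prop) s) nhdsWithin_le_nhds
    have h1 := hc.eventually (isOpen_interior.mem_nhds hintg)
    have h2 : ∀ᶠ s' in 𝓝[>] s, s' < 1 := 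
      nhdsWithin_le_nhds (Iio_mem_nhds hs1)
    obtain ⟨s', ⟨h3, h4⟩, h5⟩ := ((h1.and h2).and eventually_mem_nhdsWithin).exists
    have h6 : s' • y ∈ K := (interior_subset : interior K ⊆ K) h3
    have := hs.2 ⟨⟨hs.1.1.1.trans (le_of_lt h5), h4.le⟩, h6⟩
    exact absurd h5 (not_lt.2 this)
  have hs0 : 0 < s := by
    refine lt_of_le_of_ne hs.1.1.1 ?_
    rintro rfl
    simp only [zero_smul] at hfr
    exact hfr h0
  refine ⟨s • y, ⟨subset_closure hs.1.2, hfr⟩, s⁻¹, (one_le_inv₀ hs0).2 hs1.le, ?_⟩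
  rw [inv_smul_smul₀ hs0.ne']

open scoped Pointwise in
theorem volume_smul_diff {Q : Set (En (m + 1))} (hQ : MeasurableSet Q) (hfin : volume Q ≠ ∞) {c : ℝ} (hc : 1 ≤ c)
    (hsub : Q ⊆ c • Q) : volume.real (c • Q \ Q) = (c ^ (m + 1) - 1) * volume.real Q := by
  have h1 : volume.real (c • Q) = c ^ (m + 1) * volume.real Q := by
    rw [measureReal_def, Measure.addHaar_smul, ENNReal.toReal_mul, ENNReal.toReal_ofReal (abs_nonneg _),
      abs_of_nonneg (by positivity), finrank_euclideanSpace_fin, measureReal_def]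
  have h2 : volume (c • Q) ≠ ∞ := by
    rw [Measure.addHaar_smul]
    exact ENNReal.mul_ne_top ENNReal.ofReal_ne_top hfin
  rw [measureReal_sdiff hsub hQ h2, h1]
  ring

open scoped Pointwise in
/-- Sectors over a fine partition of the sphere control the volume growth of `K + t L`. -/
theorem exists_volume_add_le (hK : IsFullBody K) (h0 : (0 : En (m + 1)) ∈ interior K)
    (hS : IsFacetMeasure K S) (hL : IsCompact L) (hL0 : (0 : En (m + 1)) ∈ L) {e : ℝ} (he : 0 < e) :
    ∃ (N : ℕ) (η V : Fin N → ℝ), (∀ i, 0 ≤ η i) ∧ (∀ i, 0 ≤ V i) ∧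
      (∀ t, 0 ≤ t → volume.real (Set.image2 (fun x y => x + t • y) K L) ≤
        volume.real K + ∑ i, ((1 + t * η i) ^ (m + 1) - 1) * V i) ∧
      ∑ i, η i * V i ≤ coneConst m * ∫ u, supp L u ∂S + e := by
  have := hS.isFiniteMeasure hK h0
  obtain ⟨r, hr, hKr⟩ := exists_pos_le_supp hK.isCompact h0
  obtain ⟨R, hR, hKR⟩ := hK.isCompact.isBounded.exists_pos_norm_le
  obtain ⟨R', hR', hLR⟩ := hL.isBounded.exists_pos_norm_le
  have hLne : L.Nonempty := ⟨0, hL0⟩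
  have hL0' : ∀ u, 0 ≤ supp L u := fun u => by simpa using le_supp hL hL0 u
  set I := ∫ u, supp L u ∂S with hI
  set κ : ℝ := ((coneConst m : ℝ≥0) : ℝ) with hκ
  have hκ0 : 0 < κ := NNReal.coe_pos.2 (coneConst_pos m)
  have hI0 : 0 ≤ I := integral_nonneg fun u => hL0' u
  set M := S.real Set.univ with hM
  have hM0 : 0 ≤ M := measureReal_nonneg
  set δ := e / (4 * (κ * M + 1)) with hδ
  have hδ0 : 0 < δ := by positivity
  have hδe : κ * (2 * δ * M) < e := by
    have h1 : δ * (4 * (κ * M + 1)) = e := by rw [hδ]; field_simp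
    have h2 : 0 ≤ κ * M := by positivity
    nlinarith
  obtain ⟨q, hq, hqe⟩ : ∃ q : ℝ, 1 < q ∧ q ^ (m + 1) * (κ * (I + 2 * δ * M)) < κ * I + e := by
    have h1 : Tendsto (fun q : ℝ => q ^ (m + 1) * (κ * (I + 2 * δ * M))) (𝓝[>] 1)
        (𝓝 (1 ^ (m + 1) * (κ * (I + 2 * δ * M)))) :=
      Tendsto.mono_left (Continuous.tendsto (by fun_prop) 1) nhdsWithin_le_nhds
    have h2 := (h1.eventually_lt_const (u := κ * I + e) (by rw [one_pow]; linarith)).and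
      eventually_mem_nhdsWithin
    obtain ⟨q, h3, h4⟩ := h2.exists
    exact ⟨q, h4, h3⟩
  have hq0 : 0 < q := by linarith
  obtain ⟨ε', hε', hflat, hqs⟩ := exists_flat_radius hK.isCompact hK.nonempty hr hR hKr hKR hq
  set ε := min ε' (δ / R') with hεdef
  have hε : 0 < ε := lt_min hε' (by positivity)
  have hεL : R' * ε ≤ δ := by
    have : ε ≤ δ / R' := min_le_right _ _
    rw [le_div_iff₀ hR'] at this
    linarith
  obtain ⟨N, c, ω, hω, hd, hU, hsub⟩ := exists_sphere_partition (m + 1) hε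
  have hpos : ∀ i, 0 < supp K (c i) := fun i => hr.trans_le (hKr _)
  have hunit : ∀ i, ‖(c i : En (m + 1))‖ = 1 := fun i => by simp
  have hflatω : ∀ i, IsFlat q (supp K (c i)) (c i) (facet K (ω i)) := fun i =>
    (hflat (c i)).mono (facet_mono ((hsub i).trans (closedBall_subset_closedBall (min_le_left _ _))))
  have hdist : ∀ i, ∀ v ∈ ω i, |supp L v - supp L (c i)| ≤ δ := by
    intro i v hv
    have hv' : ‖(v : En (m + 1)) - c i‖ ≤ ε := by rw [← dist_eq_norm]; exact hsub i hv
    have h1 := supp_le_add hL hLne hLR v (c i)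
    have h2 := supp_le_add hL hLne hLR (c i) v
    rw [norm_sub_rev] at h2
    have h3 := mul_le_mul_of_nonneg_left hv' hR'.le
    rw [abs_sub_le_iff]
    constructor <;> linarith
  have hexB := fun i => (hflatω i).exists_sector (hunit i) hq0 (hpos i)
    (fun x hx => le_supp hK.isCompact hx (c i))
  choose B hBm hBsub hBvol using hexB
  set Q : Fin N → Set (En (m + 1)) := fun i => K ∩ sector (c i) (B i) with hQ
  set η : Fin N → ℝ := fun i => q * (supp L (c i) + δ) / supp K (c i) with hη
  have hη0 : ∀ i, 0 ≤ η i := fun i =>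
    div_nonneg (mul_nonneg hq0.le (add_nonneg (hL0' _) hδ0.le)) (hpos i).le
  have hQm : ∀ i, MeasurableSet (Q i) := fun i =>
    hK.isCompact.measurableSet.inter (measurableSet_sector _ (hBm i))
  have hQfin : ∀ i, volume (Q i) ≠ ∞ := fun i =>
    ((measure_mono Set.inter_subset_left).trans_lt hK.isCompact.measure_lt_top).ne
  refine ⟨N, η, fun i => volume.real (Q i), hη0, fun i => measureReal_nonneg, ?_, ?_⟩
  · intro t ht
    have hc1 : ∀ i, 1 ≤ 1 + t * η i := fun i => by
      have := mul_nonneg ht (hη0 i)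
      linarith
    have hQsub : ∀ i (c' : ℝ), 1 ≤ c' → ∀ x ∈ K, ∀ l : ℝ, 0 < l → l ≤ c' → 0 < ⟪x, (c i : En (m + 1))⟫_ℝ →
        radial (c i) x ∈ B i → l • x ∈ c' • Q i := by
      intro i c' hc' x hx l hl hlc hx0 hxB
      have hc0 : 0 < c' := by linarith
      rw [Set.mem_smul_set_iff_inv_smul_mem₀ hc0.ne', smul_smul]
      refine ⟨hK.convex.smul_mem_of_zero_mem (interior_subset h0) hx
        ⟨by positivity, by rw [inv_mul_le_iff₀ hc0]; linarith⟩, ?_, ?_⟩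
      · rw [real_inner_smul_left]; positivity
      · rw [real_inner_smul_left, smul_smul]
        convert hxB using 1
        rw [radial]
        congr 1
        field_simp
    have hstar : ∀ i, Q i ⊆ (1 + t * η i) • Q i := by
      intro i x hx
      simpa using hQsub i _ (hc1 i) x hx.1 1 one_pos (hc1 i) hx.2.1 hx.2.2
    have hcover : Set.image2 (fun x y => x + t • y) K L ⊆
        K ∪ ⋃ i, ((1 + t * η i) • Q i \ Q i) := by
      rintro _ ⟨a, ha, b, hb, rfl⟩
      by_cases hy : a + t • b ∈ K
      · exact Or.inl hy
      right
      obtain ⟨x, hx, l, hl, hxy⟩ := exists_exit hK h0 hy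
      have hxK : x ∈ K := hK.isCompact.isClosed.frontier_subset hx
      obtain ⟨v, hv⟩ := exists_normal hK hx.2
      obtain ⟨i, hi⟩ := Set.mem_iUnion.1 (hU ▸ Set.mem_univ v)
      have hxf : x ∈ facet K (ω i) := ⟨hx, v, hi, hv⟩
      have hxi : 0 < ⟪x, (c i : En (m + 1))⟫_ℝ := by
        have := (hflatω i).lower x hxf
        have := hpos i
        by_contra hcon
        push Not at hcon
        nlinarith
      have hle : l ≤ 1 + t * η i := by
        have h1 := supp_eq hK.isCompact hxK hv
        have h2 : ⟪a + t • b, (v : En (m + 1))⟫_ℝ ≤ supp K v + t * supp L v := by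
          rw [inner_add_left, real_inner_smul_left]
          exact add_le_add (le_supp hK.isCompact ha v) (mul_le_mul_of_nonneg_left (le_supp hL hb v) ht)
        rw [hxy, real_inner_smul_left, ← h1] at h2
        have h3 : supp K (c i) ≤ q * supp K v := hqs v (c i) (by
          rw [dist_comm]
          exact (hsub i hi).trans (min_le_left _ _))
        have h4 := (abs_le.1 (hdist i v hi)).2
        have h5 : supp L v ≤ η i * supp K v := by
          rw [hη]
          simp only
          rw [div_mul_eq_mul_div, le_div_iff₀ (hpos i)]
          have h6 : 0 ≤ supp L (c i) + δ := add_nonneg (hL0' _) hδ0.le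
          calc supp L v * supp K (c i) ≤ (supp L (c i) + δ) * supp K (c i) :=
                mul_le_mul_of_nonneg_right (by linarith) (hpos i).le
            _ ≤ (supp L (c i) + δ) * (q * supp K v) := mul_le_mul_of_nonneg_left h3 h6
            _ = _ := by ring
        have hv0 : 0 < supp K v := hr.trans_le (hKr v)
        have h7 := mul_le_mul_of_nonneg_left h5 ht
        refine le_of_mul_le_mul_right ?_ hv0
        linarith
      refine Set.mem_iUnion.2 ⟨i, ?_, fun h => hy h.1⟩
      simp only
      rw [hxy]
      exact hQsub i _ (hc1 i) x hxK l (by linarith) hle hxi (hBsub i ⟨x, hxf, rfl⟩)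
    have hfin : ∀ i, volume ((1 + t * η i) • Q i \ Q i) ≠ ∞ := fun i =>
      ((measure_mono Set.sdiff_subset).trans_lt (by
        rw [Measure.addHaar_smul]
        exact ENNReal.mul_lt_top ENNReal.ofReal_lt_top (hQfin i).lt_top)).ne
    have hfinU : volume (⋃ i, ((1 + t * η i) • Q i \ Q i)) ≠ ∞ :=
      ((measure_iUnion_fintype_le _ _).trans_lt (ENNReal.sum_lt_top.2 fun i _ => (hfin i).lt_top)).ne
    calc _ ≤ volume.real (K ∪ ⋃ i, ((1 + t * η i) • Q i \ Q i)) :=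
          measureReal_mono hcover (measure_union_lt_top hK.isCompact.measure_lt_top hfinU.lt_top).ne
      _ ≤ volume.real K + volume.real (⋃ i, ((1 + t * η i) • Q i \ Q i)) := measureReal_union_le _ _
      _ ≤ volume.real K + ∑ i, volume.real ((1 + t * η i) • Q i \ Q i) := by
          gcongr
          exact measureReal_iUnion_fintype_le _
      _ = _ := by
          congr 1
          exact Finset.sum_congr rfl fun i _ => volume_smul_diff (hQm i) (hQfin i) (hc1 i) (hstar i)
  · have hV : ∀ i, volume.real (Q i) ≤ q ^ m * supp K (c i) * (κ * S.real (ω i)) := by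
      intro i
      have h1 := hBvol i
      rw [← hS _ (hω i)] at h1
      have h2 := ENNReal.toReal_mono (by finiteness) h1
      rwa [ENNReal.toReal_mul, ENNReal.toReal_mul, ENNReal.toReal_ofReal
        (mul_nonneg (by positivity) (hpos i).le)] at h2
    have hterm : ∀ i, η i * volume.real (Q i) ≤ q ^ (m + 1) * (κ * ((supp L (c i) + δ) * S.real (ω i))) := by
      intro i
      refine (mul_le_mul_of_nonneg_left (hV i) (hη0 i)).trans (le_of_eq ?_)
      have := (hpos i).ne'
      rw [hη]
      field_simp
      ring
    have hintg := integrable_supp hL hLne S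
    have hcell : ∀ i, (supp L (c i) + δ) * S.real (ω i) ≤ ∫ u in ω i, (supp L u + 2 * δ) ∂S := by
      intro i
      calc _ = ∫ u in ω i, (supp L (c i) + δ) ∂S := by simp [mul_comm]
        _ ≤ _ := by
            refine setIntegral_mono_on (integrable_const _) (hintg.add (integrable_const _)).integrableOn
              (hω i) fun v hv => ?_
            have := (abs_le.1 (hdist i v hv)).1
            linarith
    have hintg2 : Integrable (fun u : Sph (m + 1) => supp L u + 2 * δ) S := hintg.add (integrable_const _)
    have htot : ∑ i, ∫ u in ω i, (supp L u + 2 * δ) ∂S = I + 2 * δ * M := by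
      rw [← integral_iUnion_fintype hω hd fun i => hintg2.integrableOn, hU,
        setIntegral_univ, integral_add hintg (integrable_const _)]
      simp [hI, hM, mul_comm]
    calc _ ≤ ∑ i, q ^ (m + 1) * (κ * ∫ u in ω i, (supp L u + 2 * δ) ∂S) :=
          Finset.sum_le_sum fun i _ => (hterm i).trans (by gcongr; exact hcell i)
      _ = q ^ (m + 1) * (κ * (I + 2 * δ * M)) := by
          rw [← Finset.mul_sum, ← Finset.mul_sum, htot]
      _ ≤ _ := hqe.le
end

/-- The Brunn–Minkowski inequality in Euclidean space. -/
theorem brunnMinkowski_euclidean {n : ℕ} {A B : Set (En n)} (hA : IsFullBody A) (hB : IsFullBody B) {t : ℝ}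
    (ht0 : 0 < t) (ht1 : t < 1) :
    volume.real A ^ (1 - t) * volume.real B ^ t ≤ volume.real (minkowskiMix t A B) := by
  set T := PiLp.continuousLinearEquiv 2 ℝ (fun _ : Fin n => ℝ) with hT
  have hTe : MeasurableEmbedding T := T.toHomeomorph.measurableEmbedding
  have hvol : ∀ S : Set (En n), volume.real (T '' S) = volume.real S := by
    intro S
    have h : MeasurePreserving T := PiLp.volume_preserving_ofLp (Fin n)
    rw [measureReal_def, measureReal_def, ← h.measure_preimage_emb hTe,
      Set.preimage_image_eq _ T.injective]
  have h1 := brunnMinkowski n (T '' A) (T '' B) t (hA.image_equiv T) (hB.image_equiv T) ht0 ht1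
  have h2 := image_minkowskiMix (T.toLinearEquiv.toLinearMap) t A B
  change T '' _ = minkowskiMix t (T '' A) (T '' B) at h2
  rwa [← h2, hvol, hvol, hvol] at h1

theorem HasDerivAt.nonneg_of_forall_nonneg {f : ℝ → ℝ} {d b : ℝ} (hf : HasDerivAt f d 0) (h0 : f 0 = 0)
    (hb : 0 < b) (h : ∀ t, 0 < t → t < b → 0 ≤ f t) : 0 ≤ d := by
  have h1 := (hasDerivAt_iff_tendsto_slope.1 hf).mono_left
    (nhdsWithin_mono 0 (fun x (hx : 0 < x) => ne_of_gt hx) : 𝓝[>] (0 : ℝ) ≤ 𝓝[≠] 0)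
  refine ge_of_tendsto h1 ?_
  filter_upwards [Ioo_mem_nhdsGT hb] with t ht
  rw [slope_def_field, h0, sub_zero, sub_zero]
  exact div_nonneg (h t ht.1 ht.2) ht.1.le

theorem two_mul_log_le {N k : ℕ} {η V : Fin N → ℝ} {a b : ℝ} (ha : 0 < a) (hb : 0 < b)
    (h : ∀ t : ℝ, 0 < t → t < 1 / 2 → a ^ (1 - 2 * t) * b ^ (2 * t) ≤
      (1 - t) ^ k * a + ∑ i, ((1 - t + t * η i) ^ k - (1 - t) ^ k) * V i) :
    2 * log (b / a) * a ≤ k * (∑ i, η i * V i - a) := by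
  have hlin : HasDerivAt (fun t : ℝ => 1 - t) (-1) 0 := by
    simpa using (hasDerivAt_id (0 : ℝ)).const_sub 1
  have h1 : HasDerivAt (fun t : ℝ => (1 - t) ^ k) (-k) 0 := by
    simpa using hlin.fun_pow k
  have h2 : ∀ i, HasDerivAt (fun t : ℝ => (1 - t + t * η i) ^ k) (k * (η i - 1)) 0 := by
    intro i
    have h3 : HasDerivAt (fun t : ℝ => t * η i) (η i) 0 := by
      simpa using (hasDerivAt_id (0 : ℝ)).mul_const (η i)
    have h4 : HasDerivAt (fun t : ℝ => 1 - t + t * η i) (-1 + η i) 0 := hlin.add h3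
    have h5 := h4.fun_pow k
    simp only [sub_zero, zero_mul, add_zero, one_pow, mul_one] at h5
    rwa [show η i - 1 = -1 + η i by ring]
  have h3 : HasDerivAt (fun t : ℝ => exp ((1 - 2 * t) * log a + 2 * t * log b))
      (a * (2 * (log b - log a))) 0 := by
    have h4 : HasDerivAt (fun t : ℝ => (1 - 2 * t) * log a + 2 * t * log b) (2 * (log b - log a)) 0 := by
      have h5 := ((hasDerivAt_id (0 : ℝ)).mul_const (2 * (log b - log a))).add_const (log a)
      rw [one_mul] at h5
      refine h5.congr_of_eventuallyEq (Eventually.of_forall fun t => ?_)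
      simp only [id]
      ring
    have := h4.exp
    simpa [exp_log ha] using this
  have hsum : HasDerivAt (fun t : ℝ => ∑ i, ((1 - t + t * η i) ^ k - (1 - t) ^ k) * V i)
      (∑ i, (k * (η i - 1) - -k) * V i) 0 :=
    HasDerivAt.fun_sum fun i _ => ((h2 i).sub h1).mul_const (V i)
  have hφ := ((h1.mul_const a).add hsum).sub h3
  have := hφ.nonneg_of_forall_nonneg (b := 1 / 2) ?_ (by norm_num) ?_
  · have e : ∑ i, (k * (η i - 1) - -k) * V i = k * ∑ i, η i * V i := by
      rw [Finset.mul_sum]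
      exact Finset.sum_congr rfl fun i _ => by ring
    rw [e] at this
    rw [log_div hb.ne' ha.ne']
    linarith
  · simp [exp_log ha]
  · intro t ht0 ht1
    have := h t ht0 ht1
    rw [rpow_def_of_pos ha, rpow_def_of_pos hb, ← exp_add] at this
    simp only [Pi.add_apply, Pi.sub_apply]
    rw [show (1 - 2 * t) * log a + 2 * t * log b = log a * (1 - 2 * t) + log b * (2 * t) by ring]
    linarith

section
variable {m : ℕ} {K L : Set (En (m + 1))} {S : Measure (Sph (m + 1))}

theorem minkowskiMix_mix_subset (hK : Convex ℝ K) {t : ℝ} (ht0 : 0 ≤ t) (ht1 : t < 1 / 2) :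
    minkowskiMix (2 * t) K (minkowskiMix (1 / 2) K L) ⊆ minkowskiMix t K L := by
  rintro _ ⟨x, hx, _, ⟨y, hy, z, hz, rfl⟩, rfl⟩
  have h1 : (0 : ℝ) < 1 - t := by linarith
  refine ⟨((1 - 2 * t) / (1 - t)) • x + (t / (1 - t)) • y, hK hx hy ?_ ?_ ?_, z, hz, ?_⟩
  · exact div_nonneg (by linarith) h1.le
  · positivity
  · field_simp; ring
  · simp only
    rw [smul_add, smul_smul, smul_smul, mul_div_cancel₀ _ h1.ne', mul_div_cancel₀ _ h1.ne']
    module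

open scoped Pointwise in
theorem minkowskiMix_eq_smul {t : ℝ} (ht1 : t < 1) :
    minkowskiMix t K L = (1 - t) • Set.image2 (fun x y => x + (t / (1 - t)) • y) K L := by
  have h1 : (0 : ℝ) < 1 - t := by linarith
  rw [minkowskiMix, ← Set.image_smul, Set.image_image2]
  congr 1
  ext x y : 2
  rw [smul_add, smul_smul, mul_div_cancel₀ _ h1.ne']

/-- A logarithmic first Minkowski inequality. -/
theorem two_mul_log_volume_mix_le (hK : IsFullBody K) (h0 : (0 : En (m + 1)) ∈ interior K)
    (hS : IsFacetMeasure K S) (hL : IsFullBody L) (hL0 : (0 : En (m + 1)) ∈ L) :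
    2 * log (volume.real (minkowskiMix (1 / 2) K L) / volume.real K) * volume.real K ≤
      (m + 1) * (coneConst m * ∫ u, supp L u ∂S - volume.real K) := by
  have hM : IsFullBody (minkowskiMix (1 / 2) K L) := hK.minkowskiMix hL (by norm_num)
  have hV : 0 < volume.real K := hK.volume_pos
  refine le_of_forall_pos_le_add fun e he => ?_
  obtain ⟨N, η, V, hη, hVi, hvol, hsum⟩ := exists_volume_add_le hK h0 hS hL.isCompact hL0
    (e := e / (m + 1)) (by positivity)
  have := two_mul_log_le (k := m + 1) (η := η) (V := V) hV (hM.volume_pos (μ := volume)) ?_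
  · push_cast at this
    have h2 := mul_le_mul_of_nonneg_left hsum (by positivity : (0 : ℝ) ≤ m + 1)
    rw [mul_add, mul_div_cancel₀ _ (by positivity)] at h2
    linarith
  · intro t ht0 ht1
    have h1t : 0 < 1 - t := by linarith
    have h1 := brunnMinkowski_euclidean hK hM (t := 2 * t) (by linarith) (by linarith)
    have h2 : volume.real (minkowskiMix (2 * t) K (minkowskiMix (1 / 2) K L)) ≤
        volume.real (minkowskiMix t K L) :=
      measureReal_mono (μ := volume) (minkowskiMix_mix_subset hK.convex ht0.le ht1)
        (hK.isCompact.minkowskiMix hL.isCompact t).measure_lt_top.ne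
    have h3 := hvol (t / (1 - t)) (by positivity)
    have h4 : volume.real (minkowskiMix t K L) = (1 - t) ^ (m + 1) *
        volume.real (Set.image2 (fun x y => x + (t / (1 - t)) • y) K L) := by
      rw [minkowskiMix_eq_smul (by linarith), measureReal_def, Measure.addHaar_smul, ENNReal.toReal_mul,
        ENNReal.toReal_ofReal (abs_nonneg _), abs_of_nonneg (by positivity), finrank_euclideanSpace_fin,
        measureReal_def]
    have h5 := mul_le_mul_of_nonneg_left h3 (by positivity : 0 ≤ (1 - t) ^ (m + 1))
    refine h1.trans (h2.trans (h4.le.trans (h5.trans (le_of_eq ?_))))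
    rw [mul_add, Finset.mul_sum]
    congr 1
    refine Finset.sum_congr rfl fun i _ => ?_
    rw [← mul_assoc, mul_sub, ← mul_pow, mul_one]
    congr 3
    field_simp

end

section translate
variable {n : ℕ} {K : Set (En n)}

theorem IsFullBody.translate (hK : IsFullBody K) (x : En n) : IsFullBody ((fun y => y + x) '' K) where
  convex := by
    simpa [add_comm] using hK.convex.translate x
  isCompact := hK.isCompact.image (by fun_prop)
  interior_nonempty := by
    have h := (Homeomorph.addRight x).image_interior K
    simp only [Homeomorph.coe_addRight] at h
    exact h ▸ hK.interior_nonempty.image _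

theorem supp_translate (hK : IsCompact K) (hne : K.Nonempty) (x u : En n) :
    supp ((fun y => y + x) '' K) u = supp K u + ⟪x, u⟫_ℝ := by
  obtain ⟨y, hy, h⟩ := exists_eq_supp hK hne u
  apply le_antisymm
  · refine supp_le (hne.image _) ?_
    rintro _ ⟨z, hz, rfl⟩
    simp only [inner_add_left]
    linarith [le_supp hK hz u]
  · rw [← h, ← inner_add_left]
    exact le_supp (hK.image (continuous_id.add continuous_const)) ⟨y, hy, rfl⟩ u

theorem facet_translate (x : En n) (ω : Set (Sph n)) :
    facet ((fun y => y + x) '' K) ω = (fun y => y + x) '' facet K ω := by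
  have h := (Homeomorph.addRight x).image_frontier K
  simp only [Homeomorph.coe_addRight] at h
  ext z
  simp only [facet, ← h, Set.mem_ofPred_eq, Set.mem_image]
  constructor
  · rintro ⟨⟨y, hy, rfl⟩, u, hu, hyu⟩
    exact ⟨y, ⟨hy, u, hu, fun w hw => by simpa using hyu _ ⟨w, hw, rfl⟩⟩, rfl⟩
  · rintro ⟨y, ⟨hy, u, hu, hyu⟩, rfl⟩
    refine ⟨⟨y, hy, rfl⟩, u, hu, ?_⟩
    rintro _ ⟨w, hw, rfl⟩
    simpa using hyu w hw

theorem zero_mem_interior_translate {x : En n} (hx : x ∈ interior K) :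
    0 ∈ interior ((fun y => y + -x) '' K) := by
  have h := (Homeomorph.addRight (-x)).image_interior K
  simp only [Homeomorph.coe_addRight] at h
  exact h ▸ ⟨x, hx, by simp⟩

end translate

section
variable {m : ℕ} {K L : Set (En (m + 1))} {S : Measure (Sph (m + 1))}

theorem IsFacetMeasure.translate (hS : IsFacetMeasure K S) (x : En (m + 1)) :
    IsFacetMeasure ((fun y => y + x) '' K) S := fun ω hω => by
  rw [facet_translate, hS ω hω]
  simp

theorem IsFacetMeasure.finite (hS : IsFacetMeasure K S) (hK : IsFullBody K) : IsFiniteMeasure S := by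
  obtain ⟨z, hz⟩ := hK.interior_nonempty
  exact (hS.translate (-z)).isFiniteMeasure (hK.translate _) (zero_mem_interior_translate hz)

theorem volume_real_translate {n : ℕ} (K : Set (En n)) (x : En n) :
    volume.real ((fun y => y + x) '' K) = volume.real K := by
  simp [measureReal_def]

theorem integral_sub_const_le {n : ℕ} {S : Measure (Sph n)} [IsFiniteMeasure S] {f g : Sph n → ℝ}
    (hf : Continuous f) (hg : Continuous g) (h : ∀ u, f u ≤ g u) : ∫ u, f u ∂S ≤ ∫ u, g u ∂S :=
  integral_mono (integrable_sphere hf) (integrable_sphere hg) h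

/-- An isoperimetric inequality. -/
theorem volume_le_of_mass_le (hm : 1 ≤ m) (hK : IsFullBody K) (hS : IsFacetMeasure K S) {τ : ℝ}
    (hτ : S.real Set.univ ≤ τ) :
    volume.real K ≤ volume.real (ball (0 : En (m + 1)) 1) *
      (1 + coneConst m * τ / volume.real (ball (0 : En (m + 1)) 1)) ^ (m + 1) := by
  obtain ⟨z, hz⟩ := hK.interior_nonempty
  rw [← volume_real_translate K (-z)]
  have h0 := zero_mem_interior_translate hz
  have hK' := hK.translate (-z)
  have hS' := hS.translate (-z)
  have := hS.finite hK
  clear hS hK hz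
  revert hS' hK' h0
  generalize (fun y => y + -z) '' K = K'
  intro h0 hK hS
  set ω := volume.real (ball (0 : En (m + 1)) 1) with hω
  set κ : ℝ := ((coneConst m : ℝ≥0) : ℝ) with hκ
  have hω0 : 0 < ω := ENNReal.toReal_pos (measure_ball_pos _ _ one_pos).ne' measure_ball_lt_top.ne
  have hκ0 : 0 < κ := coneConst_pos m
  have hτ0 : 0 ≤ τ := measureReal_nonneg.trans hτ
  have hV : 0 < volume.real K' := hK.volume_pos (μ := volume)
  set V := volume.real K' with hVd
  set ρ := (V / ω) ^ ((m + 1 : ℝ)⁻¹) with hρ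
  have hρ0 : 0 < ρ := by positivity
  have hρV : ω * ρ ^ (m + 1) = V := by
    rw [hρ]
    have := rpow_inv_natCast_pow (x := V / ω) (by positivity) (n := m + 1) (by omega)
    push_cast at this
    rw [this]
    field_simp
  have hL : IsFullBody (closedBall (0 : En (m + 1)) ρ) :=
    ⟨convex_closedBall _ _, isCompact_closedBall _ _,
      ⟨0, ball_subset_interior_closedBall (mem_ball_self hρ0)⟩⟩
  have hLV : volume.real (closedBall (0 : En (m + 1)) ρ) = V := by
    rw [Measure.addHaar_real_closedBall _ _ hρ0.le, finrank_euclideanSpace_fin, ← hρV, mul_comm]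
  have h1 := two_mul_log_volume_mix_le hK h0 hS hL (mem_closedBall_self hρ0.le)
  have h2 := brunnMinkowski_euclidean hK hL (t := 1 / 2) (by norm_num) (by norm_num)
  rw [hLV, ← hVd, ← rpow_add hV] at h2
  norm_num at h2
  have h3 : 0 ≤ log (volume.real (minkowskiMix (1 / 2) K' (closedBall 0 ρ)) / V) := by
    apply log_nonneg
    rw [le_div_iff₀ hV]
    simpa using h2
  have h4 : ∫ u, supp (closedBall 0 ρ) (u : En (m + 1)) ∂S ≤ ρ * τ := by
    refine (integral_sub_const_le (g := fun _ => ρ)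
      ((continuous_supp hL.isCompact hL.nonempty).comp continuous_subtype_val) continuous_const ?_).trans ?_
    · intro u
      refine supp_le hL.nonempty fun x hx => (real_inner_le_norm _ _).trans ?_
      rw [mem_sphere_zero_iff_norm.1 u.2, mul_one]
      exact mem_closedBall_zero_iff.1 hx
    · rw [integral_const, smul_eq_mul, mul_comm]
      gcongr
  have h5 : V ≤ κ * (ρ * τ) := by
    have : 0 ≤ (m + 1 : ℝ) * (κ * ∫ u, supp (closedBall 0 ρ) (u : En (m + 1)) ∂S - V) :=
      le_trans (by positivity) h1
    have := nonneg_of_mul_nonneg_right this (by positivity)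
    have := mul_le_mul_of_nonneg_left h4 hκ0.le
    linarith
  have h6 : ρ ≤ 1 + κ * τ / ω := by
    rcases le_total ρ 1 with h | h
    · have : 0 ≤ κ * τ / ω := by positivity
      linarith
    · have h7 : ω * ρ ≤ κ * τ := by
        have : ω * ρ * ρ ≤ κ * τ * ρ := by
          calc ω * ρ * ρ = ω * ρ ^ 2 := by ring
            _ ≤ ω * ρ ^ (m + 1) := by gcongr; omega
            _ ≤ κ * τ * ρ := by rw [hρV]; linarith
        exact le_of_mul_le_mul_right this hρ0
      have : ρ ≤ κ * τ / ω := by rw [le_div_iff₀ hω0]; linarith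
      linarith
  calc V = ω * ρ ^ (m + 1) := hρV.symm
    _ ≤ _ := by gcongr

theorem mul_norm_sub_le_volume (hK : IsFullBody K) (hS : IsFacetMeasure K S) {l : ℝ}
    (hl : ∀ v : En (m + 1), l * ‖v‖ ^ 2 ≤ ∫ u, ⟪v, (u : En (m + 1))⟫_ℝ ^ 2 ∂S) {x y : En (m + 1)}
    (hx : x ∈ K) (hy : y ∈ K) : coneConst m * l / 2 * ‖x - y‖ ≤ volume.real K := by
  have := hS.finite hK
  set κ : ℝ := ((coneConst m : ℝ≥0) : ℝ) with hκ
  have hκ0 : 0 < κ := coneConst_pos m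
  rcases (norm_nonneg (x - y)).eq_or_lt with hD | hD
  · rw [← hD]
    simp
  set D := ‖x - y‖ with hDd
  set τ := S.real Set.univ
  have hτ : 0 ≤ τ := measureReal_nonneg
  refine le_of_forall_pos_le_add fun e he => ?_
  have hmid : midpoint ℝ x y ∈ closure (interior K) := by
    rw [hK.convex.closure_interior_eq_closure_of_nonempty_interior hK.interior_nonempty]
    exact subset_closure (hK.convex.midpoint_mem hx hy)
  obtain ⟨z, hz, hzd⟩ := Metric.mem_closure_iff.1 hmid (e / (κ * τ + 1)) (by positivity)
  have h1 := coneConst_mul_integral_supp_le (hK.translate (-z)) (zero_mem_interior_translate hz)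
    (hS.translate (-z))
  rw [volume_real_translate] at h1
  have hK' := hK.translate (-z)
  have h2 : ∫ u, ((2 * D)⁻¹ * ⟪x - y, (u : En (m + 1))⟫_ℝ ^ 2 - e / (κ * τ + 1)) ∂S ≤
      ∫ u, supp ((fun w => w + -z) '' K) u ∂S := by
    refine integral_sub_const_le (by fun_prop)
      ((continuous_supp hK'.isCompact hK'.nonempty).comp continuous_subtype_val) fun u => ?_
    have hu : ‖(u : En (m + 1))‖ = 1 := mem_sphere_zero_iff_norm.1 u.2
    rw [supp_translate hK.isCompact hK.nonempty]
    have hx' := le_supp hK.isCompact hx (u : En (m + 1))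
    have hy' := le_supp hK.isCompact hy (u : En (m + 1))
    have hmz : ⟪z - midpoint ℝ x y, (u : En (m + 1))⟫_ℝ ≤ e / (κ * τ + 1) := by
      refine (real_inner_le_norm _ _).trans ?_
      rw [hu, mul_one, ← dist_eq_norm, dist_comm]
      exact hzd.le
    have hme : ⟪z - midpoint ℝ x y, (u : En (m + 1))⟫_ℝ = ⟪z, (u : En (m + 1))⟫_ℝ -
        (⟪x, (u : En (m + 1))⟫_ℝ + ⟪y, (u : En (m + 1))⟫_ℝ) / 2 := by
      rw [inner_sub_left, midpoint_eq_smul_add, inner_smul_left, inner_add_left]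
      simp
      ring
    have habs : |⟪x - y, (u : En (m + 1))⟫_ℝ| ≤ D := by
      simpa [hu] using abs_real_inner_le_norm (x - y) (u : En (m + 1))
    have hsq : (2 * D)⁻¹ * ⟪x - y, (u : En (m + 1))⟫_ℝ ^ 2 ≤ |⟪x - y, (u : En (m + 1))⟫_ℝ| / 2 := by
      rw [inv_mul_le_iff₀ (by positivity), ← sq_abs]
      nlinarith [abs_nonneg ⟪x - y, (u : En (m + 1))⟫_ℝ]
    rw [inner_neg_left]
    rw [inner_sub_left] at hsq ⊢
    rcases abs_cases (⟪x, (u : En (m + 1))⟫_ℝ - ⟪y, (u : En (m + 1))⟫_ℝ) with ⟨h, -⟩ | ⟨h, -⟩ <;>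
      rw [h] at hsq <;> linarith
  rw [integral_sub (integrable_sphere (by fun_prop)) (integrable_const _), integral_const_mul, integral_const,
    smul_eq_mul] at h2
  have h3 := mul_le_mul_of_nonneg_left (hl (x - y)) (by positivity : 0 ≤ (2 * D)⁻¹)
  have h4 : (2 * D)⁻¹ * (l * ‖x - y‖ ^ 2) = l / 2 * D := by
    rw [← hDd]; field_simp
  have h5 : κ * (τ * (e / (κ * τ + 1))) ≤ e := by
    rw [← mul_assoc, mul_div_assoc', div_le_iff₀ (by positivity)]
    nlinarith
  have h6 := mul_le_mul_of_nonneg_left h2 hκ0.le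
  have h7 := mul_le_mul_of_nonneg_left h3 hκ0.le
  rw [h4] at h7
  linarith

theorem min_le_volume (hm : 1 ≤ m) (hK : IsFullBody K) (hS : IsFacetMeasure K S) {l : ℝ} (hl0 : 0 < l)
    (hl : ∀ v : En (m + 1), l * ‖v‖ ^ 2 ≤ ∫ u, ⟪v, (u : En (m + 1))⟫_ℝ ^ 2 ∂S) :
    min 1 ((coneConst m * l / 2) ^ (m + 1) / volume.real (ball (0 : En (m + 1)) 1)) ≤ volume.real K := by
  set ω := volume.real (ball (0 : En (m + 1)) 1) with hω
  have hω0 : 0 < ω := ENNReal.toReal_pos (measure_ball_pos _ _ one_pos).ne' measure_ball_lt_top.ne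
  have ha : 0 < coneConst m * l / 2 := by
    have : (0 : ℝ) < coneConst m := coneConst_pos m
    positivity
  set a := coneConst m * l / 2 with had
  have hV : 0 < volume.real K := hK.volume_pos (μ := volume)
  obtain ⟨x, hx⟩ := hK.nonempty
  have hsub : K ⊆ closedBall x (volume.real K / a) := fun y hy => by
    rw [mem_closedBall, dist_eq_norm, le_div_iff₀ ha, mul_comm]
    exact mul_norm_sub_le_volume hK hS hl hy hx
  have h1 := measureReal_mono (μ := volume) hsub (isCompact_closedBall _ _).measure_lt_top.ne
  rw [Measure.addHaar_real_closedBall _ _ (by positivity), finrank_euclideanSpace_fin, ← hω] at h1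
  rcases le_total 1 (volume.real K) with h | h
  · exact min_le_of_left_le h
  · refine min_le_of_right_le ?_
    rw [div_le_iff₀ hω0]
    rw [div_pow, div_mul_eq_mul_div, le_div_iff₀ (by positivity)] at h1
    have h2 : volume.real K ^ (m + 1) ≤ volume.real K ^ 2 := pow_le_pow_of_le_one hV.le h (by omega)
    have h3 : a ^ (m + 1) * volume.real K ≤ volume.real K * ω * volume.real K := by
      nlinarith
    exact le_of_mul_le_mul_right h3 hV

open scoped Pointwise in
/-- The surface area measure is not concentrated on a great subsphere. -/
theorem integral_inner_sq_pos (hK : IsFullBody K) (hS : IsFacetMeasure K S) {v : En (m + 1)} (hv : v ≠ 0) :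
    0 < ∫ u, ⟪v, (u : En (m + 1))⟫_ℝ ^ 2 ∂S := by
  obtain ⟨z, hz⟩ := hK.interior_nonempty
  have h0 := zero_mem_interior_translate hz
  have hK' := hK.translate (-z)
  have hS' := hS.translate (-z)
  have := hS.finite hK
  clear hS hK hz
  revert hS' hK' h0
  generalize (fun y => y + -z) '' K = K
  intro h0 hK hS
  refine (integral_nonneg fun u => sq_nonneg _).lt_of_ne fun hzero => ?_
  have hae : ∀ᵐ u : Sph (m + 1) ∂S, ⟪v, (u : En (m + 1))⟫_ℝ = 0 := by
    have hintg : Integrable (fun u : Sph (m + 1) => ⟪v, (u : En (m + 1))⟫_ℝ ^ 2) S :=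
      integrable_sphere (by fun_prop)
    have h := (integral_eq_zero_iff_of_nonneg (fun u => sq_nonneg _) hintg).1 hzero.symm
    filter_upwards [h] with u hu
    exact pow_eq_zero_iff two_ne_zero |>.1 hu
  obtain ⟨R, hR0, hR⟩ : ∃ R > 0, ∀ x ∈ K, ‖x‖ ≤ R := hK.isCompact.isBounded.exists_pos_norm_le
  have hv' : 0 < ‖v‖ := norm_pos_iff.2 hv
  set w : En (m + 1) := (6 * R / ‖v‖) • v with hw
  have hwn : ‖w‖ = 6 * R := by
    rw [hw, norm_smul, norm_of_nonneg (by positivity)]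
    field_simp
  have h0K := interior_subset h0
  have hsub : K ⊆ K + segment ℝ 0 w := fun x hx => ⟨x, hx, 0, left_mem_segment _ _ _, add_zero x⟩
  have hL : IsFullBody (K + segment ℝ 0 w) :=
    ⟨hK.convex.add (convex_segment _ _), hK.isCompact.add (by
      rw [← convexHull_pair (𝕜 := ℝ)]; exact (Set.toFinite _).isCompact_convexHull ℝ),
      hK.interior_nonempty.mono (interior_mono hsub)⟩
  have h1 := two_mul_log_volume_mix_le hK h0 hS hL (hsub h0K)
  have h2 := coneConst_mul_integral_supp_le hK h0 hS
  have h3 : ∫ u, supp (K + segment ℝ 0 w) u ∂S ≤ ∫ u, supp K u ∂S := by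
    refine integral_mono_ae (integrable_supp hL.isCompact hL.nonempty S)
      (integrable_supp hK.isCompact hK.nonempty S) ?_
    filter_upwards [hae] with u hu
    refine supp_le hL.nonempty ?_
    rintro _ ⟨x, hx, y, hy, rfl⟩
    rw [segment_eq_image] at hy
    obtain ⟨t, -, rfl⟩ := hy
    simp only [hw, smul_zero, zero_add, inner_add_left, inner_smul_left, hu, mul_zero, add_zero]
    exact le_supp hK.isCompact hx u
  have hV : 0 < volume.real K := hK.volume_pos (μ := volume)
  have hM := hK.minkowskiMix hL (t := 1 / 2) (by norm_num)
  have h4 : volume.real K + volume.real K ≤ volume.real (minkowskiMix (1 / 2) K (K + segment ℝ 0 w)) := by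
    conv_lhs => rw [← volume_real_translate K ((1 / 2 : ℝ) • w), add_comm]
    rw [volume_real_translate]
    nth_rw 2 [← volume_real_translate K ((1 / 2 : ℝ) • w)]
    rw [← measureReal_union ?_ ((hK.translate _).isCompact.measurableSet) hK.isCompact.measure_lt_top.ne
      (hK.translate _).isCompact.measure_lt_top.ne]
    · refine measureReal_mono (μ := volume) ?_ hM.isCompact.measure_lt_top.ne
      rintro x (hx | ⟨x, hx, rfl⟩)
      · exact ⟨x, hx, x, hsub hx, by module⟩
      · exact ⟨x, hx, x + w, ⟨x, hx, w, right_mem_segment _ _ _, rfl⟩, by module⟩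
    · rw [Set.disjoint_left]
      rintro _ hx ⟨y, hy, rfl⟩
      have := norm_sub_norm_le ((1 / 2 : ℝ) • w) (-y)
      rw [sub_neg_eq_add, add_comm ((1 / 2 : ℝ) • w), norm_neg, norm_smul, hwn] at this
      norm_num at this
      have h5 := hR _ hx
      have h6 := hR _ hy
      norm_num at h5
      linarith
  have h5 : 0 < log (volume.real (minkowskiMix (1 / 2) K (K + segment ℝ 0 w)) / volume.real K) := by
    apply log_pos
    rw [one_lt_div hV]
    linarith
  have h6 := mul_le_mul_of_nonneg_left h3 (coneConst m).2
  have h7 : 0 < 2 * log (volume.real (minkowskiMix (1 / 2) K (K + segment ℝ 0 w)) / volume.real K) * volume.real K := by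
    positivity
  have h8 := h7.trans_le h1
  have h9 := (mul_pos_iff_of_pos_left (by positivity)).1 h8
  have h10 : ((coneConst m : ℝ≥0) : ℝ) * ∫ u, supp (K + segment ℝ 0 w) u ∂S ≤
    coneConst m * ∫ u, supp K u ∂S := h6
  linarith

theorem integral_inner_sq {n : ℕ} {S : Measure (Sph n)} [IsFiniteMeasure S] (v : En n) :
    ∫ u, ⟪v, (u : En n)⟫_ℝ ^ 2 ∂S = ∑ i, ∑ j, v i * v j * ∫ u, (u : En n) i * (u : En n) j ∂S := by
  have hintg (i j : Fin n) : Integrable (fun u : Sph n => v i * v j * ((u : En n) i * (u : En n) j)) S :=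
    integrable_sphere (by fun_prop)
  simp_rw [← integral_const_mul]
  have h (i : Fin n) := (integral_finsetSum (μ := S) Finset.univ fun j _ => hintg i j).symm
  simp_rw [h]
  rw [← integral_finsetSum _ fun i _ => integrable_finsetSum _ fun j _ => hintg i j]
  congr 1 with u
  rw [PiLp.inner_apply, sq, Finset.sum_mul_sum]
  refine Finset.sum_congr rfl fun i _ => Finset.sum_congr rfl fun j _ => ?_
  simp
  ring

theorem exists_pos_le_integral_inner_sq (hK : IsFullBody K) (hS : IsFacetMeasure K S) :
    ∃ l > 0, ∀ v : En (m + 1), l * ‖v‖ ^ 2 ≤ ∫ u, ⟪v, (u : En (m + 1))⟫_ℝ ^ 2 ∂S := by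
  have := hS.finite hK
  have hcont : Continuous fun v : En (m + 1) => ∫ u, ⟪v, (u : En (m + 1))⟫_ℝ ^ 2 ∂S := by
    simp_rw [integral_inner_sq]
    fun_prop
  obtain ⟨v₀, hv₀, hmin⟩ := (isCompact_sphere (0 : En (m + 1)) 1).exists_isMinOn
    (NormedSpace.sphere_nonempty.2 zero_le_one) hcont.continuousOn
  have hv₀' : v₀ ≠ 0 := by
    rintro rfl
    simp at hv₀
  refine ⟨_, integral_inner_sq_pos hK hS hv₀', fun v => ?_⟩
  rcases eq_or_ne v 0 with rfl | hv
  · simp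
  have hv' : 0 < ‖v‖ := norm_pos_iff.2 hv
  have h := hmin (a := ‖v‖⁻¹ • v) (by simp [norm_smul, hv'.ne'])
  simp only [Set.mem_ofPred_eq, inner_smul_left, mul_pow, integral_const_mul] at h
  have h2 := mul_le_mul_of_nonneg_right h (sq_nonneg ‖v‖)
  refine h2.trans (le_of_eq ?_)
  simp
  field_simp

end

section bernstein
open Polynomial

variable {n : ℕ}

theorem integral_prod_eval_eq {S T : Measure (Sph n)} [IsFiniteMeasure S] [IsFiniteMeasure T] {s d : ℕ}
    (h : ∀ i : Fin n → ℕ, ∑ j, i j ≤ s → sphMoment S i = sphMoment T i) (hd : n * d ≤ s)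
    (P : Fin n → ℝ[X]) (hP : ∀ j, (P j).natDegree ≤ d) :
    ∫ u, ∏ j, (P j).eval ((u : En n) j) ∂S = ∫ u, ∏ j, (P j).eval ((u : En n) j) ∂T := by
  have h1 (u : Sph n) : ∏ j, (P j).eval ((u : En n) j) =
      ∑ k ∈ Fintype.piFinset fun _ : Fin n => Finset.range (d + 1),
        (∏ j, (P j).coeff (k j)) * ∏ j, ((u : En n) j) ^ (k j) := by
    simp_rw [fun j => eval_eq_sum_range' (Nat.lt_succ_of_le (hP j)), Finset.prod_univ_sum,
      Finset.prod_mul_distrib]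
  have h2 (S : Measure (Sph n)) [IsFiniteMeasure S] (k : Fin n → ℕ) :
      Integrable (fun u : Sph n => (∏ j, (P j).coeff (k j)) * ∏ j, ((u : En n) j) ^ (k j)) S :=
    integrable_sphere (by fun_prop)
  simp_rw [h1]
  rw [integral_finsetSum _ fun k _ => h2 S k, integral_finsetSum _ fun k _ => h2 T k]
  refine Finset.sum_congr rfl fun k hk => ?_
  rw [integral_const_mul, integral_const_mul]
  congr 1
  refine h k ((Finset.sum_le_card_nsmul _ _ d fun j _ => ?_).trans (by simpa using hd))
  have := Fintype.mem_piFinset.1 hk j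
  simp at this
  omega

/-- The Bernstein basis polynomials of the interval `[-1, 1]`. -/
def symmBernstein (d ν : ℕ) : ℝ[X] := (bernsteinPolynomial ℝ d ν).comp (C (1 / 2) * (X + 1))

theorem natDegree_symmBernstein_le {d ν : ℕ} (h : ν ≤ d) : (symmBernstein d ν).natDegree ≤ d := by
  have h1 : (bernsteinPolynomial ℝ d ν).natDegree ≤ d := by
    have h2 : (1 - X : ℝ[X]).natDegree ≤ 1 := by compute_degree
    rw [bernsteinPolynomial]
    refine natDegree_mul_le.trans ?_
    have h3 : ((d.choose ν : ℝ[X]) * X ^ ν).natDegree ≤ ν := by compute_degree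
    have h4 := natDegree_pow_le_of_le (d - ν) h2
    omega
  have h2 : (C (1 / 2) * (X + 1) : ℝ[X]).natDegree ≤ 1 := by compute_degree
  calc _ ≤ _ := natDegree_comp_le
    _ ≤ d * 1 := Nat.mul_le_mul h1 h2
    _ = d := mul_one d

theorem eval_symmBernstein (d ν : ℕ) (x : ℝ) :
    (symmBernstein d ν).eval x = (bernsteinPolynomial ℝ d ν).eval ((1 + x) / 2) := by
  simp [symmBernstein, eval_comp]
  ring_nf

theorem eval_symmBernstein_nonneg (d ν : ℕ) {x : ℝ} (hx : |x| ≤ 1) : 0 ≤ (symmBernstein d ν).eval x := by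
  obtain ⟨h1, h2⟩ := abs_le.1 hx
  have h3 : 0 ≤ (1 + x) / 2 := by linarith
  have h4 : 0 ≤ 1 - (1 + x) / 2 := by linarith
  rw [eval_symmBernstein]
  simp only [bernsteinPolynomial, eval_mul, eval_natCast, eval_pow, eval_X, eval_sub, eval_one]
  positivity

theorem sum_symmBernstein (d : ℕ) (x : ℝ) :
    ∑ ν : Fin (d + 1), (symmBernstein d ν).eval x = 1 := by
  simp_rw [eval_symmBernstein]
  rw [Fin.sum_univ_eq_sum_range fun ν => (bernsteinPolynomial ℝ d ν).eval ((1 + x) / 2), ← eval_finsetSum,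
    bernsteinPolynomial.sum, eval_one]

theorem sum_sq_mul_symmBernstein_le {d : ℕ} (hd : 0 < d) (x : ℝ) :
    ∑ ν : Fin (d + 1), (2 * ((ν : ℕ) : ℝ) / d - 1 - x) ^ 2 * (symmBernstein d ν).eval x ≤ (1 / d : ℝ) := by
  have h := congrArg (eval ((1 + x) / 2)) (bernsteinPolynomial.variance ℝ d)
  simp only [eval_finsetSum, eval_mul, eval_pow, eval_sub, eval_natCast, eval_X, eval_one,
    nsmul_eq_mul] at h
  have hd' : (0 : ℝ) < d := by exact_mod_cast hd
  simp_rw [eval_symmBernstein]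
  rw [Fin.sum_univ_eq_sum_range
    fun ν => (2 * (ν : ℝ) / d - 1 - x) ^ 2 * (bernsteinPolynomial ℝ d ν).eval ((1 + x) / 2)]
  have h2 : ∑ ν ∈ Finset.range (d + 1),
      (2 * (ν : ℝ) / d - 1 - x) ^ 2 * (bernsteinPolynomial ℝ d ν).eval ((1 + x) / 2) =
      (2 / d) ^ 2 * (d * ((1 + x) / 2) * (1 - (1 + x) / 2)) := by
    rw [← h, Finset.mul_sum]
    refine Finset.sum_congr rfl fun ν _ => ?_
    rw [← mul_assoc, ← mul_pow, ← neg_sq]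
    congr 2
    field_simp
    ring
  rw [h2, show (2 / d : ℝ) ^ 2 * (d * ((1 + x) / 2) * (1 - (1 + x) / 2)) = (1 - x ^ 2) / d by
    field_simp; ring]
  gcongr
  nlinarith

/-- The weights of multivariate Bernstein approximation. -/
def bernsteinWeight (d : ℕ) (k : Fin n → Fin (d + 1)) (u : En n) : ℝ := ∏ j, (symmBernstein d (k j)).eval (u j)

/-- The nodes of multivariate Bernstein approximation. -/
def bernsteinNode (d : ℕ) (k : Fin n → Fin (d + 1)) : En n := WithLp.toLp 2 fun j => 2 * ((k j : ℕ) : ℝ) / d - 1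

theorem sum_prod_symmBernstein (d : ℕ) (u : En n) : ∑ k, bernsteinWeight d k u = 1 := by
  simp only [bernsteinWeight]
  rw [← Fintype.piFinset_univ, ← Finset.prod_univ_sum (fun _ => Finset.univ) fun j (ν : Fin (d + 1)) =>
    (symmBernstein d ν).eval (u j)]
  simp_rw [sum_symmBernstein, Finset.prod_const_one]

theorem sum_bernsteinWeight_mul (d : ℕ) (u : En n) (i : Fin n) (g : Fin (d + 1) → ℝ) :
    ∑ k, bernsteinWeight d k u * g (k i) = ∑ ν, g ν * (symmBernstein d ν).eval (u i) := by
  have h (k : Fin n → Fin (d + 1)) : bernsteinWeight d k u * g (k i) =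
      ∏ j, ((if j = i then g (k j) else 1) * (symmBernstein d (k j)).eval (u j)) := by
    rw [Finset.prod_mul_distrib, Finset.prod_ite_eq' Finset.univ i fun j => g (k j)]
    simp [bernsteinWeight, mul_comm]
  simp_rw [h]
  rw [← Fintype.piFinset_univ, ← Finset.prod_univ_sum (fun _ => Finset.univ) fun j (ν : Fin (d + 1)) =>
    (if j = i then g ν else 1) * (symmBernstein d ν).eval (u j)]
  rw [Finset.prod_eq_single i]
  · simp
  · intro j _ hj
    simp [hj, sum_symmBernstein]
  · simp

theorem sum_bernsteinWeight_mul_norm_sq_le {d : ℕ} (hd : 0 < d) (u : En n) :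
    ∑ k, bernsteinWeight d k u * ‖bernsteinNode d k - u‖ ^ 2 ≤ n / d := by
  simp_rw [EuclideanSpace.norm_sq_eq, Finset.mul_sum]
  rw [Finset.sum_comm]
  calc _ ≤ ∑ _i : Fin n, (1 / d : ℝ) := Finset.sum_le_sum fun i _ => ?_
    _ = n / d := by simp [div_eq_mul_inv]
  have := sum_bernsteinWeight_mul d u i fun ν => (2 * ((ν : ℕ) : ℝ) / d - 1 - u i) ^ 2
  simp only [bernsteinNode, PiLp.sub_apply, norm_eq_abs, sq_abs]
  rw [this]
  exact sum_sq_mul_symmBernstein_le hd (u i)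

theorem abs_sub_bernstein_le {d : ℕ} (hd : 0 < d) {f : En n → ℝ} {R : ℝ} (hR : 0 ≤ R)
    (hf : ∀ u v, |f u - f v| ≤ R * ‖u - v‖) {u : En n} (hu : ‖u‖ = 1) :
    |f u - ∑ k, f (bernsteinNode d k) * bernsteinWeight d k u| ≤ R * √(n / d) := by
  have hd' : (0 : ℝ) < d := by exact_mod_cast hd
  have hw (k : Fin n → Fin (d + 1)) : 0 ≤ bernsteinWeight d k u :=
    Finset.prod_nonneg fun j _ => eval_symmBernstein_nonneg d _
      (by simpa [hu] using PiLp.norm_apply_le u j)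
  have hn : 0 < n := by
    rcases Nat.eq_zero_or_pos n with rfl | h
    · simp [Subsingleton.elim u 0] at hu
    · exact h
  set a := √(n / d) with ha
  have ha0 : 0 < a := by positivity
  have ha2 : a ^ 2 = n / d := sq_sqrt (by positivity)
  have h1 : f u - ∑ k, f (bernsteinNode d k) * bernsteinWeight d k u =
      ∑ k, bernsteinWeight d k u * (f u - f (bernsteinNode d k)) := by
    simp_rw [mul_sub, Finset.sum_sub_distrib]
    rw [← Finset.sum_mul, sum_prod_symmBernstein, one_mul]
    simp_rw [mul_comm]
  rw [h1]
  calc _ ≤ ∑ k, |bernsteinWeight d k u * (f u - f (bernsteinNode d k))| := Finset.abs_sum_le_sum_abs _ _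
    _ ≤ ∑ k, R * (a / 2 * bernsteinWeight d k u +
        (2 * a)⁻¹ * (bernsteinWeight d k u * ‖bernsteinNode d k - u‖ ^ 2)) := by
      refine Finset.sum_le_sum fun k _ => ?_
      rw [abs_mul, abs_of_nonneg (hw k), show R * (a / 2 * bernsteinWeight d k u +
        (2 * a)⁻¹ * (bernsteinWeight d k u * ‖bernsteinNode d k - u‖ ^ 2)) =
        bernsteinWeight d k u * (R * (a / 2 + (2 * a)⁻¹ * ‖bernsteinNode d k - u‖ ^ 2)) by ring]
      refine mul_le_mul_of_nonneg_left ((hf _ _).trans (mul_le_mul_of_nonneg_left ?_ hR)) (hw k)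
      rw [norm_sub_rev]
      set b := ‖bernsteinNode d k - u‖
      have : b * (2 * a) ≤ a ^ 2 + b ^ 2 := by nlinarith [sq_nonneg (a - b)]
      rw [← sub_nonneg]
      have e : a / 2 + (2 * a)⁻¹ * b ^ 2 - b = (2 * a)⁻¹ * (a ^ 2 + b ^ 2 - b * (2 * a)) := by
        field_simp
      rw [e]
      exact mul_nonneg (by positivity) (by linarith)
    _ ≤ R * (a / 2 + (2 * a)⁻¹ * a ^ 2) := by
      rw [← Finset.mul_sum, Finset.sum_add_distrib, ← Finset.mul_sum, ← Finset.mul_sum, sum_prod_symmBernstein,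
        mul_one]
      have := sum_bernsteinWeight_mul_norm_sq_le hd u
      rw [← ha2] at this
      gcongr
    _ = R * a := by field_simp; ring

theorem abs_integral_sub_le_of_moments {S T : Measure (Sph n)} [IsFiniteMeasure S] [IsFiniteMeasure T] {s : ℕ}
    (hs : 0 < s) (h : ∀ i : Fin n → ℕ, ∑ j, i j ≤ s → sphMoment S i = sphMoment T i) {f : En n → ℝ} {R : ℝ}
    (hR : 0 ≤ R) (hf : ∀ u v, |f u - f v| ≤ R * ‖u - v‖) (hf0 : f 0 = 0) (hfc : Continuous f) :
    |∫ u, f u ∂S - ∫ u, f u ∂T| ≤ (S.real Set.univ + T.real Set.univ) * (R * (2 * n / √s)) := by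
  obtain ⟨p, hpc, hpS, hp⟩ : ∃ p : En n → ℝ, Continuous p ∧ ∫ u, p u ∂S = ∫ u, p u ∂T ∧
      ∀ u : Sph n, |f u - p u| ≤ R * (2 * n / √s) := by
    have hs' : (0 : ℝ) < s := by exact_mod_cast hs
    rcases lt_or_ge s n with hsn | hsn
    · refine ⟨0, continuous_zero, by simp, fun u => ?_⟩
      have := hf u 0
      simp only [hf0, sub_zero, norm_eq_of_mem_sphere] at this
      simp only [Pi.zero_apply, sub_zero]
      refine this.trans (mul_le_mul_of_nonneg_left ?_ hR)
      rw [one_le_div (by positivity), sqrt_le_left (by positivity)]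
      have : (s : ℝ) ≤ n := by exact_mod_cast hsn.le
      have : (1 : ℝ) ≤ n := by
        have : 1 ≤ n := by omega
        exact_mod_cast this
      nlinarith
    · rcases Nat.eq_zero_or_pos n with rfl | hn
      · have : IsEmpty (Sph 0) := ⟨fun u => by
          have := u.2
          rw [mem_sphere_zero_iff_norm, Subsingleton.elim (u : En 0) 0] at this
          simp at this⟩
        exact ⟨0, continuous_zero, by simp, fun u => isEmptyElim u⟩
      have hd : 0 < s / n := Nat.div_pos hsn hn
      refine ⟨fun u => ∑ k, f (bernsteinNode (s / n) k) * bernsteinWeight (s / n) k u, ?_, ?_, fun u => ?_⟩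
      · simp only [bernsteinWeight]
        fun_prop
      · have hintg (S : Measure (Sph n)) [IsFiniteMeasure S] (k : Fin n → Fin (s / n + 1)) :
            Integrable (fun u : Sph n => f (bernsteinNode (s / n) k) * bernsteinWeight (s / n) k u) S :=
          integrable_sphere (by simp only [bernsteinWeight]; fun_prop)
        rw [integral_finsetSum _ fun k _ => hintg S k, integral_finsetSum _ fun k _ => hintg T k]
        refine Finset.sum_congr rfl fun k _ => ?_
        rw [integral_const_mul, integral_const_mul]
        congr 1
        exact integral_prod_eval_eq h (Nat.mul_div_le s n) (fun j => symmBernstein (s / n) (k j))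
          fun j => natDegree_symmBernstein_le (by omega)
      · refine (abs_sub_bernstein_le hd hR hf (by simp)).trans (mul_le_mul_of_nonneg_left ?_ hR)
        rw [sqrt_le_left (by positivity), div_pow, sq_sqrt hs'.le, div_le_div_iff₀ (by positivity) hs']
        have h1 : s < n * (s / n + 1) := Nat.lt_mul_div_succ s hn
        have h2 : s ≤ n * (2 * (s / n)) := h1.le.trans (Nat.mul_le_mul_left _ (by omega))
        have h3 : (s : ℝ) ≤ n * (2 * ((s / n : ℕ) : ℝ)) := by exact_mod_cast h2
        have hn' : (0 : ℝ) < n := by exact_mod_cast hn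
        have hd' : (0 : ℝ) < ((s / n : ℕ) : ℝ) := by exact_mod_cast hd
        nlinarith [mul_pos (mul_pos hn' hn') hd']
  have hb (S : Measure (Sph n)) [IsFiniteMeasure S] :
      |∫ u, f u ∂S - ∫ u, p u ∂S| ≤ S.real Set.univ * (R * (2 * n / √s)) := by
    have h1 : Integrable (fun u : Sph n => f u) S := integrable_sphere (by fun_prop)
    have h2 : Integrable (fun u : Sph n => p u) S := integrable_sphere (by fun_prop)
    rw [← integral_sub h1 h2, mul_comm]
    have := norm_integral_le_of_norm_le_const (μ := S) (f := fun u : Sph n => f u - p u) (ae_of_all _ hp)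
    exact this
  have h1 := hb S
  have h2 := hb T
  rw [hpS] at h1
  rw [abs_le] at h1 h2 ⊢
  constructor <;> linarith [h1.1, h1.2, h2.1, h2.2]

end bernstein

section hausdorff
variable {n : ℕ} {K L : Set (En n)}

theorem exists_dist_le_of_supp_le (hK : IsCompact K) (hL : IsCompact L) (hLc : Convex ℝ L) (hLne : L.Nonempty)
    {c : ℝ} (hc : 0 ≤ c) (h : ∀ u : En n, ‖u‖ = 1 → supp K u ≤ supp L u + c) {x : En n} (hx : x ∈ K) :
    ∃ y ∈ L, dist x y ≤ c := by
  obtain ⟨y, hy, hmin⟩ := exists_norm_eq_iInf_of_complete_convex hLne hL.isComplete hLc x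
  refine ⟨y, hy, ?_⟩
  rw [norm_eq_iInf_iff_real_inner_le_zero hLc hy] at hmin
  rw [dist_eq_norm]
  rcases (norm_nonneg (x - y)).eq_or_lt with h0 | h0
  · rwa [← h0]
  set u : En n := ‖x - y‖⁻¹ • (x - y) with hu
  have h1 := h u (by rw [hu, norm_smul, norm_inv, norm_norm, inv_mul_cancel₀ h0.ne'])
  have h2 : supp L u = ⟪y, u⟫_ℝ := supp_eq hL hy fun z hz => by
    rw [hu, inner_smul_right, real_inner_comm]
    exact mul_nonpos_of_nonneg_of_nonpos (by positivity) (hmin z hz)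
  have h3 := le_supp hK hx u
  have h4 : ⟪x, u⟫_ℝ - ⟪y, u⟫_ℝ = ‖x - y‖ := by
    rw [← inner_sub_left, hu, inner_smul_right, real_inner_self_eq_norm_sq]
    field_simp
  linarith

theorem hausdorffDist_le_of_abs_supp_sub_le (hK : IsFullBody K) (hL : IsFullBody L) {c : ℝ} (hc : 0 ≤ c)
    (h : ∀ u : En n, ‖u‖ = 1 → |supp K u - supp L u| ≤ c) : hausdorffDist K L ≤ c :=
  hausdorffDist_le_of_mem_dist hc
    (fun _ hx => exists_dist_le_of_supp_le hK.isCompact hL.isCompact hL.convex hL.nonempty hc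
      (fun u hu => by linarith [(abs_le.1 (h u hu)).2]) hx)
    fun _ hx => exists_dist_le_of_supp_le hL.isCompact hK.isCompact hK.convex hK.nonempty hc
      (fun u hu => by linarith [(abs_le.1 (h u hu)).1]) hx

theorem transHausdorffDist_nonneg : 0 ≤ transHausdorffDist K L :=
  Real.iInf_nonneg fun _ => hausdorffDist_nonneg

theorem transHausdorffDist_le_translate (a b : En n) :
    transHausdorffDist K L ≤ hausdorffDist ((fun y => y + a) '' K) ((fun y => y + b) '' L) := by
  have h : (fun y => y + b) '' L = (fun y => y + a) '' ((fun y => y + (b - a)) '' L) := by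
    rw [Set.image_image]
    exact Set.image_congr' fun y => by abel
  rw [h, hausdorffDist_image (isometry_add_right a)]
  exact ciInf_le ⟨0, Set.forall_mem_range.2 fun _ => hausdorffDist_nonneg⟩ (b - a)

theorem transHausdorffDist_le_of_abs_supp_sub_le (hK : IsFullBody K) (hL : IsFullBody L) {c : ℝ} (hc : 0 ≤ c)
    {x : En n} (h : ∀ u : En n, ‖u‖ = 1 → |supp K u - supp L u - ⟪x, u⟫_ℝ| ≤ c) :
    transHausdorffDist K L ≤ c := by
  refine (transHausdorffDist_le_translate 0 x).trans
    (hausdorffDist_le_of_abs_supp_sub_le (hK.translate 0) (hL.translate x) hc fun u hu => ?_)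
  rw [supp_translate hK.isCompact hK.nonempty, supp_translate hL.isCompact hL.nonempty, inner_zero_left,
    add_zero, ← sub_sub]
  exact h u hu

theorem transHausdorffDist_translate_le (a b : En n) :
    transHausdorffDist K L ≤ transHausdorffDist ((fun y => y + a) '' K) ((fun y => y + b) '' L) := by
  refine le_ciInf fun x => (transHausdorffDist_le_translate a (b + x)).trans (le_of_eq ?_)
  rw [Set.image_image]
  simp_rw [add_assoc]

open scoped Pointwise in
theorem supp_smul (hK : IsCompact K) (hne : K.Nonempty) {c : ℝ} (hc : 0 ≤ c) (u : En n) :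
    supp (c • K) u = c * supp K u := by
  obtain ⟨x, hx, h⟩ := exists_eq_supp hK hne u
  apply le_antisymm
  · refine supp_le (hne.image _) ?_
    rintro _ ⟨y, hy, rfl⟩
    simp only [inner_smul_left]
    exact mul_le_mul_of_nonneg_left (le_supp hK hy u) hc
  · rw [← h]
    have := le_supp (hK.smul c) (Set.smul_mem_smul_set hx) u
    rwa [inner_smul_left] at this

open scoped Pointwise in
theorem IsFullBody.smul (hK : IsFullBody K) {c : ℝ} (hc : c ≠ 0) : IsFullBody (c • K) :=
  ⟨hK.convex.smul c, hK.isCompact.smul c, by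
    rw [interior_smul₀ hc]
    exact hK.interior_nonempty.smul_set⟩

theorem abs_supp_le (hK : IsCompact K) (hne : K.Nonempty) {R : ℝ} (hR : ∀ x ∈ K, ‖x‖ ≤ R) {u : En n}
    (hu : ‖u‖ = 1) : |supp K u| ≤ R := by
  obtain ⟨x, hx, h⟩ := exists_eq_supp hK hne u
  rw [← h]
  refine (abs_real_inner_le_norm x u).trans ?_
  rw [hu, mul_one]
  exact hR x hx

end hausdorff

section
variable {m : ℕ} {K L : Set (En (m + 1))} {S T : Measure (Sph (m + 1))}

theorem le_one_add_two_mul_of_log_le {V W x : ℝ} (hV : 0 < V) (hW : 0 < W) (hx0 : 0 ≤ x) (hx1 : x ≤ 1)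
    (h : log (W / V) ≤ x) : W ≤ V * (1 + 2 * x) := by
  have h1 : W / V ≤ exp x := (log_le_iff_le_exp (by positivity)).1 h
  have h2 := (abs_le.1 (abs_exp_sub_one_sub_id_le (by rwa [abs_of_nonneg hx0]))).2
  rw [div_le_iff₀ hV] at h1
  have h3 : exp x ≤ 1 + 2 * x := by nlinarith
  nlinarith

open scoped Pointwise in
/-- Stability of bodies with nearly equal mixed volumes, the smaller body coming second. -/
theorem exists_abs_supp_sub_le (hm : 1 ≤ m) (hK : IsFullBody K) (hL : IsFullBody L)
    (hK0 : (0 : En (m + 1)) ∈ interior K) (hL0 : (0 : En (m + 1)) ∈ interior L)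
    (hS : IsFacetMeasure K S) (hT : IsFacetMeasure L T) {v₀ V₁ R E : ℝ} (hv₀ : 0 < v₀)
    (hvL : v₀ ≤ volume.real L) (hLK : volume.real L ≤ volume.real K) (hKV : volume.real K ≤ V₁)
    (hKR : ∀ x ∈ K, ‖x‖ ≤ R) (hLR : ∀ x ∈ L, ‖x‖ ≤ R) (hE : 0 < E)
    (h : coneConst m * ∫ u, supp L u ∂S ≤ coneConst m * ∫ u, supp L u ∂T + E) :
    ∃ x : En (m + 1), ∀ u : En (m + 1), ‖u‖ = 1 → |supp K u - supp L u - ⟪x, u⟫_ℝ| ≤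
      (1 + 4 * (2 * (V₁ / v₀ * R)) + 2 * (2 * (V₁ / v₀ * R)) ^ 2) *
        ((m + 1) * (V₁ / v₀) * E / v₀) ^ (((m + 3 : ℕ) : ℝ)⁻¹) := by
  set q := V₁ / v₀ with hq
  have hq1 : 1 ≤ q := by rw [hq, one_le_div hv₀]; linarith
  have hR : 0 ≤ R := (norm_nonneg _).trans (hKR 0 (interior_subset hK0))
  set W := 2 * (q * R) with hWd
  have hRW : 2 * R ≤ W := by rw [hWd]; nlinarith
  have hW : 0 ≤ W := by positivity
  set y := (m + 1) * q * E / v₀ with hy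
  have hy0 : 0 < y := by positivity
  set e := y ^ (((m + 3 : ℕ) : ℝ)⁻¹) with he
  have he0 : 0 < e := by positivity
  have hey : e ^ (m + 3) = y := rpow_inv_natCast_pow hy0.le (by omega)
  rcases lt_or_ge 1 y with hy1 | hy1
  · refine ⟨0, fun u hu => ?_⟩
    have h1 := abs_supp_le hK.isCompact hK.nonempty hKR hu
    have h2 := abs_supp_le hL.isCompact hL.nonempty hLR hu
    have h3 : 1 ≤ e := one_le_rpow hy1.le (by positivity)
    rw [inner_zero_left, sub_zero]
    have h4 := abs_sub (supp K u) (supp L u)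
    nlinarith [sq_nonneg W]
  set V := volume.real K with hV
  set U := volume.real L with hU
  have hU0 : 0 < U := hv₀.trans_le hvL
  have hV0 : 0 < V := hU0.trans_le hLK
  set c := (V / U) ^ (((m + 1 : ℕ) : ℝ)⁻¹) with hc
  have hc1 : 1 ≤ c := one_le_rpow ((one_le_div hU0).2 hLK) (by positivity)
  have hcU : c ^ (m + 1) = V / U := rpow_inv_natCast_pow (by positivity) (by omega)
  have hcq : c ≤ q := by
    refine (le_self_pow₀ hc1 (by omega : m + 1 ≠ 0)).trans ?_
    rw [hcU]
    exact div_le_div₀ (hV0.le.trans hKV) hKV hv₀ hvL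
  have hc0 : 0 < c := by linarith
  have hcL : IsFullBody (c • L) := hL.smul hc0.ne'
  have hVcL : volume.real (c • L) = V := by
    rw [measureReal_def, Measure.addHaar_smul, ENNReal.toReal_mul, ENNReal.toReal_ofReal (abs_nonneg _),
      finrank_euclideanSpace_fin, abs_of_nonneg (by positivity), hcU, ← measureReal_def, ← hU]
    field_simp
  have hsupp : ∫ u, supp (c • L) u ∂S = c * ∫ u, supp L u ∂S := by
    rw [← integral_const_mul]
    simp_rw [supp_smul hL.isCompact hL.nonempty hc0.le]
  have h0cL : (0 : En (m + 1)) ∈ c • L := ⟨0, interior_subset hL0, smul_zero c⟩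
  have hkey := two_mul_log_volume_mix_le hK hK0 hS hcL h0cL
  have hT' := coneConst_mul_integral_supp_le hL hL0 hT
  have hBM := brunnMinkowski_euclidean hK hcL (t := 1 / 2) (by norm_num) (by norm_num)
  rw [hVcL, ← hV, ← rpow_add hV0, show (1 - 1 / 2 + 1 / 2 : ℝ) = 1 by norm_num, rpow_one] at hBM
  set M := volume.real (minkowskiMix (1 / 2) K (c • L)) with hM
  rw [hsupp] at hkey
  have hI : coneConst m * (c * ∫ u, supp L u ∂S) ≤ V / c + c * E := by
    have h1 : c * U ≤ V / c := by
      have h2 : c ^ 2 ≤ V / U := hcU ▸ pow_le_pow_right₀ hc1 (by omega)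
      rw [le_div_iff₀ hc0]
      rw [le_div_iff₀ hU0] at h2
      linarith
    have := mul_le_mul_of_nonneg_left (h.trans (add_le_add_left hT' E)) hc0.le
    nlinarith
  have hlog0 : 0 ≤ log (M / V) := log_nonneg ((one_le_div hV0).2 hBM)
  have hVc : V / c ≤ V := div_le_self hV0.le hc1
  have hVI : V ≤ V / c + c * E := by
    have h1 : 0 ≤ 2 * log (M / V) * V := by positivity
    have := nonneg_of_mul_nonneg_right (h1.trans hkey) (by positivity)
    linarith
  have hc2 : (c - 1) * v₀ ≤ q * q * E := by
    have h1 : V * c ≤ V + c * c * E := by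
      have := mul_le_mul_of_nonneg_right hVI hc0.le
      rw [add_mul, div_mul_cancel₀ _ hc0.ne'] at this
      linarith
    have h2 : (c - 1) * v₀ ≤ (c - 1) * V :=
      mul_le_mul_of_nonneg_left (hvL.trans hLK) (by linarith)
    have h3 : c * c * E ≤ q * q * E := by gcongr
    linarith
  have hlog : log (M / V) ≤ y / 2 := by
    have h1 : 2 * log (M / V) * v₀ ≤ (m + 1) * (q * E) := by
      calc 2 * log (M / V) * v₀ ≤ 2 * log (M / V) * V := by gcongr; linarith
        _ ≤ _ := hkey
        _ ≤ (m + 1) * (q * E) := by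
          refine mul_le_mul_of_nonneg_left ?_ (by positivity)
          have : c * E ≤ q * E := by gcongr
          linarith
    rw [hy, div_div, le_div_iff₀ (by positivity)]
    linarith
  have hMV : M ≤ V * (1 + e ^ (m + 1 + 2)) := by
    have := le_one_add_two_mul_of_log_le hV0 (hV0.trans_le hBM) (by positivity) (by linarith) hlog
    rw [show m + 1 + 2 = m + 3 by omega, hey]
    linarith
  have hdiam (Q : Set (En (m + 1))) (ρ : ℝ) (hQ : ∀ x ∈ Q, ‖x‖ ≤ ρ) (x) (hx : x ∈ Q) (z) (hz : z ∈ Q) :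
      ‖x - z‖ ≤ 2 * ρ := by
    have := norm_sub_le x z
    linarith [hQ x hx, hQ z hz]
  have hcR : ∀ x ∈ c • L, ‖x‖ ≤ q * R := by
    rintro _ ⟨x, hx, rfl⟩
    simp only [norm_smul, norm_of_nonneg hc0.le]
    exact mul_le_mul hcq (hLR x hx) (norm_nonneg _) (by linarith)
  refine ⟨V⁻¹ • (momentVector K - momentVector (c • L)), fun u hu => ?_⟩
  have h1 := abs_supp_sub_le (W := W) (Nat.succ_ne_zero m) hK hcL he0 hV.symm hVcL
    (fun x hx z hz => (hdiam K R hKR x hx z hz).trans hRW) (hdiam (c • L) (q * R) hcR) hMV hu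
  have h2 : |supp (c • L) u - supp L u| ≤ W * e := by
    rw [supp_smul hL.isCompact hL.nonempty hc0.le, ← sub_one_mul, abs_mul, abs_of_nonneg (by linarith)]
    have h3 := abs_supp_le hL.isCompact hL.nonempty hLR hu
    have h4 : y ≤ e := by
      rw [he]
      exact self_le_rpow_of_le_one hy0.le hy1 (inv_le_one_of_one_le₀ (Nat.one_le_cast.2 (by omega)))
    have h5 : c - 1 ≤ q * y := by
      have e1 : q * y = (m + 1) * (q * q * E / v₀) := by rw [hy]; ring
      have e2 : c - 1 ≤ q * q * E / v₀ := by rwa [le_div_iff₀ hv₀]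
      rw [e1]
      have : 0 ≤ (m : ℝ) * (q * q * E / v₀) := by positivity
      linarith
    calc (c - 1) * |supp L u| ≤ (q * y) * R := by gcongr
      _ ≤ (q * e) * R := by gcongr
      _ ≤ W * e := by
        rw [hWd]
        have : 0 ≤ q * e * R := by positivity
        linarith
  have h3 := abs_add_le (supp K u - supp (c • L) u -
    ⟪V⁻¹ • (momentVector K - momentVector (c • L)), u⟫_ℝ) (supp (c • L) u - supp L u)
  rw [show supp K u - supp (c • L) u - ⟪V⁻¹ • (momentVector K - momentVector (c • L)), u⟫_ℝ +
    (supp (c • L) u - supp L u) = supp K u - supp L u -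
      ⟪V⁻¹ • (momentVector K - momentVector (c • L)), u⟫_ℝ by ring] at h3
  refine h3.trans ((add_le_add h1 h2).trans (le_of_eq ?_))
  ring

end

/-- The surface area measure of the `(m + 1)`-dimensional body `K` is `S`, with total mass at most `τ` and all
its second moments at least `l`. -/
structure IsSpread {m : ℕ} (τ l : ℝ) (K : Set (En (m + 1))) (S : Measure (Sph (m + 1))) : Prop where
  full : IsFullBody K
  facet : IsFacetMeasure K S
  mass_le : S.real Set.univ ≤ τ
  le_integral : ∀ v : En (m + 1), l * ‖v‖ ^ 2 ≤ ∫ u, ⟪v, (u : En (m + 1))⟫_ℝ ^ 2 ∂S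

theorem IsSpread.translate {m : ℕ} {τ l : ℝ} {K : Set (En (m + 1))} {S : Measure (Sph (m + 1))}
    (h : IsSpread τ l K S) (x : En (m + 1)) : IsSpread τ l ((fun y => y + x) '' K) S :=
  ⟨h.full.translate x, h.facet.translate x, h.mass_le, h.le_integral⟩

theorem exists_transHausdorffDist_le {m : ℕ} (hm : 1 ≤ m) {τ l : ℝ} (hτ : 0 < τ) (hl : 0 < l) :
    ∃ C > 0, ∀ (K L : Set (En (m + 1))) (S T : Measure (Sph (m + 1))), IsSpread τ l K S → IsSpread τ l L T →
      ∀ s : ℕ, 0 < s → (∀ i : Fin (m + 1) → ℕ, ∑ j, i j ≤ s → sphMoment S i = sphMoment T i) →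
        transHausdorffDist K L ≤ C * (s : ℝ) ^ (-(2 * ((m + 3 : ℕ) : ℝ))⁻¹) := by
  set ω := volume.real (ball (0 : En (m + 1)) 1) with hω
  set κ : ℝ := ((coneConst m : ℝ≥0) : ℝ) with hκ
  have hω0 : 0 < ω := ENNReal.toReal_pos (measure_ball_pos _ _ one_pos).ne' measure_ball_lt_top.ne
  have hκ0 : 0 < κ := coneConst_pos m
  set V₁ := ω * (1 + κ * τ / ω) ^ (m + 1) with hV₁
  have hV₁0 : 0 < V₁ := by positivity
  set v₀ := min 1 ((κ * l / 2) ^ (m + 1) / ω) with hv₀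
  have hv₀0 : 0 < v₀ := lt_min one_pos (by positivity)
  set R := V₁ / (κ * l / 2) with hR
  have hR0 : 0 < R := by positivity
  set B := 1 + 4 * (2 * (V₁ / v₀ * R)) + 2 * (2 * (V₁ / v₀ * R)) ^ 2 with hB
  have hB0 : 0 < B := by positivity
  set A := κ * ((τ + τ) * (R * (2 * (m + 1 : ℕ)))) with hA
  have hA0 : 0 < A := by positivity
  set D := (m + 1) * (V₁ / v₀) * A / v₀ with hD
  have hD0 : 0 < D := by positivity
  refine ⟨B * D ^ (((m + 3 : ℕ) : ℝ)⁻¹), by positivity, ?_⟩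
  suffices ∀ (K L : Set (En (m + 1))) (S T : Measure (Sph (m + 1))), IsSpread τ l K S → IsSpread τ l L T →
      (0 : En (m + 1)) ∈ interior K → (0 : En (m + 1)) ∈ interior L →
      ∀ s : ℕ, 0 < s → (∀ i : Fin (m + 1) → ℕ, ∑ j, i j ≤ s → sphMoment S i = sphMoment T i) →
        transHausdorffDist K L ≤ B * D ^ (((m + 3 : ℕ) : ℝ)⁻¹) * (s : ℝ) ^ (-(2 * ((m + 3 : ℕ) : ℝ))⁻¹) by
    intro K L S T hK hL s hs h
    obtain ⟨x, hx⟩ := hK.full.interior_nonempty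
    obtain ⟨y, hy⟩ := hL.full.interior_nonempty
    exact (transHausdorffDist_translate_le (-x) (-y)).trans (this _ _ S T (hK.translate _) (hL.translate _)
      (zero_mem_interior_translate hx) (zero_mem_interior_translate hy) s hs h)
  intro K L S T hK hL hK0 hL0 s hs h
  have hs0 : (0 : ℝ) < s := by exact_mod_cast hs
  have hSf := hK.facet.finite hK.full
  have hTf := hL.facet.finite hL.full
  have hbound {Q : Set (En (m + 1))} {U : Measure (Sph (m + 1))} (hQ : IsSpread τ l Q U)
      (h0 : (0 : En (m + 1)) ∈ interior Q) :
      v₀ ≤ volume.real Q ∧ volume.real Q ≤ V₁ ∧ ∀ x ∈ Q, ‖x‖ ≤ R := by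
    have h1 := volume_le_of_mass_le hm hQ.full hQ.facet hQ.mass_le
    refine ⟨min_le_volume hm hQ.full hQ.facet hl hQ.le_integral, h1, fun x hx => ?_⟩
    have := mul_norm_sub_le_volume hQ.full hQ.facet hQ.le_integral hx (interior_subset h0)
    rw [sub_zero] at this
    rw [hR, le_div_iff₀ (by positivity), mul_comm]
    exact this.trans h1
  obtain ⟨hvK, hKV, hKR⟩ := hbound hK hK0
  obtain ⟨hvL, hLV, hLR⟩ := hbound hL hL0
  set E := A / √s with hE
  have hE0 : 0 < E := by positivity
  have hintg {Q : Set (En (m + 1))} (hQ : IsFullBody Q) (hQR : ∀ x ∈ Q, ‖x‖ ≤ R) :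
      |∫ u, supp Q (u : En (m + 1)) ∂S - ∫ u, supp Q (u : En (m + 1)) ∂T| ≤ E / κ := by
    have h1 := abs_integral_sub_le_of_moments hs h hR0.le (f := supp Q) (fun u v => ?_) ?_
      (continuous_supp hQ.isCompact hQ.nonempty)
    · refine h1.trans ?_
      have h2 : S.real Set.univ + T.real Set.univ ≤ τ + τ := add_le_add hK.mass_le hL.mass_le
      calc _ ≤ (τ + τ) * (R * (2 * (m + 1 : ℕ) / √s)) := by gcongr
        _ = E / κ := by rw [hE, hA]; field_simp
    · have h1 := supp_le_add hQ.isCompact hQ.nonempty hQR u v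
      have h2 := supp_le_add hQ.isCompact hQ.nonempty hQR v u
      rw [norm_sub_rev] at h2
      rw [abs_le]
      constructor <;> linarith
    · obtain ⟨x, -, hx⟩ := exists_eq_supp hQ.isCompact hQ.nonempty 0
      rw [← hx, inner_zero_right]
  have hpow : B * ((m + 1) * (V₁ / v₀) * E / v₀) ^ (((m + 3 : ℕ) : ℝ)⁻¹) =
      B * D ^ (((m + 3 : ℕ) : ℝ)⁻¹) * (s : ℝ) ^ (-(2 * ((m + 3 : ℕ) : ℝ))⁻¹) := by
    have h1 : (m + 1) * (V₁ / v₀) * E / v₀ = D * (s : ℝ) ^ (-(1 / 2) : ℝ) := by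
      rw [hD, hE, sqrt_eq_rpow, rpow_neg hs0.le]
      field_simp
    rw [h1, mul_rpow hD0.le (by positivity), ← rpow_mul hs0.le, mul_assoc]
    congr 3
    rw [mul_inv]
    ring
  rw [← hpow]
  have hc : 0 ≤ B * ((m + 1) * (V₁ / v₀) * E / v₀) ^ (((m + 3 : ℕ) : ℝ)⁻¹) := by positivity
  rcases le_total (volume.real L) (volume.real K) with hLK | hLK
  · have h1 := (abs_le.1 (hintg hL.full hLR)).2
    rw [le_div_iff₀ hκ0] at h1
    obtain ⟨x, hx⟩ := exists_abs_supp_sub_le hm hK.full hL.full hK0 hL0 hK.facet hL.facet hv₀0 hvL hLK hKV hKR hLR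
      hE0 (by linarith)
    exact transHausdorffDist_le_of_abs_supp_sub_le hK.full hL.full hc hx
  · have h1 := (abs_le.1 (hintg hK.full hKR)).1
    rw [neg_le, le_div_iff₀ hκ0] at h1
    obtain ⟨x, hx⟩ := exists_abs_supp_sub_le hm hL.full hK.full hL0 hK0 hL.facet hK.facet hv₀0 hvK hLK hLV hLR hKR
      hE0 (by linarith)
    refine transHausdorffDist_le_of_abs_supp_sub_le (x := -x) hK.full hL.full hc fun u hu => ?_
    rw [inner_neg_left, ← abs_neg]
    convert hx u hu using 2
    ring

section
variable {n : ℕ}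

theorem integral_mul_eq_sphMoment (S : Measure (Sph n)) (i j : Fin n) :
    ∫ u, (u : En n) i * (u : En n) j ∂S = sphMoment S (Pi.single i 1 + Pi.single j 1) := by
  simp only [sphMoment, Pi.add_apply, pow_add, Finset.prod_mul_distrib]
  congr 1 with u
  have h (i : Fin n) : ∏ k, (u : En n) k ^ (Pi.single i 1 : Fin n → ℕ) k = (u : En n) i := by
    rw [Finset.prod_eq_single i (fun k _ hk => by simp [hk]) (by simp)]
    simp
  rw [h, h]

theorem sum_integral_mul_self (S : Measure (Sph n)) [IsFiniteMeasure S] :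
    ∑ i, ∫ u, (u : En n) i * (u : En n) i ∂S = S.real Set.univ := by
  have h (i : Fin n) : Integrable (fun u : Sph n => (u : En n) i * (u : En n) i) S :=
    integrable_sphere (by fun_prop)
  rw [← integral_finsetSum _ fun i _ => h i]
  have h2 (u : Sph n) : ∑ i, (u : En n) i * (u : En n) i = 1 := by
    have := EuclideanSpace.norm_sq_eq (u : En n)
    rw [norm_eq_of_mem_sphere] at this
    simpa [sq] using this.symm
  simp [h2]

theorem integral_mul_eq_of_moments {S T : Measure (Sph n)}
    (h : ∀ i : Fin n → ℕ, ∑ j, i j ≤ 2 → sphMoment S i = sphMoment T i) (i j : Fin n) :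
    ∫ u, (u : En n) i * (u : En n) j ∂S = ∫ u, (u : En n) i * (u : En n) j ∂T := by
  rw [integral_mul_eq_sphMoment, integral_mul_eq_sphMoment]
  refine h _ ?_
  simp [Finset.sum_add_distrib]

theorem exists_ne_zero_inner_eq_zero {m : ℕ} (hm : 1 ≤ m) (u : En (m + 1)) : ∃ v ≠ 0, ⟪v, u⟫_ℝ = 0 := by
  have h : (ℝ ∙ u)ᗮ ≠ ⊥ := fun hbot => by
    rw [Submodule.orthogonal_eq_bot_iff] at hbot
    have h1 := finrank_span_le_card (R := ℝ) ({u} : Set (En (m + 1)))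
    rw [hbot, finrank_top, finrank_euclideanSpace_fin] at h1
    simp at h1
    omega
  obtain ⟨v, hv, hv0⟩ := Submodule.exists_mem_ne_zero_of_ne_bot h
  exact ⟨v, hv0, real_inner_comm u v ▸ Submodule.mem_orthogonal_singleton_iff_inner_right.1 hv⟩

/-- A pair of opposite atoms has a degenerate matrix of second moments. -/
theorem exists_sum_integral_smul_dirac_eq_zero {m : ℕ} (hm : 1 ≤ m) (c : ℝ≥0∞) {u u' : Sph (m + 1)}
    (hu : (u' : En (m + 1)) = -(u : En (m + 1))) : ∃ v : En (m + 1), v ≠ 0 ∧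
      ∑ i, ∑ j, v i * v j * ∫ w, (w : En (m + 1)) i * (w : En (m + 1)) j
        ∂(c • (Measure.dirac u + Measure.dirac u')) = 0 := by
  obtain ⟨v, hv, hvu⟩ := exists_ne_zero_inner_eq_zero hm (u : En (m + 1))
  refine ⟨v, hv, ?_⟩
  simp_rw [integral_smul_measure, smul_eq_mul, mul_left_comm _ c.toReal, ← Finset.mul_sum]
  rw [← integral_inner_sq, integral_add_measure (integrable_sphere (by fun_prop)) (integrable_sphere (by fun_prop)),
    integral_dirac, integral_dirac, hu, inner_neg_right, hvu]
  simp

theorem IsSurfaceAreaMeasure.isFacetMeasure {m : ℕ} {K : Set (En (m + 1))} {S : Measure (Sph (m + 1))}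
    (h : IsSurfaceAreaMeasure K S) (hK : (interior K).Nonempty) : IsFacetMeasure K S := by
  obtain ⟨-, h⟩ | ⟨h, -⟩ := h
  · intro ω hω
    rw [h ω hω]
    simp [facet]
  · exact absurd h hK.ne_empty

end

section
variable {m : ℕ} {K L : Set (En (m + 1))} {S T : Measure (Sph (m + 1))} {τ l : ℝ}

theorem IsSpread.of_integral_mul_eq (hK : IsSpread τ l K S) (hL : IsFullBody L) (hT : IsFacetMeasure L T)
    (h : ∀ i j, ∫ u, (u : En (m + 1)) i * (u : En (m + 1)) j ∂T = ∫ u, (u : En (m + 1)) i * (u : En (m + 1)) j ∂S) :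
    IsSpread τ l L T := by
  have := hK.facet.finite hK.full
  have := hT.finite hL
  refine ⟨hL, hT, ?_, fun v => ?_⟩
  · rw [← sum_integral_mul_self]
    simp_rw [h]
    rw [sum_integral_mul_self]
    exact hK.mass_le
  · have h1 := hK.le_integral v
    rw [integral_inner_sq] at h1 ⊢
    simpa only [h] using h1

theorem IsSpread.of_isSurfaceAreaMeasure (hm : 1 ≤ m) (hl : 0 < l) (hK : IsSpread τ l K S) (hLc : Convex ℝ L)
    (hLk : IsCompact L) (hT : IsSurfaceAreaMeasure L T)
    (h : ∀ i j, ∫ u, (u : En (m + 1)) i * (u : En (m + 1)) j ∂T = ∫ u, (u : En (m + 1)) i * (u : En (m + 1)) j ∂S) :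
    IsSpread τ l L T := by
  rcases (interior L).eq_empty_or_nonempty with hLe | hLi
  · obtain ⟨hne, -⟩ | ⟨-, u, u', hu, -, rfl⟩ := hT
    · exact absurd hLe hne.ne_empty
    have := hK.facet.finite hK.full
    obtain ⟨v, hv, hv0⟩ := exists_sum_integral_smul_dirac_eq_zero hm _ hu
    have h1 := hK.le_integral v
    rw [integral_inner_sq] at h1
    simp_rw [← h] at h1
    have h2 : 0 < l * ‖v‖ ^ 2 := by positivity
    exact absurd (h1.trans hv0.le) h2.not_ge
  · exact hK.of_integral_mul_eq ⟨hLc, hLk, hLi⟩ (hT.isFacetMeasure hLi) h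

/-- Stability of the determination of a body by finitely many of its surface tensors, with a constant depending
only on the rank-2 tensor. -/
theorem exists_const_of_rank2TensorMatrix (hm : 1 ≤ m) (Q : Matrix (Fin (m + 1)) (Fin (m + 1)) ℝ) :
    ∃ C > 0, ∀ (K L : Set (En (m + 1))) (S T : Measure (Sph (m + 1))), IsFullBody K → IsSurfaceAreaMeasure K S →
      rank2TensorMatrix S = Q → Convex ℝ L → IsCompact L → IsSurfaceAreaMeasure L T → ∀ s : ℕ, 2 ≤ s →
      (∀ i : Fin (m + 1) → ℕ, ∑ j, i j ≤ s → sphMoment T i = sphMoment S i) →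
        transHausdorffDist K L ≤ C * (s : ℝ) ^ (-(2 * ((m + 3 : ℕ) : ℝ))⁻¹) := by
  by_cases hex : ∃ (K : Set (En (m + 1))) (S : Measure (Sph (m + 1))), IsFullBody K ∧ IsSurfaceAreaMeasure K S ∧
      rank2TensorMatrix S = Q
  · obtain ⟨K', S', hK', hS', rfl⟩ := hex
    replace hS' := hS'.isFacetMeasure hK'.interior_nonempty
    obtain ⟨l, hl, hl'⟩ := exists_pos_le_integral_inner_sq hK' hS'
    have hspread : IsSpread (S'.real Set.univ + 1) l K' S' := ⟨hK', hS', by linarith, hl'⟩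
    obtain ⟨C, hC, h⟩ := exists_transHausdorffDist_le hm (τ := S'.real Set.univ + 1) (l := l) (by positivity) hl
    refine ⟨C, hC, fun K L S T hK hS hSQ hLc hLk hT s hs hmom => ?_⟩
    have hKs : IsSpread (S'.real Set.univ + 1) l K S :=
      hspread.of_integral_mul_eq hK (hS.isFacetMeasure hK.interior_nonempty) fun i j => by
        have h1 := congrFun (congrFun hSQ i) j
        simp only [rank2TensorMatrix, Matrix.of_apply] at h1
        exact mul_left_cancel₀ (by positivity) h1
    have hLs := hKs.of_isSurfaceAreaMeasure hm hl hLc hLk hT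
      (integral_mul_eq_of_moments fun i hi => hmom i (hi.trans hs))
    exact h K L S T hKs hLs s (by omega) fun i hi => (hmom i hi).symm
  · exact ⟨1, one_pos, fun K L S T hK hS hSQ => absurd ⟨K, S, hK, hS, hSQ⟩ hex⟩

end

/-- there is a constant `c` depending only on `n`, `ε` and the
rank-2 surface tensor `Φ_{n-1}²(K₀)` (formalized as a function `C` of the
coefficient matrix of the rank-2 tensor), such that for every convex body `K₀`
with nonempty interior and every convex body `K_{s₀}` whose surface tensors up
to rank `s₀ ≥ 2` coincide with those of `K₀` (i.e. whose surface area measure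
has the same moments up to order `s₀`),
`δᵗ(K₀, K_{s₀}) ≤ c · s₀^{-(1-ε)/(4n)}`; consequently any sequence of such
bodies converges in shape to `K₀`. -/
theorem stmt16 {n : ℕ} (hn : 2 ≤ n) (ε : ℝ) (hε0 : 0 < ε) (hε1 : ε < 1) :
    ∃ C : Matrix (Fin n) (Fin n) ℝ → ℝ,
      ∀ K₀ : Set (En n),
        Convex ℝ K₀ → IsCompact K₀ → (interior K₀).Nonempty →
      ∀ μ₀ : Measure (Sph n), IsSurfaceAreaMeasure K₀ μ₀ →
        (0 < C (rank2TensorMatrix μ₀)) ∧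
        (∀ s₀ : ℕ, 2 ≤ s₀ →
          ∀ K : Set (En n), Convex ℝ K → IsCompact K → K.Nonempty →
          ∀ μK : Measure (Sph n), IsSurfaceAreaMeasure K μK →
          (∀ i : Fin n → ℕ, (∑ j, i j) ≤ s₀ → sphMoment μK i = sphMoment μ₀ i) →
          transHausdorffDist K₀ K ≤
            C (rank2TensorMatrix μ₀) * (s₀ : ℝ) ^ (-(1 - ε) / (4 * (n : ℝ)))) ∧
        (∀ (Kseq : ℕ → Set (En n)) (μseq : ℕ → Measure (Sph n)),
          (∀ s₀ : ℕ, 2 ≤ s₀ →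
            Convex ℝ (Kseq s₀) ∧ IsCompact (Kseq s₀) ∧ (Kseq s₀).Nonempty ∧
            IsSurfaceAreaMeasure (Kseq s₀) (μseq s₀) ∧
            ∀ i : Fin n → ℕ, (∑ j, i j) ≤ s₀ →
              sphMoment (μseq s₀) i = sphMoment μ₀ i) →
          Tendsto (fun s₀ => transHausdorffDist K₀ (Kseq s₀)) atTop (𝓝 0)) := by
  obtain ⟨m, rfl⟩ : ∃ m, n = m + 1 := ⟨n - 1, by omega⟩
  choose C hC hbound using exists_const_of_rank2TensorMatrix (m := m) (by omega)
  refine ⟨C, fun K₀ hc hk hi μ₀ hμ₀ => ?_⟩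
  have hle : ∀ s₀ : ℕ, 2 ≤ s₀ → ∀ K : Set (En (m + 1)), Convex ℝ K → IsCompact K →
      ∀ μK : Measure (Sph (m + 1)), IsSurfaceAreaMeasure K μK →
      (∀ i : Fin (m + 1) → ℕ, (∑ j, i j) ≤ s₀ → sphMoment μK i = sphMoment μ₀ i) →
      transHausdorffDist K₀ K ≤
        C (rank2TensorMatrix μ₀) * (s₀ : ℝ) ^ (-(1 - ε) / (4 * ((m + 1 : ℕ) : ℝ))) := by
    intro s₀ hs₀ K hKc hKk μK hμK h
    refine (hbound _ K₀ K μ₀ μK ⟨hc, hk, hi⟩ hμ₀ rfl hKc hKk hμK s₀ hs₀ h).trans ?_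
    have h1 : (1 : ℝ) ≤ s₀ := by exact_mod_cast (by omega : 1 ≤ s₀)
    have h2 : (1 : ℝ) ≤ m := by exact_mod_cast (by omega : 1 ≤ m)
    refine mul_le_mul_of_nonneg_left (rpow_le_rpow_of_exponent_le h1 ?_) (hC _).le
    rw [neg_div, neg_le_neg_iff, ← one_div]
    push_cast
    rw [div_le_div_iff₀ (by positivity) (by positivity)]
    nlinarith
  refine ⟨hC _, fun s₀ hs₀ K hKc hKk _ => hle s₀ hs₀ K hKc hKk, fun Kseq μseq hseq => ?_⟩
  have hlim : Tendsto (fun s : ℕ => C (rank2TensorMatrix μ₀) *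
      (s : ℝ) ^ (-((1 - ε) / (4 * ((m + 1 : ℕ) : ℝ))))) atTop (𝓝 0) := by
    have h1 : 0 < (1 - ε) / (4 * ((m + 1 : ℕ) : ℝ)) := div_pos (by linarith) (by positivity)
    simpa using ((tendsto_rpow_neg_atTop h1).comp tendsto_natCast_atTop_atTop).const_mul
      (C (rank2TensorMatrix μ₀))
  refine squeeze_zero' (Eventually.of_forall fun s => transHausdorffDist_nonneg) ?_ hlim
  filter_upwards [eventually_ge_atTop 2] with s hs
  obtain ⟨h1, h2, -, h3, h4⟩ := hseq s hs
  rw [← neg_div]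
  exact hle s hs _ h1 h2 _ h3 h4
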